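/- The only pairs (x, y) ∈ ℚ × ℚ satisfying y² = x⁶ − 4x⁵ + 6x⁴ − 2x³ + x² − 2x + 1 are (x, y) ∈ {(0, 1), (0, −1), (1, 1), (1, −1)}. -/

import Mathlib

open Polynomial

namespace Q13

section forms
variable {R S : Type*} [CommRing R] [CommRing S]

noncomputable def P1 (n : Fin 2 → R) : R[X] := C (n 0) + C (n 1) * X
noncomputable def P2 (n : Fin 3 → R) : R[X] := C (n 0) + C (n 1) * X + C (n 2) * X ^ 2
noncomputable def P3 (n : Fin 4 → R) : R[X] :=
  C (n 0) + C (n 1) * X + C (n 2) * X ^ 2 + C (n 3) * X ^ 3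
noncomputable def P4 (n : Fin 5 → R) : R[X] :=
  C (n 0) + C (n 1) * X + C (n 2) * X ^ 2 + C (n 3) * X ^ 3 + C (n 4) * X ^ 4
noncomputable def hP (R : Type*) [CommRing R] : R[X] := X ^ 3 + X + 1
noncomputable def gP (R : Type*) [CommRing R] : R[X] := - X ^ 5 + X ^ 4 - X ^ 3 - X
noncomputable def fP (R : Type*) [CommRing R] : R[X] :=
  X ^ 6 - 4 * X ^ 5 + 6 * X ^ 4 - 2 * X ^ 3 + X ^ 2 - 2 * X + 1

lemma map_P1 (φ : R →+* S) (n : Fin 2 → R) : (P1 n).map φ = P1 (φ ∘ n) := by simp [P1]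
lemma map_P2 (φ : R →+* S) (n : Fin 3 → R) : (P2 n).map φ = P2 (φ ∘ n) := by simp [P2]
lemma map_P3 (φ : R →+* S) (n : Fin 4 → R) : (P3 n).map φ = P3 (φ ∘ n) := by simp [P3]
lemma map_P4 (φ : R →+* S) (n : Fin 5 → R) : (P4 n).map φ = P4 (φ ∘ n) := by simp [P4]
lemma map_hP (φ : R →+* S) : (hP R).map φ = hP S := by simp [hP]
lemma map_gP (φ : R →+* S) : (gP R).map φ = gP S := by simp [gP]
lemma map_fP (φ : R →+* S) : (fP R).map φ = fP S := by
  simp [fP, Polynomial.map_ofNat]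

lemma coef7 {e0 e1 e2 e3 e4 e5 e6 : R}
    (h : C e0 + C e1 * X + C e2 * X ^ 2 + C e3 * X ^ 3 + C e4 * X ^ 4 + C e5 * X ^ 5
      + C e6 * X ^ 6 = 0) :
    e0 = 0 ∧ e1 = 0 ∧ e2 = 0 ∧ e3 = 0 ∧ e4 = 0 ∧ e5 = 0 ∧ e6 = 0 := by
  have H := fun k => congrArg (fun p => coeff p k) h
  have h0 := H 0
  have h1 := H 1
  have h2 := H 2
  have h3 := H 3
  have h4 := H 4
  have h5 := H 5
  have h6 := H 6
  simp only [coeff_add, coeff_C_mul, coeff_X_pow, coeff_X, coeff_C, coeff_zero] at h0 h1 h2 h3 h4 h5 h6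
  norm_num at h0 h1 h2 h3 h4 h5 h6
  exact ⟨h0, h1, h2, h3, h4, h5, h6⟩

lemma coef7' {e0 e1 e2 e3 e4 e5 e6 d0 d1 d2 d3 d4 d5 d6 : R}
    (h : C e0 + C e1 * X + C e2 * X ^ 2 + C e3 * X ^ 3 + C e4 * X ^ 4 + C e5 * X ^ 5
      + C e6 * X ^ 6 = C d0 + C d1 * X + C d2 * X ^ 2 + C d3 * X ^ 3 + C d4 * X ^ 4 + C d5 * X ^ 5
      + C d6 * X ^ 6) :
    e0 = d0 ∧ e1 = d1 ∧ e2 = d2 ∧ e3 = d3 ∧ e4 = d4 ∧ e5 = d5 ∧ e6 = d6 := by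
  obtain ⟨h0, h1, h2, h3, h4, h5, h6⟩ := coef7 (e0 := e0 - d0) (e1 := e1 - d1) (e2 := e2 - d2)
    (e3 := e3 - d3) (e4 := e4 - d4) (e5 := e5 - d5) (e6 := e6 - d6)
    (by simp only [map_sub]; linear_combination h)
  simp only [sub_eq_zero] at *
  exact ⟨h0, h1, h2, h3, h4, h5, h6⟩

/-- coefficients of `B² + hB - g = n * w` -/
lemma coef_nw {B : Fin 4 → R} {n : Fin 3 → R} {w : Fin 5 → R}
    (h : P3 B ^ 2 + hP R * P3 B - gP R = P2 n * P4 w) :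
    B 0 ^ 2 + B 0 = n 0 * w 0 ∧
    2 * B 0 * B 1 + B 1 + B 0 + 1 = n 0 * w 1 + n 1 * w 0 ∧
    2 * B 0 * B 2 + B 1 ^ 2 + B 2 + B 1 = n 0 * w 2 + n 1 * w 1 + n 2 * w 0 ∧
    2 * B 0 * B 3 + 2 * B 1 * B 2 + B 3 + B 2 + B 0 + 1 = n 0 * w 3 + n 1 * w 2 + n 2 * w 1 ∧
    2 * B 1 * B 3 + B 2 ^ 2 + B 3 + B 1 - 1 = n 0 * w 4 + n 1 * w 3 + n 2 * w 2 ∧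
    2 * B 2 * B 3 + B 2 + 1 = n 1 * w 4 + n 2 * w 3 ∧
    B 3 ^ 2 + B 3 = n 2 * w 4 := by
  apply coef7'
  simp only [P3, P2, P4, hP, gP] at h
  simp only [map_sub, map_add, map_mul, map_pow, map_one, map_ofNat]
  linear_combination h

/-- the square of a quadratic form -/
def sq2 (m : Fin 3 → R) : Fin 5 → R :=
  ![m 0 ^ 2, 2 * m 0 * m 1, m 1 ^ 2 + 2 * m 0 * m 2, 2 * m 1 * m 2, m 2 ^ 2]

lemma P4_sq2 (m : Fin 3 → R) : P4 (sq2 m) = P2 m ^ 2 := by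
  simp [P4, sq2, P2, map_ofNat (C : R →+* R[X])]; ring

lemma P4_smul (c : R) (m : Fin 5 → R) : P4 (fun k => c * m k) = C c * P4 m := by
  simp [P4]; ring

lemma P2_sub (n m : Fin 3 → R) : P2 n - P2 m = P2 (fun k => n k - m k) := by
  simp [P2]; ring
lemma P2_smul (c : R) (n : Fin 3 → R) : C c * P2 n = P2 (fun k => c * n k) := by
  simp [P2]; ring

def MulEq (n m : Fin 3 → R) (B : Fin 4 → R) (c : R) : Prop :=
  P3 B ^ 2 + hP R * P3 B - gP R = C c * P2 n * P2 m ^ 2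

lemma MulEq.map (φ : R →+* S) {n m : Fin 3 → R} {B : Fin 4 → R} {c : R} (h : MulEq n m B c) :
    MulEq (φ ∘ n) (φ ∘ m) (φ ∘ B) (φ c) := by
  have := congrArg (Polynomial.map φ) h
  simpa [MulEq, Polynomial.map_sub, map_P2, map_P3, map_hP, map_gP] using this

lemma MulEq.nw {n m : Fin 3 → R} {B : Fin 4 → R} {c : R} (h : MulEq n m B c) :
    P3 B ^ 2 + hP R * P3 B - gP R = P2 n * P4 (fun k => c * sq2 m k) := by
  rw [P4_smul, P4_sq2, h]; ring

end forms

/-! ### The 2-adic closing argument -/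

def nd : Fin 9 → Fin 3 → ℤ :=
  ![![0,1,0], ![0,1,-1], ![1,0,0], ![0,1,-1], ![1,-1,0], ![0,0,1], ![1,-1,0], ![0,1,0], ![1,-2,1]]
def Bd : Fin 9 → Fin 4 → ℤ :=
  ![![0,-1,0,0], ![0,0,-1,0], ![0,-1,-1,0], ![0,-2,1,-1], ![0,-1,0,-1], ![0,-1,-1,0],
    ![-1,0,-1,0], ![-1,1,-2,0], ![0,-1,-1,0]]
def cd : Fin 9 → ℤ := ![1, 1, -1, -1, -1, -1, 1, -1, -1]

lemma data_eq (i : Fin 9) : MulEq (nd i) (nd (i + 1)) (Bd i) (cd i) := by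
  fin_cases i <;> simp [MulEq, nd, Bd, cd, P2, P3, hP, gP] <;> ring

lemma F2_unique : ∀ i : Fin 9, ∀ t0 t1 m0 m1 m2 B0 B1 B2 B3 : ZMod 2,
    B0 = Bd i 0 + nd i 0 * t0 →
    B1 = Bd i 1 + nd i 0 * t1 + nd i 1 * t0 →
    B2 = Bd i 2 + nd i 1 * t1 + nd i 2 * t0 →
    B3 = Bd i 3 + nd i 2 * t1 →
    B0 ^ 2 + B0 = nd i 0 * m0 ^ 2 →
    B1 + B0 + 1 = nd i 1 * m0 ^ 2 →
    B1 ^ 2 + B2 + B1 = nd i 0 * m1 ^ 2 + nd i 2 * m0 ^ 2 →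
    B3 + B2 + B0 + 1 = nd i 1 * m1 ^ 2 →
    B2 ^ 2 + B3 + B1 - 1 = nd i 0 * m2 ^ 2 + nd i 2 * m1 ^ 2 →
    B2 + 1 = nd i 1 * m2 ^ 2 →
    B3 ^ 2 + B3 = nd i 2 * m2 ^ 2 →
    B0 = Bd i 0 ∧ B1 = Bd i 1 ∧ B2 = Bd i 2 ∧ B3 = Bd i 3 ∧
      m0 = nd (i + 1) 0 ∧ m1 = nd (i + 1) 1 ∧ m2 = nd (i + 1) 2 := by
  intro i t0 t1 m0 m1 m2 B0 B1 B2 B3 h0 h1 h2 h3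
  subst h0 h1 h2 h3
  revert i t0 t1 m0 m1 m2
  decide +kernel

lemma F2_next : ∀ i : Fin 9, ∃ t0 t1 : ZMod 2,
    (Bd i 0 : ZMod 2) = Bd (i + 1) 0 + nd (i + 1) 0 * t0 ∧
    (Bd i 1 : ZMod 2) = Bd (i + 1) 1 + nd (i + 1) 0 * t1 + nd (i + 1) 1 * t0 ∧
    (Bd i 2 : ZMod 2) = Bd (i + 1) 2 + nd (i + 1) 1 * t1 + nd (i + 1) 2 * t0 ∧
    (Bd i 3 : ZMod 2) = Bd (i + 1) 3 + nd (i + 1) 2 * t1 := by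
  decide +kernel

lemma F2_zero : ∀ i : Fin 9, ∀ d0 d1 d2 e0 e1 e2 e3 : ZMod 2,
    d0 * nd i 0 ^ 2 = e0 →
    d1 * nd i 0 ^ 2 = e1 + e0 →
    d2 * nd i 0 ^ 2 + d0 * nd i 1 ^ 2 = e2 + e1 →
    d1 * nd i 1 ^ 2 = e3 + e2 + e0 →
    d2 * nd i 1 ^ 2 + d0 * nd i 2 ^ 2 = e3 + e1 →
    d1 * nd i 2 ^ 2 = e2 →
    d2 * nd i 2 ^ 2 = e3 →
    d0 = 0 ∧ d1 = 0 ∧ d2 = 0 ∧ e0 = 0 ∧ e1 = 0 ∧ e2 = 0 ∧ e3 = 0 := by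
  intro i d0 d1 d2 e0 e1 e2 e3 h0 h1 h2 h3 h4 h5 h6
  obtain rfl : e1 = d1 * nd i 0 ^ 2 - e0 := by linear_combination -h1
  subst h0 h5 h6
  clear h1
  revert i d0 d1 d2
  decide +kernel

abbrev Z2 := ℤ_[2]

/-- reduction mod 2 -/
noncomputable abbrev rd : Z2 →+* ZMod 2 := PadicInt.toZMod

lemma rd_eq_zero {x : Z2} : rd x = 0 ↔ ∃ y, x = 2 * y := by
  rw [← RingHom.mem_ker, PadicInt.ker_toZMod, PadicInt.maximalIdeal_eq_span_p,
    Ideal.mem_span_singleton]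
  rfl

lemma rd_unit {x : Z2} (h : rd x ≠ 0) : IsUnit x := by
  by_contra hx
  apply h
  rw [← RingHom.mem_ker, PadicInt.ker_toZMod]
  exact hx

lemma rd_of_unit {x : Z2} (h : IsUnit x) : rd x = 1 := by
  have := h.map rd
  have h2 : ∀ a : ZMod 2, a ≠ 0 → a = 1 := by decide
  exact h2 _ this.ne_zero

lemma two_ne : (2 : Z2) ≠ 0 := by norm_num

lemma pow_two_dvd_all {x : Z2} (h : ∀ j : ℕ, (2 : Z2) ^ (j + 1) ∣ x) : x = 0 := by
  by_contra hx
  have h1 := h x.valuation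
  have := (PadicInt.mem_span_pow_iff_le_valuation x hx (x.valuation + 1)).1
    (Ideal.mem_span_singleton.2 (by exact_mod_cast h1))
  omega

/-- class `i` mod 2 -/
def Cls (i : Fin 9) (n : Fin 3 → Z2) (A : Fin 4 → Z2) : Prop :=
  (∀ k, rd (n k) = nd i k) ∧ ∃ t0 t1 : ZMod 2,
    rd (A 0) = Bd i 0 + nd i 0 * t0 ∧
    rd (A 1) = Bd i 1 + nd i 0 * t1 + nd i 1 * t0 ∧
    rd (A 2) = Bd i 2 + nd i 1 * t1 + nd i 2 * t0 ∧
    rd (A 3) = Bd i 3 + nd i 2 * t1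

def Stp (n : Fin 3 → Z2) (A : Fin 4 → Z2) (m : Fin 3 → Z2) (B : Fin 4 → Z2) (c : Z2) : Prop :=
  IsUnit c ∧ MulEq n m B c ∧ ∃ l : Fin 2 → Z2, P3 B = P3 A + P2 n * P1 l

lemma cls_step {i : Fin 9} {n : Fin 3 → Z2} {A : Fin 4 → Z2} {m : Fin 3 → Z2} {B : Fin 4 → Z2}
    {c : Z2} (hc : Cls i n A) (hs : Stp n A m B c) :
    (∀ k, rd (B k) = Bd i k) ∧ Cls (i + 1) m B := by
  obtain ⟨hn, t0, t1, hA0, hA1, hA2, hA3⟩ := hc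
  obtain ⟨hu, hm, l, hl⟩ := hs
  have hl' : B 0 = A 0 + n 0 * l 0 ∧ B 1 = A 1 + n 0 * l 1 + n 1 * l 0 ∧
      B 2 = A 2 + n 1 * l 1 + n 2 * l 0 ∧ B 3 = A 3 + n 2 * l 1 ∧ (0 : Z2) = 0 ∧ (0 : Z2) = 0
        ∧ (0 : Z2) = 0 := by
    apply coef7'
    simp only [P3, P2, P1] at hl
    simp only [map_add, map_mul, map_zero]
    linear_combination hl
  obtain ⟨h0, h1, h2, h3, -, -, -⟩ := hl'
  have hm' := coef_nw (hm.map rd).nw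
  simp [sq2, rd_of_unit hu, hn, -ZMod.pow_card] at hm'
  have two : (2 : ZMod 2) = 0 := rfl
  simp only [two, zero_mul, mul_zero, add_zero, zero_add] at hm'
  obtain ⟨g0, g1, g2, g3, g4, g5, g6⟩ := hm'
  replace h0 := congrArg rd h0
  replace h1 := congrArg rd h1
  replace h2 := congrArg rd h2
  replace h3 := congrArg rd h3
  simp only [map_add, map_mul, hA0, hA1, hA2, hA3, hn] at h0 h1 h2 h3
  obtain ⟨r0, r1, r2, r3, r4, r5, r6⟩ := F2_unique i (t0 + rd (l 0)) (t1 + rd (l 1)) (rd (m 0))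
    (rd (m 1)) (rd (m 2)) (rd (B 0)) (rd (B 1)) (rd (B 2)) (rd (B 3))
    (by rw [h0]; ring) (by rw [h1]; ring) (by rw [h2]; ring) (by rw [h3]; ring) g0 g1 g2 g3 g4 g5 g6
  refine ⟨?_, ?_, ?_⟩
  · intro k; fin_cases k <;> assumption
  · intro k; fin_cases k <;> assumption
  · obtain ⟨s0, s1, q0, q1, q2, q3⟩ := F2_next i
    exact ⟨s0, s1, by rw [r0, q0], by rw [r1, q1], by rw [r2, q2], by rw [r3, q3]⟩

lemma core_step {R : Type*} [CommRing R] [IsDomain R] {n m ni n' : Fin 3 → R} {B b : Fin 4 → R}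
    {c ci u p q p' p1 : R} {D μ : Fin 3 → R} {E : Fin 4 → R}
    (h1 : MulEq n m B c) (h2 : MulEq ni n' b ci) (hD : ∀ k, c * u ^ 2 * n k - ci * ni k = p * D k)
    (hB : ∀ k, B k = b k + p * E k) (hm : ∀ k, m k = u * n' k + p * q * μ k)
    (hpq : p * q = 2 * p') (hp : p = 2 * p1) (hp0 : p ≠ 0) :
    ∃ Y : R[X], P2 D * P2 n' ^ 2 = hP R * P3 E + 2 * Y := by
  have hD' : C c * C u ^ 2 * P2 n - C ci * P2 ni = C p * P2 D := by
    have h0 := congrArg (C : R →+* R[X]) (hD 0)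
    have h1 := congrArg (C : R →+* R[X]) (hD 1)
    have h2 := congrArg (C : R →+* R[X]) (hD 2)
    simp only [map_sub, map_mul, map_pow] at h0 h1 h2
    simp only [P2]
    linear_combination h0 + X * h1 + X ^ 2 * h2
  have hB' : P3 B = P3 b + C p * P3 E := by
    simp only [P3, hB, map_add, map_mul]; ring
  have hm' : P2 m = C u * P2 n' + C p * C q * P2 μ := by
    simp only [P2, hm, map_add, map_mul]; ring
  have hpq' : C p * C q = 2 * C p' := by
    have := congrArg (C : R →+* R[X]) hpq
    simpa only [map_mul, map_ofNat] using this
  have hpp : C p = 2 * C p1 := by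
    have := congrArg (C : R →+* R[X]) hp
    simpa only [map_mul, map_ofNat] using this
  have hC : (C p : R[X]) ≠ 0 := by simpa using hp0
  refine ⟨P3 b * P3 E + C p1 * P3 E ^ 2 - C q * C c * C u * P2 n * P2 n' * P2 μ
    - C p' * C q * C c * P2 n * P2 μ ^ 2, ?_⟩
  apply mul_left_cancel₀ hC
  unfold MulEq at h1 h2
  rw [hB', hm'] at h1
  linear_combination (- P2 n' ^ 2) * hD' + h2 - h1 + (C p * P3 E ^ 2) * hpp
    - (C p * C q * C c * P2 n * P2 μ ^ 2) * hpq'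

lemma inner_step {i : Fin 9} {l j : ℕ} {n m : Fin 3 → Z2} {B : Fin 4 → Z2} {c u : Z2}
    (h1 : MulEq n m B c) (hl : l + 1 ≤ j)
    (hD : ∀ k, (2 : Z2) ^ (l + 1) ∣ c * u ^ 2 * n k - cd i * nd i k)
    (hB : ∀ k, (2 : Z2) ^ (l + 1) ∣ B k - Bd i k)
    (hm : ∀ k, (2 : Z2) ^ j ∣ m k - u * nd (i + 1) k) :
    (∀ k, (2 : Z2) ^ (l + 2) ∣ c * u ^ 2 * n k - cd i * nd i k) ∧
    (∀ k, (2 : Z2) ^ (l + 2) ∣ B k - Bd i k) := by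
  choose D hD using hD
  choose E hE using hB
  choose μ hμ using hm
  obtain ⟨s, rfl⟩ := Nat.exists_eq_add_of_le hl
  obtain ⟨Y, hY⟩ := core_step (R := Z2) (n := n) (m := m) (ni := fun k => (nd i k : Z2))
    (n' := fun k => (nd (i + 1) k : Z2)) (B := B) (b := fun k => (Bd i k : Z2)) (c := c)
    (ci := cd i) (u := u) (p := 2 ^ (l + 1)) (q := 2 ^ s) (p' := 2 ^ (l + s)) (p1 := 2 ^ l)
    (D := D) (μ := μ) (E := E) h1 ((data_eq i).map (Int.castRingHom Z2)) hD
    (fun k => by linear_combination hE k)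
    (fun k => by linear_combination hμ k) (by ring) (by ring) (pow_ne_zero _ two_ne)
  have hY' := congrArg (Polynomial.map rd) hY
  have two : (2 : (ZMod 2)[X]) = 0 := by
    have : (2 : ZMod 2) = 0 := rfl
    rw [← map_ofNat (C : ZMod 2 →+* (ZMod 2)[X]) 2, this, map_zero]
  simp only [Polynomial.map_mul, Polynomial.map_add, Polynomial.map_pow, map_P2, map_P3, map_hP,
    Polynomial.map_ofNat, two, zero_mul, add_zero] at hY'
  have key : rd (D 0) * nd (i + 1) 0 ^ 2 = rd (E 0) ∧
    rd (D 1) * nd (i + 1) 0 ^ 2 = rd (E 1) + rd (E 0) ∧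
    rd (D 2) * nd (i + 1) 0 ^ 2 + rd (D 0) * nd (i + 1) 1 ^ 2 = rd (E 2) + rd (E 1) ∧
    rd (D 1) * nd (i + 1) 1 ^ 2 = rd (E 3) + rd (E 2) + rd (E 0) ∧
    rd (D 2) * nd (i + 1) 1 ^ 2 + rd (D 0) * nd (i + 1) 2 ^ 2 = rd (E 3) + rd (E 1) ∧
    rd (D 1) * nd (i + 1) 2 ^ 2 = rd (E 2) ∧
    rd (D 2) * nd (i + 1) 2 ^ 2 = rd (E 3) := by
    apply coef7'
    simp only [P2, P3, hP, Function.comp, map_intCast] at hY'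
    simp only [map_add, map_mul, map_pow, map_intCast]
    linear_combination hY' - two * (C (rd (D 0)) + C (rd (D 1)) * X + C (rd (D 2)) * X ^ 2) *
      ((nd (i + 1) 0 : (ZMod 2)[X]) * nd (i + 1) 1 * X + (nd (i + 1) 0 : (ZMod 2)[X]) * nd (i + 1) 2 * X ^ 2
        + (nd (i + 1) 1 : (ZMod 2)[X]) * nd (i + 1) 2 * X ^ 3)
  obtain ⟨k0, k1, k2, k3, k4, k5, k6⟩ := key
  obtain ⟨d0, d1, d2, e0, e1, e2, e3⟩ := F2_zero (i + 1) _ _ _ _ _ _ _ k0 k1 k2 k3 k4 k5 k6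
  rw [rd_eq_zero] at d0 d1 d2 e0 e1 e2 e3
  constructor
  · have : ∀ k, ∃ y, D k = 2 * y := by intro k; fin_cases k <;> assumption
    intro k
    obtain ⟨y, hy⟩ := this k
    exact ⟨y, by rw [hD k, hy]; ring⟩
  · have : ∀ k, ∃ y, E k = 2 * y := by intro k; fin_cases k <;> assumption
    intro k
    obtain ⟨y, hy⟩ := this k
    exact ⟨y, by rw [hE k, hy]; ring⟩

lemma cd_one : ∀ i : Fin 9, ((cd i : ℤ) : ZMod 2) = 1 := by decide
lemma cd_unit : ∀ i : Fin 9, IsUnit (cd i) := by decide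

theorem closing (G : Set ((Fin 3 → Z2) × (Fin 4 → Z2)))
    (hG : ∀ s ∈ G, ∃ t ∈ G, ∃ c, Stp s.1 s.2 t.1 t.2 c) (j : ℕ) :
    ∀ s ∈ G, ∀ i, Cls i s.1 s.2 → ∃ u : Z2, IsUnit u ∧ ∀ k, (2 : Z2) ^ (j + 1) ∣ s.1 k - u * nd i k := by
  induction j with
  | zero =>
    intro s hs i hc
    refine ⟨1, isUnit_one, fun k => ?_⟩
    have := hc.1 k
    have h0 : rd (s.1 k - 1 * nd i k) = 0 := by simp [this]
    obtain ⟨y, hy⟩ := rd_eq_zero.1 h0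
    exact ⟨y, by rw [hy]; ring⟩
  | succ j ih =>
    intro s hs i hc
    obtain ⟨t, ht, c, hst⟩ := hG s hs
    obtain ⟨hB, hc'⟩ := cls_step hc hst
    obtain ⟨u, hu, hm⟩ := ih t ht (i + 1) hc'
    have hcu : IsUnit (c * u ^ 2) := hst.1.mul (hu.pow 2)
    have main : ∀ l, l ≤ j + 1 →
      (∀ k, (2 : Z2) ^ (l + 1) ∣ c * u ^ 2 * s.1 k - cd i * nd i k) ∧
      (∀ k, (2 : Z2) ^ (l + 1) ∣ t.2 k - Bd i k) := by
      intro l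
      induction l with
      | zero =>
        intro _
        have hcd : ((cd i : ℤ) : ZMod 2) = 1 := cd_one i
        constructor
        · intro k
          have h0 : rd (c * u ^ 2 * s.1 k - cd i * nd i k) = 0 := by
            rw [map_sub, map_mul, rd_of_unit hcu, hc.1 k]; simp [hcd]
          obtain ⟨y, hy⟩ := rd_eq_zero.1 h0
          exact ⟨y, by rw [hy]; ring⟩
        · intro k
          have h0 : rd (t.2 k - Bd i k) = 0 := by simp [hB k]
          obtain ⟨y, hy⟩ := rd_eq_zero.1 h0
          exact ⟨y, by rw [hy]; ring⟩
      | succ l ihl =>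
        intro hl
        obtain ⟨a1, a2⟩ := ihl (by omega)
        exact inner_step hst.2.1 hl a1 a2 hm
    obtain ⟨a1, -⟩ := main (j + 1) le_rfl
    obtain ⟨v, hv⟩ := hcu
    have hcd : IsUnit (cd i : Z2) := by
      have : IsUnit (cd i) := cd_unit i
      exact this.map (Int.castRingHom Z2)
    refine ⟨↑v⁻¹ * cd i, (Units.isUnit _).mul hcd, fun k => ?_⟩
    obtain ⟨y, hy⟩ := a1 k
    refine ⟨↑v⁻¹ * y, ?_⟩
    rw [← hv] at hy
    have hvv : (↑v⁻¹ : Z2) * v = 1 := by simp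
    linear_combination (↑v⁻¹ : Z2) * hy - s.1 k * hvv

theorem closing' (G : Set ((Fin 3 → Z2) × (Fin 4 → Z2)))
    (hG : ∀ s ∈ G, ∃ t ∈ G, ∃ c, Stp s.1 s.2 t.1 t.2 c) (s) (hs : s ∈ G) (i : Fin 9)
    (hc : Cls i s.1 s.2) (a b : Fin 3) : s.1 a * nd i b = s.1 b * nd i a := by
  rw [← sub_eq_zero]
  apply pow_two_dvd_all
  intro j
  obtain ⟨u, hu, h⟩ := closing G hG j s hs i hc
  obtain ⟨y, hy⟩ := h a
  obtain ⟨z, hz⟩ := h b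
  exact ⟨y * nd i b - z * nd i a, by linear_combination (nd i b : Z2) * hy - (nd i a : Z2) * hz⟩

end Q13
open Polynomial

namespace Q13

lemma coef_quartic {R : Type*} [CommRing R] {n m : Fin 3 → R} {A : Fin 4 → R} {w : Fin 5 → R}
    {t : Fin 2 → R} {q c : R}
    (h : C q ^ 2 * P4 w + C q * P1 t * (2 * P3 A + hP R) + P2 n * P1 t ^ 2 = C c * P2 m ^ 2) :
    q ^ 2 * w 0 + q * (t 0 * (2 * A 0 + 1)) + n 0 * t 0 ^ 2 = c * m 0 ^ 2 ∧
    q ^ 2 * w 1 + q * (t 0 * (2 * A 1 + 1) + t 1 * (2 * A 0 + 1)) + (n 1 * t 0 ^ 2 + 2 * n 0 * t 0 * t 1)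
      = c * (2 * m 0 * m 1) ∧
    q ^ 2 * w 2 + q * (t 0 * (2 * A 2) + t 1 * (2 * A 1 + 1))
      + (n 2 * t 0 ^ 2 + 2 * n 1 * t 0 * t 1 + n 0 * t 1 ^ 2) = c * (m 1 ^ 2 + 2 * m 0 * m 2) ∧
    q ^ 2 * w 3 + q * (t 0 * (2 * A 3 + 1) + t 1 * (2 * A 2)) + (n 1 * t 1 ^ 2 + 2 * n 2 * t 0 * t 1)
      = c * (2 * m 1 * m 2) ∧
    q ^ 2 * w 4 + q * (t 1 * (2 * A 3 + 1)) + n 2 * t 1 ^ 2 = c * m 2 ^ 2 := by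
  have : _ ∧ _ ∧ _ ∧ _ ∧ _ ∧ (0 : R) = 0 ∧ (0 : R) = 0 := coef7' (R := R) 
    (e0 := q ^ 2 * w 0 + q * (t 0 * (2 * A 0 + 1)) + n 0 * t 0 ^ 2) (d0 := c * m 0 ^ 2)
    (e1 := q ^ 2 * w 1 + q * (t 0 * (2 * A 1 + 1) + t 1 * (2 * A 0 + 1)) + (n 1 * t 0 ^ 2 + 2 * n 0 * t 0 * t 1))
    (d1 := c * (2 * m 0 * m 1))
    (e2 := q ^ 2 * w 2 + q * (t 0 * (2 * A 2) + t 1 * (2 * A 1 + 1))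
      + (n 2 * t 0 ^ 2 + 2 * n 1 * t 0 * t 1 + n 0 * t 1 ^ 2)) (d2 := c * (m 1 ^ 2 + 2 * m 0 * m 2))
    (e3 := q ^ 2 * w 3 + q * (t 0 * (2 * A 3 + 1) + t 1 * (2 * A 2)) + (n 1 * t 1 ^ 2 + 2 * n 2 * t 0 * t 1))
    (d3 := c * (2 * m 1 * m 2))
    (e4 := q ^ 2 * w 4 + q * (t 1 * (2 * A 3 + 1)) + n 2 * t 1 ^ 2) (d4 := c * m 2 ^ 2)
    (by
      simp only [P2, P3, P4, P1, hP] at h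
      simp only [map_add, map_mul, map_pow, map_zero, map_one, map_ofNat]
      linear_combination h)
  obtain ⟨h0, h1, h2, h3, h4, -, -⟩ := this
  exact ⟨h0, h1, h2, h3, h4⟩

lemma F2_nl : ∀ n0 n1 n2 t0 t1 : ZMod 2, n0 * t0 ^ 2 = 0 → n1 * t0 ^ 2 = 0 →
    n2 * t0 ^ 2 + n0 * t1 ^ 2 = 0 → n1 * t1 ^ 2 = 0 → n2 * t1 ^ 2 = 0 →
    (n0 ≠ 0 ∨ n1 ≠ 0 ∨ n2 ≠ 0) → (t0 ≠ 0 ∨ t1 ≠ 0) → False := by decide +kernel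

lemma F2_h : ∀ x z : ZMod 2, (x ≠ 0 ∨ z ≠ 0) → z ^ 3 + x * z ^ 2 + x ^ 3 ≠ 0 := by decide +kernel

lemma no_pole {n m : Fin 3 → Z2} {A : Fin 4 → Z2} {w : Fin 5 → Z2} {t : Fin 2 → Z2} {e : ℕ} {c : Z2}
    (hn : rd (n 0) ≠ 0 ∨ rd (n 1) ≠ 0 ∨ rd (n 2) ≠ 0) (ht : rd (t 0) ≠ 0 ∨ rd (t 1) ≠ 0)
    (h : C (2 ^ (e + 1)) ^ 2 * P4 w + C (2 ^ (e + 1)) * P1 t * (2 * P3 A + hP Z2) + P2 n * P1 t ^ 2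
      = C c * P2 m ^ 2) : False := by
  obtain ⟨h0, h1, h2, h3, h4⟩ := coef_quartic h
  have two : (2 : ZMod 2) = 0 := rfl
  have r2 : rd 2 = 0 := by rw [map_ofNat]; rfl
  have rq : rd (2 ^ (e + 1)) = 0 := by rw [map_pow, r2]; simp
  have hq : (2 : Z2) ^ (e + 1) ≠ 0 := pow_ne_zero _ two_ne
  have hcu : IsUnit c := by
    apply rd_unit
    intro hc
    apply F2_nl (rd (n 0)) (rd (n 1)) (rd (n 2)) (rd (t 0)) (rd (t 1)) _ _ _ _ _ hn ht
    · simpa only [map_add, map_mul, map_pow, r2, rq, hc, zero_mul, zero_add, add_zero, ne_eq,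
        OfNat.ofNat_ne_zero, not_false_eq_true, zero_pow] using congrArg rd h0
    · simpa only [map_add, map_mul, map_pow, r2, rq, hc, zero_mul, zero_add, add_zero, ne_eq,
        OfNat.ofNat_ne_zero, not_false_eq_true, zero_pow] using congrArg rd h1
    · simpa only [map_add, map_mul, map_pow, r2, rq, hc, zero_mul, zero_add, add_zero, ne_eq,
        OfNat.ofNat_ne_zero, not_false_eq_true, zero_pow] using congrArg rd h2
    · simpa only [map_add, map_mul, map_pow, r2, rq, hc, zero_mul, zero_add, add_zero, ne_eq,
        OfNat.ofNat_ne_zero, not_false_eq_true, zero_pow] using congrArg rd h3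
    · simpa only [map_add, map_mul, map_pow, r2, rq, hc, zero_mul, zero_add, add_zero, ne_eq,
        OfNat.ofNat_ne_zero, not_false_eq_true, zero_pow] using congrArg rd h4
  obtain ⟨x, hx⟩ : ∃ x, x = t 0 := ⟨_, rfl⟩
  obtain ⟨z, hz⟩ : ∃ z, z = - t 1 := ⟨_, rfl⟩
  have ht0 : t 0 = x := hx.symm
  have ht1 : t 1 = - z := by rw [hz]; ring
  obtain ⟨q, hqq⟩ : ∃ q : Z2, q = 2 ^ (e + 1) := ⟨_, rfl⟩
  simp only [ht0, ht1] at h0 h1 h2 h3 h4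
  rw [← hqq] at h0 h1 h2 h3 h4 hq rq
  have E0 : q ^ 2 * (w 0 * z ^ 4 + w 1 * x * z ^ 3 + w 2 * x ^ 2 * z ^ 2 + w 3 * x ^ 3 * z
      + w 4 * x ^ 4) = c * (m 0 * z ^ 2 + m 1 * x * z + m 2 * x ^ 2) ^ 2 := by
    linear_combination z ^ 4 * h0 + x * z ^ 3 * h1 + x ^ 2 * z ^ 2 * h2 + x ^ 3 * z * h3 + x ^ 4 * h4
  obtain ⟨M, hM⟩ : q ∣ m 0 * z ^ 2 + m 1 * x * z + m 2 * x ^ 2 := by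
    have : q ^ 2 ∣ (m 0 * z ^ 2 + m 1 * x * z + m 2 * x ^ 2) ^ 2 := by
      rw [← hcu.dvd_mul_left, ← E0]
      exact dvd_mul_right _ _
    exact (IsIntegrallyClosed.pow_dvd_pow_iff (by norm_num)).1 this
  obtain ⟨dx, dz, hd⟩ : ∃ dx dz : Z2, x * dz - z * dx = 1 := by
    rcases ht with ht | ht
    · obtain ⟨v, hv⟩ := rd_unit ht
      refine ⟨0, ↑v⁻¹, ?_⟩
      rw [hx, ← hv]; simp
    · obtain ⟨v, hv⟩ := rd_unit ht
      refine ⟨↑v⁻¹, 0, ?_⟩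
      rw [hz, ← hv]; simp
  have E1 : q * ((2 * A 0 + 1) * z ^ 3 + (2 * A 1 + 1) * x * z ^ 2 + 2 * A 2 * x ^ 2 * z
        + (2 * A 3 + 1) * x ^ 3)
      + q ^ 2 * (w 0 * (4 * z ^ 3 * dz) + w 1 * (dx * z ^ 3 + 3 * x * z ^ 2 * dz)
        + w 2 * (2 * x * dx * z ^ 2 + 2 * x ^ 2 * z * dz) + w 3 * (3 * x ^ 2 * dx * z + x ^ 3 * dz)
        + w 4 * (4 * x ^ 3 * dx)) =
      2 * c * (m 0 * z ^ 2 + m 1 * x * z + m 2 * x ^ 2) *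
        (m 0 * (2 * z * dz) + m 1 * (dx * z + x * dz) + m 2 * (2 * x * dx)) := by
    linear_combination (4 * z ^ 3 * dz) * h0 + (dx * z ^ 3 + 3 * x * z ^ 2 * dz) * h1 +
      (2 * x * dx * z ^ 2 + 2 * x ^ 2 * z * dz) * h2 + (3 * x ^ 2 * dx * z + x ^ 3 * dz) * h3 +
      (4 * x ^ 3 * dx) * h4 - q * ((2 * A 0 + 1) * z ^ 3 + (2 * A 1 + 1) * x * z ^ 2
        + 2 * A 2 * x ^ 2 * z + (2 * A 3 + 1) * x ^ 3) * hd
  rw [hM] at E1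
  have E2 : ((2 * A 0 + 1) * z ^ 3 + (2 * A 1 + 1) * x * z ^ 2 + 2 * A 2 * x ^ 2 * z
        + (2 * A 3 + 1) * x ^ 3)
      + q * (w 0 * (4 * z ^ 3 * dz) + w 1 * (dx * z ^ 3 + 3 * x * z ^ 2 * dz)
        + w 2 * (2 * x * dx * z ^ 2 + 2 * x ^ 2 * z * dz) + w 3 * (3 * x ^ 2 * dx * z + x ^ 3 * dz)
        + w 4 * (4 * x ^ 3 * dx)) =
      2 * (c * M *
        (m 0 * (2 * z * dz) + m 1 * (dx * z + x * dz) + m 2 * (2 * x * dx))) := by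
    apply mul_left_cancel₀ hq
    linear_combination E1
  have E3 := congrArg rd E2
  rw [map_add, map_mul rd q, map_mul rd 2, rq, r2, zero_mul, zero_mul, add_zero] at E3
  simp only [map_add, map_mul, map_pow, r2, zero_mul, zero_add, map_one, one_mul, add_zero] at E3
  refine F2_h (rd x) (rd z) ?_ E3
  rw [hx, hz, map_neg]
  simpa using ht

lemma F2_ns : ∀ B0 B1 B2 B3 : ZMod 2, B0 ^ 2 + B0 = 0 → B1 + B0 + 1 = 0 → B1 ^ 2 + B2 + B1 = 0 →
    B3 + B2 + B0 + 1 = 0 → B2 ^ 2 + B3 + B1 - 1 = 0 → B2 + 1 = 0 → B3 ^ 2 + B3 = 0 → False := by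
  decide +kernel

abbrev Q2 := ℚ_[2]
noncomputable abbrev cz : Z2 →+* Q2 := PadicInt.Coe.ringHom

lemma cz_two : cz 2 = 2 := map_ofNat cz 2

lemma cz_inj : Function.Injective cz := Subtype.coe_injective

lemma exists_den (x : Q2) : ∃ e : ℕ, ∃ y : Z2, cz y = 2 ^ e * x := by
  obtain ⟨e, he⟩ := pow_unbounded_of_one_lt ‖x‖ (one_lt_two)
  refine ⟨e, ⟨2 ^ e * x, ?_⟩, rfl⟩
  have h2 : ‖(2 : Q2)‖ = 2⁻¹ := by simpa using Padic.norm_p (p := 2)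
  rw [norm_mul, norm_pow, h2, inv_pow, inv_mul_le_iff₀ (by positivity)]
  linarith

lemma exists_den2 (l : Fin 2 → Q2) : ∃ e : ℕ, ∃ t : Fin 2 → Z2, (∀ k, cz (t k) = 2 ^ e * l k) ∧
    (e = 0 ∨ rd (t 0) ≠ 0 ∨ rd (t 1) ≠ 0) := by
  classical
  have hex : ∃ e : ℕ, ∃ t : Fin 2 → Z2, (∀ k, cz (t k) = 2 ^ e * l k) := by
    obtain ⟨e0, y0, h0⟩ := exists_den (l 0)
    obtain ⟨e1, y1, h1⟩ := exists_den (l 1)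
    refine ⟨e0 + e1, ![2 ^ e1 * y0, 2 ^ e0 * y1], ?_⟩
    intro k
    fin_cases k
    · simp only [Fin.zero_eta, Matrix.cons_val_zero, map_mul, map_pow, map_ofNat, h0]; ring
    · simp [cz_two, h1]; ring
  obtain ⟨t, ht⟩ := Nat.find_spec hex
  refine ⟨Nat.find hex, t, ht, ?_⟩
  by_contra hcon
  push Not at hcon
  obtain ⟨he, t0, t1⟩ := hcon
  obtain ⟨y0, t0⟩ := rd_eq_zero.1 t0
  obtain ⟨y1, t1⟩ := rd_eq_zero.1 t1
  obtain ⟨e, he'⟩ := Nat.exists_eq_succ_of_ne_zero he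
  apply Nat.find_min hex (m := e) (by omega)
  rw [he'] at ht
  have z2 : (2 : Q2) ≠ 0 := by norm_num
  refine ⟨![y0, y1], ?_⟩
  intro k
  have := ht k
  apply mul_left_cancel₀ z2
  fin_cases k
  · simp only [Fin.zero_eta, t0, map_mul, map_ofNat] at this
    simp [this]; ring
  · simp only [Fin.mk_one, t1, map_mul, map_ofNat] at this
    simp [this]; ring

theorem integrality {n m : Fin 3 → Z2} {A : Fin 4 → Z2} {w : Fin 5 → Z2}
    (hn : rd (n 0) ≠ 0 ∨ rd (n 1) ≠ 0 ∨ rd (n 2) ≠ 0)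
    (hm : rd (m 0) ≠ 0 ∨ rd (m 1) ≠ 0 ∨ rd (m 2) ≠ 0)
    (hA : P3 A ^ 2 + hP Z2 * P3 A - gP Z2 = P2 n * P4 w)
    {B : Fin 4 → Q2} {c : Q2} {l : Fin 2 → Q2} (hB : MulEq (cz ∘ n) (cz ∘ m) B c)
    (hl : P3 B = P3 (cz ∘ A) + P2 (cz ∘ n) * P1 l) :
    ∃ (B' : Fin 4 → Z2) (c' : Z2), (∀ k, cz (B' k) = B k) ∧ cz c' = c ∧ Stp n A m B' c' := by
  obtain ⟨e, t, ht, het⟩ := exists_den2 l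
  have hn0 : P2 n ≠ 0 := by
    intro h
    have := coef7' (R := Z2) (e0 := n 0) (e1 := n 1) (e2 := n 2) (e3 := 0) (e4 := 0) (e5 := 0)
      (e6 := 0) (d0 := 0) (d1 := 0) (d2 := 0) (d3 := 0) (d4 := 0) (d5 := 0) (d6 := 0)
      (by simp only [P2] at h; simp only [map_zero]; linear_combination h)
    simp [this.1, this.2.1, this.2.2.1] at hn
  have hn0' : P2 (cz ∘ n) ≠ 0 := by
    rw [← map_P2]; exact (Polynomial.map_ne_zero_iff cz_inj).2 hn0
  have hA' := congrArg (Polynomial.map cz) hA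
  simp only [Polynomial.map_sub, Polynomial.map_add, Polynomial.map_mul, Polynomial.map_pow, map_P2,
    map_P3, map_P4, map_hP, map_gP] at hA'
  have htl : P1 (cz ∘ t) = C (2 ^ e) * P1 l := by
    simp only [P1, Function.comp, ht, map_mul]; ring
  have key : C (2 ^ e) ^ 2 * P4 (cz ∘ w) + C (2 ^ e) * P1 (cz ∘ t) * (2 * P3 (cz ∘ A) + hP Q2)
      + P2 (cz ∘ n) * P1 (cz ∘ t) ^ 2 = C ((2 ^ e) ^ 2 * c) * P2 (cz ∘ m) ^ 2 := by
    apply mul_left_cancel₀ hn0'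
    unfold MulEq at hB
    rw [hl] at hB
    rw [htl, map_mul, map_pow C (2 ^ e) 2]
    linear_combination C (2 ^ e) ^ 2 * hB - C (2 ^ e) ^ 2 * hA'
  obtain ⟨c', hc'⟩ : ∃ c' : Z2, cz c' = (2 ^ e) ^ 2 * c := by
    obtain ⟨h0, h1, h2, h3, h4⟩ := coef_quartic key
    have fin : ∀ (v x : Z2), rd v ≠ 0 → cz x = (2 ^ e) ^ 2 * c * cz v → 
      ∃ c' : Z2, cz c' = (2 ^ e) ^ 2 * c := by
      intro v x hv hx
      obtain ⟨u, rfl⟩ := rd_unit hv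
      refine ⟨x * ↑u⁻¹, ?_⟩
      rw [map_mul, hx, mul_assoc, ← map_mul]; simp
    by_cases k0 : rd (m 0) = 0
    · by_cases k2 : rd (m 2) = 0
      · refine fin (m 1 ^ 2 + 2 * m 0 * m 2)
          ((2 ^ e) ^ 2 * w 2 + (2 ^ e) * (t 0 * (2 * A 2) + t 1 * (2 * A 1 + 1))
            + (n 2 * t 0 ^ 2 + 2 * n 1 * t 0 * t 1 + n 0 * t 1 ^ 2)) ?_ ?_
        · simp only [k0, k2, map_add, map_mul, map_pow, mul_zero, add_zero]
          simp only [k0, k2, ne_eq, not_true, false_or, or_false] at hm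
          exact pow_ne_zero _ hm
        · simpa [cz_two] using h2
      · refine fin (m 2 ^ 2) ((2 ^ e) ^ 2 * w 4 + (2 ^ e) * (t 1 * (2 * A 3 + 1)) + n 2 * t 1 ^ 2)
          (by rw [map_pow]; exact pow_ne_zero _ k2) (by simpa [cz_two] using h4)
    · refine fin (m 0 ^ 2) ((2 ^ e) ^ 2 * w 0 + (2 ^ e) * (t 0 * (2 * A 0 + 1)) + n 0 * t 0 ^ 2)
          (by rw [map_pow]; exact pow_ne_zero _ k0) (by simpa [cz_two] using h0)
  have key' : C (2 ^ e) ^ 2 * P4 w + C (2 ^ e) * P1 t * (2 * P3 A + hP Z2)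
      + P2 n * P1 t ^ 2 = C c' * P2 m ^ 2 := by
    apply Polynomial.map_injective cz cz_inj
    rw [← hc'] at key
    simpa only [Polynomial.map_add, Polynomial.map_mul, Polynomial.map_pow, map_P2, map_P1,
      map_P3, map_P4, map_hP, map_gP, Polynomial.map_C, map_pow, map_ofNat, Polynomial.map_ofNat] using key
  rcases e with _ | e
  · simp only [pow_zero, one_pow, one_mul, map_one] at *
    obtain rfl : cz ∘ t = l := funext ht
    refine ⟨![A 0 + n 0 * t 0, A 1 + n 0 * t 1 + n 1 * t 0, A 2 + n 1 * t 1 + n 2 * t 0,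
      A 3 + n 2 * t 1], c', ?_, hc', ?_⟩
    · have := coef7' (R := Q2) (e0 := B 0) (e1 := B 1) (e2 := B 2) (e3 := B 3) (e4 := 0) (e5 := 0)
        (e6 := 0) (d0 := cz (A 0) + cz (n 0) * cz (t 0))
        (d1 := cz (A 1) + cz (n 0) * cz (t 1) + cz (n 1) * cz (t 0))
        (d2 := cz (A 2) + cz (n 1) * cz (t 1) + cz (n 2) * cz (t 0))
        (d3 := cz (A 3) + cz (n 2) * cz (t 1)) (d4 := 0) (d5 := 0) (d6 := 0) (by
          simp only [P3, P2, P1, Function.comp] at hl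
          simp only [map_add, map_mul, map_zero]
          linear_combination hl)
      obtain ⟨b0, b1, b2, b3, -⟩ := this
      intro k
      fin_cases k
      · simp [b0]
      · simp [b1]
      · simp [b2]
      · simp [b3]
    · have hl' : P3 ![A 0 + n 0 * t 0, A 1 + n 0 * t 1 + n 1 * t 0, A 2 + n 1 * t 1 + n 2 * t 0,
          A 3 + n 2 * t 1] = P3 A + P2 n * P1 t := by
        simp [P3, P2, P1]; ring
      have hme : MulEq n m ![A 0 + n 0 * t 0, A 1 + n 0 * t 1 + n 1 * t 0,
          A 2 + n 1 * t 1 + n 2 * t 0, A 3 + n 2 * t 1] c' := by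
        unfold MulEq
        rw [hl']
        linear_combination hA + P2 n * key'
      refine ⟨?_, hme, t, hl'⟩
      apply rd_unit
      intro h0
      have := coef_nw (hme.map rd).nw
      have two : (2 : ZMod 2) = 0 := rfl
      simp only [h0, zero_mul, mul_zero, add_zero, two, zero_add] at this
      obtain ⟨g0, g1, g2, g3, g4, g5, g6⟩ := this
      exact F2_ns _ _ _ _ g0 g1 g2 g3 g4 g5 g6
  · exact (no_pole hn (by simpa using het) key').elim

end Q13
open Polynomial

namespace Q13

noncomputable def ev2 (n : Fin 3 → ℚ) (x : ℝ) : ℝ := n 0 + n 1 * x + n 2 * x ^ 2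
noncomputable def ev3 (n : Fin 4 → ℚ) (x : ℝ) : ℝ := n 0 + n 1 * x + n 2 * x ^ 2 + n 3 * x ^ 3
noncomputable def evf (x : ℝ) : ℝ :=
  x ^ 6 - 4 * x ^ 5 + 6 * x ^ 4 - 2 * x ^ 3 + x ^ 2 - 2 * x + 1

lemma aeval_P2 (n : Fin 3 → ℚ) (x : ℝ) : aeval x (P2 n) = ev2 n x := by simp [P2, ev2]
lemma aeval_P3 (n : Fin 4 → ℚ) (x : ℝ) : aeval x (P3 n) = ev3 n x := by simp [P3, ev3]
lemma aeval_fP (x : ℝ) : aeval x (fP ℚ) = evf x := by simp [fP, evf, map_ofNat (aeval x : ℚ[X] →ₐ[ℚ] ℝ)]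

lemma evf_pos (x : ℝ) : 0 < evf x := by
  have h : evf x = (x ^ 3 - 2 * x ^ 2 - x + 1) ^ 2 + (2 * (x ^ 2 - x)) ^ 2 := by
    simp only [evf]; ring
  rw [h]
  by_cases hx : x ^ 2 - x = 0
  · have : x = 0 ∨ x = 1 := by
      have : x * (x - 1) = 0 := by linear_combination hx
      rcases mul_eq_zero.1 this with h | h
      · exact Or.inl h
      · exact Or.inr (by linarith)
    rcases this with rfl | rfl <;> norm_num
  · positivity

lemma P2_eq_zero {R : Type*} [CommRing R] {n : Fin 3 → R} (h : P2 n = 0) : n = 0 := by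
  have := coef7' (R := R) (e0 := n 0) (e1 := n 1) (e2 := n 2) (e3 := 0) (e4 := 0) (e5 := 0)
      (e6 := 0) (d0 := 0) (d1 := 0) (d2 := 0) (d3 := 0) (d4 := 0) (d5 := 0) (d6 := 0)
      (by simp only [P2] at h; simp only [map_zero]; linear_combination h)
  funext k; fin_cases k
  · exact this.1
  · exact this.2.1
  · exact this.2.2.1

lemma P3_eq_zero {R : Type*} [CommRing R] {n : Fin 4 → R} (h : P3 n = 0) : n = 0 := by
  have := coef7' (R := R) (e0 := n 0) (e1 := n 1) (e2 := n 2) (e3 := n 3) (e4 := 0) (e5 := 0)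
      (e6 := 0) (d0 := 0) (d1 := 0) (d2 := 0) (d3 := 0) (d4 := 0) (d5 := 0) (d6 := 0)
      (by simp only [P3] at h; simp only [map_zero]; linear_combination h)
  funext k; fin_cases k
  · exact this.1
  · exact this.2.1
  · exact this.2.2.1
  · exact this.2.2.2.1

lemma zero_of_inf {p : ℚ[X]} {S : Set ℝ} (hS : S.Infinite) (h : ∀ x ∈ S, aeval x p = 0) : p = 0 := by
  have : p.map (algebraMap ℚ ℝ) = 0 := by
    apply Polynomial.eq_zero_of_infinite_isRoot
    apply hS.mono
    intro x hx
    simpa [Polynomial.IsRoot, Polynomial.eval_map_algebraMap] using h x hx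
  exact (Polynomial.map_eq_zero (algebraMap ℚ ℝ)).1 this

def Rel (n : Fin 3 → ℚ) (c : ℚ) (a : Fin 4 → ℚ) (m : Fin 3 → ℚ) (k : ℚ) : Prop :=
  P3 a ^ 2 - C c * P2 n * P2 m ^ 2 = C k * fP ℚ

lemma Rel.ev {n : Fin 3 → ℚ} {c : ℚ} {a : Fin 4 → ℚ} {m : Fin 3 → ℚ} {k : ℚ} (h : Rel n c a m k)
    (x : ℝ) : ev3 a x ^ 2 - c * ev2 n x * ev2 m x ^ 2 = k * evf x := by
  have := congrArg (aeval x) h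
  simpa [aeval_P2, aeval_P3, aeval_fP] using this

lemma ev2_cont (n : Fin 3 → ℚ) : Continuous (ev2 n) := by unfold ev2; fun_prop
lemma ev3_cont (n : Fin 4 → ℚ) : Continuous (ev3 n) := by unfold ev3; fun_prop

lemma kpos {n : Fin 3 → ℚ} {c : ℚ} {a : Fin 4 → ℚ} {m : Fin 3 → ℚ} {k : ℚ} (h : Rel n c a m k)
    (hne : a ≠ 0 ∨ m ≠ 0) (hN : ∃ x : ℝ, c * ev2 n x < 0) : 0 < k := by
  obtain ⟨x0, hx0⟩ := hN
  have hk0 : (0 : ℝ) ≤ k := by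
    have := h.ev x0
    by_contra hk
    push Not at hk
    nlinarith [evf_pos x0, sq_nonneg (ev3 a x0), mul_nonneg (sq_nonneg (ev2 m x0)) (neg_nonneg.2 hx0.le),
      mul_pos (neg_pos.2 hk) (evf_pos x0)]
  have hk1 : k ≠ 0 := by
    rintro rfl
    have hS : {x : ℝ | c * ev2 n x < 0}.Infinite := by
      have ho : IsOpen {x : ℝ | c * ev2 n x < 0} :=
        isOpen_lt (continuous_const.mul (ev2_cont n)) continuous_const
      obtain ⟨p, q, hpq, hs⟩ : ∃ p q : ℝ, p < q ∧ Set.Ioo p q ⊆ {x : ℝ | c * ev2 n x < 0} := by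
        obtain ⟨e, he, hb⟩ := Metric.isOpen_iff.1 ho x0 hx0
        refine ⟨x0 - e, x0 + e, by linarith, ?_⟩
        rwa [← Real.ball_eq_Ioo]
      exact (Set.Ioo_infinite hpq).mono hs
    have hz : ∀ x ∈ {x : ℝ | c * ev2 n x < 0}, ev3 a x = 0 ∧ ev2 m x = 0 := by
      intro x hx
      have := h.ev x
      simp only [Set.mem_ofPred_eq] at hx
      have h1 : ev3 a x ^ 2 + (-(c * ev2 n x)) * ev2 m x ^ 2 = 0 := by
        push_cast at this; linarith
      have h2 : 0 ≤ (-(c * ev2 n x)) * ev2 m x ^ 2 := mul_nonneg (by linarith) (sq_nonneg _)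
      have h3 : ev3 a x ^ 2 = 0 := by nlinarith [sq_nonneg (ev3 a x)]
      have h4 : (-(c * ev2 n x)) * ev2 m x ^ 2 = 0 := by linarith
      refine ⟨by simpa using h3, ?_⟩
      rcases mul_eq_zero.1 h4 with h5 | h5
      · linarith
      · simpa using h5
    rcases hne with hne | hne
    · exact hne (P3_eq_zero (zero_of_inf hS fun x hx => by rw [aeval_P3]; exact (hz x hx).1))
    · exact hne (P2_eq_zero (zero_of_inf hS fun x hx => by rw [aeval_P2]; exact (hz x hx).2))
  have : (0 : ℚ) ≤ k := by exact_mod_cast hk0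
  exact lt_of_le_of_ne this (Ne.symm hk1)

lemma nonvan {n : Fin 3 → ℚ} {c : ℚ} {a : Fin 4 → ℚ} {m : Fin 3 → ℚ} {k : ℚ} (h : Rel n c a m k)
    (hk : 0 < k) {x : ℝ} (hx : 0 ≤ c * ev2 n x) : ev3 a x ≠ 0 := by
  intro h0
  have := h.ev x
  rw [h0] at this
  have hk' : (0 : ℝ) < k := by exact_mod_cast hk
  nlinarith [mul_pos hk' (evf_pos x), mul_nonneg hx (sq_nonneg (ev2 m x))]

lemma ivt_sign {F : ℝ → ℝ} (hF : Continuous F) {p q : ℝ} (hpq : p ≤ q)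
    (h : ∀ x, p ≤ x → x ≤ q → F x ≠ 0) : 0 < F p * F q := by
  by_contra hc
  push Not at hc
  have : (0 : ℝ) ∈ Set.uIcc (F p) (F q) := by
    rcases le_total (F p) 0 with h1 | h1
    · rcases le_or_gt 0 (F q) with h2 | h2
      · exact Set.mem_uIcc.2 (Or.inl ⟨h1, h2⟩)
      · have : F p < 0 := lt_of_le_of_ne h1 (h p le_rfl hpq)
        nlinarith [mul_pos_of_neg_of_neg this h2]
    · rcases le_or_gt (F q) 0 with h2 | h2
      · exact Set.mem_uIcc.2 (Or.inr ⟨h2, h1⟩)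
      · have : 0 < F p := lt_of_le_of_ne h1 (Ne.symm (h p le_rfl hpq))
        nlinarith [mul_pos this h2]
  obtain ⟨x, hx, hx0⟩ := intermediate_value_uIcc (hF.continuousOn) this
  rw [Set.uIcc_of_le hpq] at hx
  exact h x hx.1 hx.2 hx0

lemma right_sign {b0 b1 b2 b3 p : ℝ} (hb : b3 ≠ 0)
    (h : ∀ x, p ≤ x → b0 + b1 * x + b2 * x ^ 2 + b3 * x ^ 3 ≠ 0) :
    0 < (b0 + b1 * p + b2 * p ^ 2 + b3 * p ^ 3) * b3 := by
  have hb2 : 0 < b3 ^ 2 := by positivity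
  obtain ⟨T, hT1, hTp, hT⟩ : ∃ T : ℝ, 1 ≤ T ∧ p ≤ T ∧
      |b3 * b0| + |b3 * b1| + |b3 * b2| < b3 ^ 2 * T := by
    refine ⟨1 + |p| + (|b3 * b0| + |b3 * b1| + |b3 * b2|) / b3 ^ 2, ?_, ?_, ?_⟩
    · have := abs_nonneg p
      have : 0 ≤ (|b3 * b0| + |b3 * b1| + |b3 * b2|) / b3 ^ 2 := by positivity
      linarith
    · have := le_abs_self p
      have : 0 ≤ (|b3 * b0| + |b3 * b1| + |b3 * b2|) / b3 ^ 2 := by positivity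
      linarith
    · rw [mul_add, mul_div_cancel₀ _ hb2.ne']
      have : 0 < b3 ^ 2 * (1 + |p|) := by positivity
      linarith
  have hpos : 0 < b3 * (b0 + b1 * T + b2 * T ^ 2 + b3 * T ^ 3) := by
    have e0 : -|b3 * b0| * T ^ 2 ≤ b3 * b0 := by
      have := neg_abs_le (b3 * b0)
      nlinarith [abs_nonneg (b3 * b0), mul_nonneg (abs_nonneg (b3 * b0)) (by nlinarith : (0:ℝ) ≤ T ^ 2 - 1)]
    have e1 : -|b3 * b1| * T ^ 2 ≤ b3 * b1 * T := by
      have := neg_abs_le (b3 * b1)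
      nlinarith [mul_nonneg (abs_nonneg (b3 * b1)) (by nlinarith : (0:ℝ) ≤ T ^ 2 - T)]
    have e2 : -|b3 * b2| * T ^ 2 ≤ b3 * b2 * T ^ 2 := by
      have := neg_abs_le (b3 * b2)
      nlinarith [sq_nonneg T]
    have e3 : 0 < (b3 ^ 2 * T - (|b3 * b0| + |b3 * b1| + |b3 * b2|)) * T ^ 2 :=
      mul_pos (by linarith) (by positivity)
    nlinarith
  have hF : Continuous fun x : ℝ => b0 + b1 * x + b2 * x ^ 2 + b3 * x ^ 3 := by fun_prop
  have := ivt_sign hF hTp (fun x hx _ => h x hx)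
  have h3 := mul_pos this hpos
  by_contra hc
  push Not at hc
  have hsq := sq_nonneg (b0 + b1 * T + b2 * T ^ 2 + b3 * T ^ 3)
  nlinarith [mul_nonneg (neg_nonneg.2 hc) hsq]

lemma left_sign {b0 b1 b2 b3 p : ℝ} (hb : b3 ≠ 0)
    (h : ∀ x, x ≤ p → b0 + b1 * x + b2 * x ^ 2 + b3 * x ^ 3 ≠ 0) :
    (b0 + b1 * p + b2 * p ^ 2 + b3 * p ^ 3) * b3 < 0 := by
  have := right_sign (b0 := b0) (b1 := - b1) (b2 := b2) (b3 := - b3) (p := - p) (by simpa using hb)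
    (fun x hx => by
      have := h (-x) (by linarith)
      intro h0; apply this; linear_combination h0)
  linarith

end Q13
open Polynomial

namespace Q13

def Out (n : Fin 3 → ℚ) (V : Fin 4 → ℚ) : Prop :=
  ∃ (c r : ℚ) (a : Fin 4 → ℚ) (m : Fin 3 → ℚ) (l : Fin 2 → ℚ), c ≠ 0 ∧ r ≠ 0 ∧
    Rel n c a m (r ^ 2) ∧ P3 a - C r * P3 V = P2 n * P1 l

lemma Rel.coef {n : Fin 3 → ℚ} {c : ℚ} {a : Fin 4 → ℚ} {m : Fin 3 → ℚ} {k : ℚ} (h : Rel n c a m k) :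
    2 * a 2 * a 3 = c * (n 1 * m 2 ^ 2 + 2 * n 2 * m 1 * m 2) - 4 * k ∧
    a 3 ^ 2 = c * n 2 * m 2 ^ 2 + k := by
  have := coef7' (R := ℚ) (e0 := a 0 ^ 2) (e1 := 2 * a 0 * a 1) (e2 := 2 * a 0 * a 2 + a 1 ^ 2)
    (e3 := 2 * a 0 * a 3 + 2 * a 1 * a 2) (e4 := 2 * a 1 * a 3 + a 2 ^ 2) (e5 := 2 * a 2 * a 3)
    (e6 := a 3 ^ 2) (d0 := c * n 0 * m 0 ^ 2 + k)
    (d1 := c * (n 0 * (2 * m 0 * m 1) + n 1 * m 0 ^ 2) - 2 * k)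
    (d2 := c * (n 0 * (m 1 ^ 2 + 2 * m 0 * m 2) + n 1 * (2 * m 0 * m 1) + n 2 * m 0 ^ 2) + k)
    (d3 := c * (n 0 * (2 * m 1 * m 2) + n 1 * (m 1 ^ 2 + 2 * m 0 * m 2) + n 2 * (2 * m 0 * m 1)) - 2 * k)
    (d4 := c * (n 0 * m 2 ^ 2 + n 1 * (2 * m 1 * m 2) + n 2 * (m 1 ^ 2 + 2 * m 0 * m 2)) + 6 * k)
    (d5 := c * (n 1 * m 2 ^ 2 + 2 * n 2 * m 1 * m 2) - 4 * k)
    (d6 := c * n 2 * m 2 ^ 2 + k) (by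
      simp only [Rel, P3, P2, fP] at h
      simp only [map_add, map_sub, map_mul, map_pow, map_ofNat]
      linear_combination h)
  exact ⟨this.2.2.2.2.2.1, this.2.2.2.2.2.2⟩

lemma V_coef {n : Fin 3 → ℚ} {V : Fin 4 → ℚ} {w : Fin 5 → ℚ} (h : P3 V ^ 2 - fP ℚ = P2 n * P4 w) :
    2 * V 2 * V 3 = n 1 * w 4 + n 2 * w 3 - 4 ∧ V 3 ^ 2 = n 2 * w 4 + 1 := by
  have := coef7' (R := ℚ) (e0 := V 0 ^ 2) (e1 := 2 * V 0 * V 1) (e2 := 2 * V 0 * V 2 + V 1 ^ 2)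
    (e3 := 2 * V 0 * V 3 + 2 * V 1 * V 2) (e4 := 2 * V 1 * V 3 + V 2 ^ 2) (e5 := 2 * V 2 * V 3)
    (e6 := V 3 ^ 2) (d0 := n 0 * w 0 + 1)
    (d1 := n 0 * w 1 + n 1 * w 0 - 2)
    (d2 := n 0 * w 2 + n 1 * w 1 + n 2 * w 0 + 1)
    (d3 := n 0 * w 3 + n 1 * w 2 + n 2 * w 1 - 2)
    (d4 := n 0 * w 4 + n 1 * w 3 + n 2 * w 2 + 6)
    (d5 := n 1 * w 4 + n 2 * w 3 - 4)
    (d6 := n 2 * w 4 + 1) (by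
      simp only [P3, P2, P4, fP] at h
      simp only [map_add, map_sub, map_mul, map_pow, map_ofNat, map_one]
      linear_combination h)
  exact ⟨this.2.2.2.2.2.1, this.2.2.2.2.2.2⟩

lemma V_ev {n : Fin 3 → ℚ} {V : Fin 4 → ℚ} {w : Fin 5 → ℚ} (h : P3 V ^ 2 - fP ℚ = P2 n * P4 w)
    {x : ℝ} (hx : ev2 n x = 0) : ev3 V x ^ 2 = evf x := by
  have := congrArg (aeval x) h
  simp only [map_sub, map_mul, map_pow, aeval_P2, aeval_P3, aeval_fP, hx, zero_mul] at this
  linarith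

/-- case `n` constant -/
lemma case_const {n : Fin 3 → ℚ} {V : Fin 4 → ℚ} {w : Fin 5 → ℚ}
    (hV : P3 V ^ 2 - fP ℚ = P2 n * P4 w) (h0 : n 0 ≠ 0) (h1 : n 1 = 0) (h2 : n 2 = 0)
    (Hs : ∀ c : ℚ, c = 1 ∨ c = -1 → ∃ a m k, (a ≠ 0 ∨ m ≠ 0) ∧ Rel n c a m k) : Out n V := by
  obtain ⟨c, hc, hcn⟩ : ∃ c : ℚ, (c = 1 ∨ c = -1) ∧ c * n 0 < 0 := by
    rcases lt_or_gt_of_ne h0 with h | h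
    · exact ⟨1, Or.inl rfl, by linarith⟩
    · exact ⟨-1, Or.inr rfl, by linarith⟩
  obtain ⟨a, m, k, hne, hr⟩ := Hs c hc
  have hk : 0 < k := kpos hr hne ⟨0, by
    simp only [ev2, h1, h2]
    have : ((c * n 0 : ℚ) : ℝ) < 0 := by exact_mod_cast hcn
    push_cast at this ⊢
    linarith⟩
  obtain ⟨e5, e6⟩ := hr.coef
  obtain ⟨f5, f6⟩ := V_coef hV
  simp only [h1, h2, zero_mul, mul_zero, zero_add, zero_sub, add_zero] at e5 e6 f5 f6
  have ha3 : a 3 ≠ 0 := by rintro h; rw [h] at e6; linarith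
  have hV3 : V 3 ≠ 0 := by rintro h; rw [h] at f6; linarith
  have hkr : (a 3 * V 3) ^ 2 = k := by rw [mul_pow, e6, f6, mul_one]
  have h23 : a 2 = a 3 * V 3 * V 2 := by
    apply mul_left_cancel₀ ha3
    linear_combination e5 / 2 - a 3 ^ 2 / 2 * f5 + 2 * e6
  have h33 : a 3 = a 3 * V 3 * V 3 := by
    linear_combination - a 3 * f6
  refine ⟨c, a 3 * V 3, a, m, ![(a 0 - a 3 * V 3 * V 0) / n 0, (a 1 - a 3 * V 3 * V 1) / n 0],
    by rcases hc with rfl | rfl <;> norm_num, mul_ne_zero ha3 hV3, hkr ▸ hr, ?_⟩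
  have g0 : n 0 * ((a 0 - a 3 * V 3 * V 0) / n 0) = a 0 - a 3 * V 3 * V 0 := by field_simp
  have g1 : n 0 * ((a 1 - a 3 * V 3 * V 1) / n 0) = a 1 - a 3 * V 3 * V 1 := by field_simp
  have g0' := congrArg (C : ℚ →+* ℚ[X]) g0
  have g1' := congrArg (C : ℚ →+* ℚ[X]) g1
  have g2' := congrArg (C : ℚ →+* ℚ[X]) h23
  have g3' := congrArg (C : ℚ →+* ℚ[X]) h33
  simp only [map_mul, map_sub] at g0' g1' g2' g3'
  simp only [P3, P2, P1, h1, h2, map_zero, map_mul, Matrix.cons_val_zero, Matrix.cons_val_one]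
  linear_combination - g0' - X * g1' + X ^ 2 * g2' + X ^ 3 * g3'

/-- case `n` linear -/
lemma case_lin {n : Fin 3 → ℚ} {V : Fin 4 → ℚ} {w : Fin 5 → ℚ}
    (hV : P3 V ^ 2 - fP ℚ = P2 n * P4 w) (h1 : n 1 ≠ 0) (h2 : n 2 = 0)
    (Hs : ∀ c : ℚ, c = 1 ∨ c = -1 → ∃ a m k, (a ≠ 0 ∨ m ≠ 0) ∧ Rel n c a m k) : Out n V := by
  obtain ⟨x, hx⟩ : ∃ x : ℚ, n 0 + n 1 * x = 0 := ⟨- n 0 / n 1, by field_simp; ring⟩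
  have hxR : (n 0 : ℝ) + n 1 * x = 0 := by exact_mod_cast hx
  have hnx : ∀ y : ℝ, ev2 n y = n 1 * (y - x) := by
    intro y; simp only [ev2, h2]; push_cast; linear_combination hxR
  obtain ⟨f5, f6⟩ := V_coef hV
  simp only [h2, zero_mul, zero_add] at f6
  have hV3 : V 3 ≠ 0 := by rintro h; rw [h] at f6; linarith
  set v : ℚ := V 0 + V 1 * x + V 2 * x ^ 2 + V 3 * x ^ 3 with hv
  have hvR : ev3 V x = v := by simp only [ev3, hv]; push_cast; ring
  have hvf : (v : ℝ) ^ 2 = evf x := by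
    rw [← hvR]; apply V_ev hV; rw [hnx]; ring
  have hv0 : v ≠ 0 := by
    intro h; rw [h] at hvf; have := evf_pos x; push_cast at hvf; nlinarith
  -- main conclusion once the sign is known
  have fin : ∀ (c : ℚ) (a : Fin 4 → ℚ) (m : Fin 3 → ℚ) (k : ℚ), c ≠ 0 → Rel n c a m k → 0 < k →
      0 < (ev3 a x * a 3) * (V 3 * v) → Out n V := by
    intro c a m k hc hr hk hs
    obtain ⟨e5, e6⟩ := hr.coef
    simp only [h2, zero_mul, mul_zero, zero_add] at e6
    set α : ℚ := a 0 + a 1 * x + a 2 * x ^ 2 + a 3 * x ^ 3 with hα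
    have hαR : ev3 a x = α := by simp only [ev3, hα]; push_cast; ring
    rw [hαR] at hs
    have hs' : 0 < (α * a 3) * (V 3 * v) := by exact_mod_cast hs
    have hαk : α ^ 2 = k * v ^ 2 := by
      have := hr.ev x
      rw [hnx, hαR, ← hvf, sub_self] at this
      have h' : (α : ℝ) ^ 2 = k * v ^ 2 := by linarith
      exact_mod_cast h'
    have hαr : α = a 3 * V 3 * v := by
      have h3 : (α - a 3 * V 3 * v) * (α + a 3 * V 3 * v) = 0 := by
        linear_combination hαk - v ^ 2 * V 3 ^ 2 * e6 - k * v ^ 2 * f6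
      rcases mul_eq_zero.1 h3 with h | h
      · linarith
      · exfalso
        have : α = - (a 3 * V 3 * v) := by linarith
        rw [this] at hs'
        nlinarith [sq_nonneg (a 3 * V 3 * v)]
    have ha3 : a 3 ≠ 0 := by rintro h; rw [h] at e6; linarith
    have hkr : (a 3 * V 3) ^ 2 = k := by rw [mul_pow, e6, f6, mul_one]
    have h33 : a 3 = a 3 * V 3 * V 3 := by
      linear_combination - a 3 * f6
    -- quotient of `d = a - rV` (degree ≤ 2, vanishing at x) by n
    set r := a 3 * V 3
    refine ⟨c, r, a, m, ![(a 1 - r * V 1 + x * (a 2 - r * V 2)) / n 1, (a 2 - r * V 2) / n 1],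
      hc, mul_ne_zero ha3 hV3, hkr ▸ hr, ?_⟩
    have g0 : n 1 * ((a 1 - r * V 1 + x * (a 2 - r * V 2)) / n 1) = a 1 - r * V 1 + x * (a 2 - r * V 2) := by
      field_simp
    have g1 : n 1 * ((a 2 - r * V 2) / n 1) = a 2 - r * V 2 := by field_simp
    set L0 := (a 1 - r * V 1 + x * (a 2 - r * V 2)) / n 1
    set L1 := (a 2 - r * V 2) / n 1
    have q0 : a 0 - r * V 0 = n 0 * L0 := by
      linear_combination x * g0 + hαr - L0 * hx - x ^ 3 * h33
    have q1 : a 1 - r * V 1 = n 0 * L1 + n 1 * L0 := by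
      linear_combination x * g1 - g0 - L1 * hx
    have q2 : a 2 - r * V 2 = n 1 * L1 := by linear_combination - g1
    have g0' := congrArg (C : ℚ →+* ℚ[X]) q0
    have g1' := congrArg (C : ℚ →+* ℚ[X]) q1
    have g2' := congrArg (C : ℚ →+* ℚ[X]) q2
    have g3' := congrArg (C : ℚ →+* ℚ[X]) h33
    simp only [map_mul, map_sub, map_add] at g0' g1' g2' g3'
    simp only [P3, P2, P1, h2, map_zero, Matrix.cons_val_zero, Matrix.cons_val_one]
    linear_combination g0' + X * g1' + X ^ 2 * g2' + X ^ 3 * g3'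
  have hsgn : ∃ c : ℚ, (c = 1 ∨ c = -1) ∧ 0 < (c * n 1) * (V 3 * v) := by
    have : n 1 * (V 3 * v) ≠ 0 := mul_ne_zero h1 (mul_ne_zero hV3 hv0)
    rcases lt_or_gt_of_ne this with h | h
    · exact ⟨-1, Or.inr rfl, by linarith⟩
    · exact ⟨1, Or.inl rfl, by linarith⟩
  obtain ⟨c, hc, hcn⟩ := hsgn
  have hc0 : c ≠ 0 := by rcases hc with rfl | rfl <;> norm_num
  obtain ⟨a, m, k, hne, hr⟩ := Hs c hc
  have hcn1 : c * n 1 ≠ 0 := mul_ne_zero hc0 h1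
  have hcnR : (c : ℝ) * n 1 ≠ 0 := by exact_mod_cast hcn1
  have hk : 0 < k := kpos hr hne ⟨x - c * n 1, by
    rw [hnx]
    have : 0 < ((c : ℝ) * n 1) ^ 2 := by positivity
    nlinarith⟩
  obtain ⟨e5, e6⟩ := hr.coef
  simp only [h2, zero_mul, mul_zero, zero_add] at e6
  have ha3 : a 3 ≠ 0 := by rintro h; rw [h] at e6; linarith
  have ha3R : (a 3 : ℝ) ≠ 0 := by exact_mod_cast ha3
  refine fin c a m k hc0 hr hk ?_
  rcases lt_or_gt_of_ne hcn1 with h | h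
  · have hR : (c : ℝ) * n 1 < 0 := by exact_mod_cast h
    have hl := left_sign (b0 := a 0) (b1 := a 1) (b2 := a 2) (b3 := a 3) (p := x) ha3R (fun y hy => by
      apply nonvan hr hk
      rw [hnx]; nlinarith)
    have hVv : V 3 * v < 0 := by
      by_contra hcon; push Not at hcon; nlinarith
    have hVvR : (V 3 : ℝ) * v < 0 := by exact_mod_cast hVv
    exact mul_pos_of_neg_of_neg hl hVvR
  · have hR : 0 < (c : ℝ) * n 1 := by exact_mod_cast h
    have hl := right_sign (b0 := a 0) (b1 := a 1) (b2 := a 2) (b3 := a 3) (p := x) ha3R (fun y hy => by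
      apply nonvan hr hk
      rw [hnx]; nlinarith)
    have hVv : 0 < V 3 * v := by
      by_contra hcon; push Not at hcon; nlinarith
    have hVvR : 0 < (V 3 : ℝ) * v := by exact_mod_cast hVv
    exact mul_pos hl hVvR

end Q13
open Polynomial

namespace Q13

lemma red {n : Fin 3 → ℚ} (h2 : n 2 ≠ 0) (V : Fin 4 → ℚ) : ∃ (v0 v1 : ℚ) (l : Fin 2 → ℚ),
    P3 V = C v0 + C v1 * (2 * C (n 2) * X + C (n 1)) + P2 n * P1 l := by
  set l1 := V 3 / n 2 with hl1
  set l0 := (V 2 - n 1 * l1) / n 2 with hl0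
  set v1 := (V 1 - n 0 * l1 - n 1 * l0) / (2 * n 2) with hv1
  have e3 : V 3 = n 2 * l1 := by rw [hl1]; field_simp
  have e2 : V 2 = n 2 * l0 + n 1 * l1 := by rw [hl0]; field_simp; ring
  have e1 : V 1 = 2 * v1 * n 2 + n 0 * l1 + n 1 * l0 := by rw [hv1]; field_simp; ring
  clear_value l1 l0 v1
  refine ⟨V 0 - n 0 * l0 - n 1 * v1, v1, ![l0, l1], ?_⟩
  simp only [P3, P2, P1, e1, e2, e3, map_add, map_sub, map_mul, Matrix.cons_val_zero,
    Matrix.cons_val_one, map_ofNat]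
  ring

lemma lin_dvd {n : Fin 3 → ℚ} (h2 : n 2 ≠ 0) {s t : ℚ}
    (h : P2 n ∣ C s + C t * (2 * C (n 2) * X + C (n 1))) : s = 0 ∧ t = 0 := by
  have hdeg : (P2 n).degree = 2 := by
    have : P2 n = C (n 2) * X ^ 2 + C (n 1) * X + C (n 0) := by simp only [P2]; ring
    rw [this]; exact degree_quadratic h2
  have hr : C s + C t * (2 * C (n 2) * X + C (n 1)) = C (2 * t * n 2) * X + C (s + t * n 1) := by
    simp only [map_add, map_mul, map_ofNat]; ring
  rw [hr] at h
  have hz := eq_zero_of_dvd_of_degree_lt h (by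
    rw [hdeg]; exact lt_of_le_of_lt degree_linear_le (by norm_num))
  have := coef7' (R := ℚ) (e0 := s + t * n 1) (e1 := 2 * t * n 2) (e2 := 0) (e3 := 0) (e4 := 0) (e5 := 0)
      (e6 := 0) (d0 := 0) (d1 := 0) (d2 := 0) (d3 := 0) (d4 := 0) (d5 := 0) (d6 := 0)
      (by simp only [map_zero]; linear_combination hz)
  have ht : t = 0 := by
    have h1 := this.2.1
    simpa [h2] using h1
  have hs := this.1
  rw [ht] at hs
  exact ⟨by linarith, ht⟩

set_option maxHeartbeats 1000000 in
/-- case `n` quadratic -/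
lemma case_quad {n : Fin 3 → ℚ} {V : Fin 4 → ℚ} {w : Fin 5 → ℚ}
    (hV : P3 V ^ 2 - fP ℚ = P2 n * P4 w) (h2 : n 2 ≠ 0) (hirr : ¬ P2 n ∣ fP ℚ)
    (Hs : ∀ c : ℚ, c = 1 ∨ c = -1 → ∃ a m k, (a ≠ 0 ∨ m ≠ 0) ∧ Rel n c a m k) : Out n V := by
  obtain ⟨v0, v1, lV, hVr⟩ := red h2 V
  set δ := n 1 ^ 2 - 4 * n 0 * n 2 with hδ
  set Y := v0 ^ 2 - δ * v1 ^ 2 with hY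
  have h2R : (n 2 : ℝ) ≠ 0 := by exact_mod_cast h2
  have hsq : (2 * C (n 2) * X + C (n 1)) ^ 2 = C δ + 4 * C (n 2) * P2 n := by
    simp only [hδ, P2, map_sub, map_mul, map_pow, map_ofNat]; ring
  have hev : ∀ x : ℝ, 4 * n 2 * ev2 n x = (2 * n 2 * x + n 1) ^ 2 - δ := by
    intro x; simp only [ev2, hδ]; push_cast; ring
  have hVev : ∀ x : ℝ, ev3 V x = v0 + v1 * (2 * n 2 * x + n 1) + ev2 n x * (lV 0 + lV 1 * x) := by
    intro x
    have := congrArg (aeval x) hVr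
    simpa [aeval_P2, aeval_P3, P1, map_ofNat (aeval x : ℚ[X] →ₐ[ℚ] ℝ)] using this
  have hY0 : Y ≠ 0 := by
    intro hY0
    by_cases hv1 : v1 = 0
    · have hv0 : v0 = 0 := by
        rw [hY, hv1] at hY0; simpa using hY0
      apply hirr
      rw [hv1, hv0] at hVr
      refine ⟨P2 n * P1 lV ^ 2 - P4 w, ?_⟩
      rw [hVr] at hV
      simp only [map_zero] at hV
      linear_combination - hV
    · have hv1R : (v1 : ℝ) ≠ 0 := by exact_mod_cast hv1
      obtain ⟨x, hx⟩ : ∃ x : ℝ, v1 * (2 * n 2 * x + n 1) = - v0 :=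
        ⟨(- v0 / v1 - n 1) / (2 * n 2), by field_simp; ring⟩
      have hn : ev2 n x = 0 := by
        have h1 := hev x
        have h3 : (v1 : ℝ) ^ 2 * (4 * n 2 * ev2 n x) = Y := by
          rw [h1, hY]; push_cast
          linear_combination (v1 * (2 * n 2 * x + n 1) - v0) * hx
        rw [hY0] at h3
        simpa [hv1R, h2R] using h3
      have h4 := V_ev hV hn
      rw [hVev, hn, hx] at h4
      have := evf_pos x
      simp at h4
      linarith
  obtain ⟨c, hc, hcn⟩ : ∃ c : ℚ, (c = 1 ∨ c = -1) ∧ (c * n 2) * Y < 0 := by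
    have : n 2 * Y ≠ 0 := mul_ne_zero h2 hY0
    rcases lt_or_gt_of_ne this with h | h
    · exact ⟨1, Or.inl rfl, by linarith⟩
    · exact ⟨-1, Or.inr rfl, by linarith⟩
  have hc0 : c ≠ 0 := by rcases hc with rfl | rfl <;> norm_num
  obtain ⟨a, m, k, hne, hr⟩ := Hs c hc
  have hcn2 : c * n 2 ≠ 0 := mul_ne_zero hc0 h2
  have hcev : ∀ y : ℝ, 4 * (n 2 : ℝ) ^ 2 * (c * ev2 n ((y - n 1) / (2 * n 2))) = (c * n 2) * (y ^ 2 - δ) := by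
    intro y
    have h1 := hev ((y - n 1) / (2 * n 2))
    have h3 : 2 * (n 2 : ℝ) * ((y - n 1) / (2 * n 2)) + n 1 = y := by field_simp; ring
    rw [h3] at h1
    linear_combination c * n 2 * h1
  have h2sq : 0 < 4 * (n 2 : ℝ) ^ 2 := by positivity
  have hδY : Y < 0 → 0 < δ := by
    intro h
    by_contra hd
    push Not at hd
    nlinarith [sq_nonneg v0, mul_nonneg (neg_nonneg.2 hd) (sq_nonneg v1)]
  have hk : 0 < k := by
    rcases lt_or_gt_of_ne hcn2 with h | h
    · have hR : (c : ℝ) * n 2 < 0 := by exact_mod_cast h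
      refine kpos hr hne ⟨((|(δ : ℝ)| + 1) - n 1) / (2 * n 2), ?_⟩
      have h1 := hcev (|(δ : ℝ)| + 1)
      have h3 : 0 < (|(δ : ℝ)| + 1) ^ 2 - δ := by
        nlinarith [abs_nonneg (δ : ℝ), le_abs_self (δ : ℝ)]
      have h4 := mul_neg_of_neg_of_pos hR h3
      rw [← h1] at h4
      exact (pos_iff_neg_of_mul_neg h4).1 h2sq
    · have hR : 0 < (c : ℝ) * n 2 := by exact_mod_cast h
      have hYn : Y < 0 := (pos_iff_neg_of_mul_neg hcn).1 h
      have hd : (0 : ℝ) < δ := by exact_mod_cast hδY hYn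
      refine kpos hr hne ⟨(0 - n 1) / (2 * n 2), ?_⟩
      have h1 := hcev 0
      have h4 : (c : ℝ) * n 2 * (0 ^ 2 - δ) < 0 := mul_neg_of_pos_of_neg hR (by linarith)
      rw [← h1] at h4
      exact (pos_iff_neg_of_mul_neg h4).1 h2sq
  obtain ⟨α0, α1, la, har⟩ := red h2 a
  obtain ⟨E1, E2⟩ := lin_dvd h2 (s := α0 ^ 2 + δ * α1 ^ 2 - k * (v0 ^ 2 + δ * v1 ^ 2))
    (t := 2 * (α0 * α1 - k * v0 * v1)) (by
      set Z : ℚ[X] := 2 * C (n 2) * X + C (n 1)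
      have hr' := hr
      unfold Rel at hr'
      refine ⟨C c * P2 m ^ 2 - C k * P4 w - 4 * C (n 2) * C α1 ^ 2 + 4 * C (n 2) * C k * C v1 ^ 2
        - (P3 a + (C α0 + C α1 * Z)) * P1 la + C k * ((P3 V + (C v0 + C v1 * Z)) * P1 lV), ?_⟩
      simp only [map_add, map_sub, map_mul, map_pow, map_ofNat]
      linear_combination hr' - C k * hV + (C k * C v1 ^ 2 - C α1 ^ 2) * hsq
        - (P3 a + (C α0 + C α1 * Z)) * har + C k * (P3 V + (C v0 + C v1 * Z)) * hVr)
  have E2' : α0 * α1 = k * v0 * v1 := by linarith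
  set P := α0 * v0 - δ * α1 * v1 with hP
  set Q := α1 * v0 - α0 * v1 with hQ
  have hPQ : P * Q = 0 := by
    rw [hP, hQ]; linear_combination (v0 ^ 2 + δ * v1 ^ 2) * E2' - v0 * v1 * E1
  have hPQ2 : P ^ 2 + δ * Q ^ 2 = k * Y ^ 2 := by
    rw [hP, hQ, hY]; linear_combination (v0 ^ 2 + δ * v1 ^ 2) * E1 - 4 * δ * v0 * v1 * E2'
  have f0 : α0 * Y = P * v0 + δ * v1 * Q := by rw [hP, hQ, hY]; ring
  have f1 : α1 * Y = P * v1 + v0 * Q := by rw [hP, hQ, hY]; ring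
  by_cases hQ0 : Q = 0
  · rw [hQ0] at hPQ2 f0 f1
    have hkr : (P / Y) ^ 2 = k := by
      field_simp; linarith
    have hr0 : P / Y ≠ 0 := by
      intro h; rw [h] at hkr; linarith
    refine ⟨c, P / Y, a, m, ![la 0 - P / Y * lV 0, la 1 - P / Y * lV 1], hc0, hr0, hkr ▸ hr, ?_⟩
    have g0 : α0 = P / Y * v0 := by field_simp; linarith
    have g1 : α1 = P / Y * v1 := by field_simp; linarith
    rw [har, hVr, g0, g1]
    simp only [P1, map_sub, map_mul, Matrix.cons_val_zero, Matrix.cons_val_one]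
    ring
  · exfalso
    have hP0 : P = 0 := by
      rcases mul_eq_zero.1 hPQ with h | h
      · exact h
      · exact absurd h hQ0
    rw [hP0] at hPQ2 f0 f1
    have hd : 0 < δ := by
      have h1 : 0 < k * Y ^ 2 := by positivity
      have h3 : 0 < Q ^ 2 := by positivity
      by_contra hd
      push Not at hd
      nlinarith
    have hdR : (0 : ℝ) < δ := by exact_mod_cast hd
    have hprod : (α0 ^ 2 - δ * α1 ^ 2) * Y ^ 2 = - δ * Q ^ 2 * Y := by
      have : (α0 ^ 2 - δ * α1 ^ 2) * Y ^ 2 = (α0 * Y) ^ 2 - δ * (α1 * Y) ^ 2 := by ring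
      rw [this, f0, f1, hY]; ring
    have haev : ∀ x : ℝ, ev3 a x = α0 + α1 * (2 * n 2 * x + n 1) + ev2 n x * (la 0 + la 1 * x) := by
      intro x
      have := congrArg (aeval x) har
      simpa [aeval_P2, aeval_P3, P1, map_ofNat (aeval x : ℚ[X] →ₐ[ℚ] ℝ)] using this
    obtain ⟨s, hs0, hs⟩ : ∃ s : ℝ, 0 < s ∧ s ^ 2 = δ := ⟨√δ, Real.sqrt_pos.2 hdR, Real.sq_sqrt hdR.le⟩
    have hval : ∀ y : ℝ, y ^ 2 = δ → ev3 a ((y - n 1) / (2 * n 2)) = α0 + α1 * y := by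
      intro y hy
      have h1 := hcev y
      rw [hy, sub_self, mul_zero] at h1
      have hcR : (c : ℝ) ≠ 0 := by exact_mod_cast hc0
      have h5 : ev2 n ((y - n 1) / (2 * n 2)) = 0 := by
        simpa [h2R, hcR] using h1
      have h3 : 2 * (n 2 : ℝ) * ((y - n 1) / (2 * n 2)) + n 1 = y := by field_simp; ring
      rw [haev, h3, h5]; ring
    have hvs := hval s hs
    have hvs' := hval (-s) (by rw [neg_sq, hs])
    have hprodR : (((α0 ^ 2 - δ * α1 ^ 2 : ℚ)) : ℝ) = (α0 + α1 * (-s)) * (α0 + α1 * s) := by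
      push_cast; linear_combination (α1 : ℝ) ^ 2 * hs
    rcases lt_or_gt_of_ne hcn2 with h | h
    · have hR : (c : ℝ) * n 2 < 0 := by exact_mod_cast h
      have hYp : 0 < Y := (neg_iff_pos_of_mul_neg hcn).1 h
      have hFc : Continuous fun y : ℝ => ev3 a ((y - n 1) / (2 * n 2)) :=
        (ev3_cont a).comp (by fun_prop)
      have := ivt_sign hFc (p := -s) (q := s) (by linarith) (fun y hy1 hy2 => by
        apply nonvan hr hk
        have h1 := hcev y
        have h3 : 0 ≤ (c * n 2) * (y ^ 2 - δ) := by
          rw [← hs]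
          have : y ^ 2 - s ^ 2 ≤ 0 := by nlinarith
          exact mul_nonneg_of_nonpos_of_nonpos hR.le this
        rw [← h1] at h3
        exact nonneg_of_mul_nonneg_right h3 h2sq)
      simp only [hvs, hvs'] at this
      rw [← hprodR] at this
      have h6 : 0 < α0 ^ 2 - δ * α1 ^ 2 := by exact_mod_cast this
      have h7 : 0 < δ * Q ^ 2 * Y := by positivity
      have h8 : 0 < (α0 ^ 2 - δ * α1 ^ 2) * Y ^ 2 := by positivity
      linarith
    · have hR : 0 < (c : ℝ) * n 2 := by exact_mod_cast h
      have hYn : Y < 0 := (pos_iff_neg_of_mul_neg hcn).1 h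
      have ha3 : a 3 ≠ 0 := by
        have e6 := hr.coef.2
        intro h0; rw [h0] at e6
        nlinarith [mul_nonneg h.le (sq_nonneg (m 2))]
      have ha3R : (a 3 : ℝ) ≠ 0 := by exact_mod_cast ha3
      set κ : ℝ := 1 / (2 * n 2) with hκ
      set τ : ℝ := - n 1 / (2 * n 2) with hτ
      have hκ0 : κ ≠ 0 := by rw [hκ]; positivity
      have hpar : ∀ y : ℝ, (y - n 1) / (2 * n 2) = κ * y + τ := by
        intro y; rw [hκ, hτ]; field_simp; ring
      have hcub : ∀ y : ℝ, ev3 a ((y - n 1) / (2 * n 2)) =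
          (a 0 + a 1 * τ + a 2 * τ ^ 2 + a 3 * τ ^ 3) + (κ * (a 1 + 2 * a 2 * τ + 3 * a 3 * τ ^ 2)) * y
          + (κ ^ 2 * (a 2 + 3 * a 3 * τ)) * y ^ 2 + (a 3 * κ ^ 3) * y ^ 3 := by
        intro y; rw [hpar]; simp only [ev3]; ring
      have hb3 : (a 3 : ℝ) * κ ^ 3 ≠ 0 := mul_ne_zero ha3R (pow_ne_zero _ hκ0)
      have nv : ∀ y : ℝ, s ^ 2 ≤ y ^ 2 → ev3 a ((y - n 1) / (2 * n 2)) ≠ 0 := by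
        intro y hy
        apply nonvan hr hk
        have h1 := hcev y
        have h3 : 0 ≤ (c * n 2) * (y ^ 2 - δ) := by
          rw [← hs]; exact mul_nonneg hR.le (by linarith)
        rw [← h1] at h3
        exact nonneg_of_mul_nonneg_right h3 h2sq
      have r1 := right_sign (p := s) hb3 (fun y hy => by
        rw [← hcub]; exact nv y (by gcongr))
      have r2 := left_sign (p := -s) hb3 (fun y hy => by
        rw [← hcub]
        apply nv y
        rw [← neg_sq y]
        have hys : s ≤ -y := by linarith
        gcongr)
      rw [← hcub, hvs] at r1
      rw [← hcub, hvs'] at r2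
      have h5 := mul_neg_of_pos_of_neg r1 r2
      have h6 : (((α0 ^ 2 - δ * α1 ^ 2 : ℚ)) : ℝ) < 0 := by
        rw [hprodR]
        by_contra hcon
        push Not at hcon
        nlinarith [mul_nonneg hcon (sq_nonneg ((a 3 : ℝ) * κ ^ 3))]
      have h6' : α0 ^ 2 - δ * α1 ^ 2 < 0 := by exact_mod_cast h6
      have h7 : 0 < δ * Q ^ 2 * (-Y) := by
        have : 0 < - Y := by linarith
        positivity
      have h8 : 0 < Y ^ 2 := by positivity
      nlinarith

theorem descent_step {n : Fin 3 → ℚ} {V : Fin 4 → ℚ} {w : Fin 5 → ℚ}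
    (hV : P3 V ^ 2 - fP ℚ = P2 n * P4 w) (hn : n ≠ 0) (hirr : n 2 ≠ 0 → ¬ P2 n ∣ fP ℚ)
    (Hs : ∀ c : ℚ, c = 1 ∨ c = -1 → ∃ a m k, (a ≠ 0 ∨ m ≠ 0) ∧ Rel n c a m k) : Out n V := by
  by_cases h2 : n 2 = 0
  · by_cases h1 : n 1 = 0
    · refine case_const hV ?_ h1 h2 Hs
      intro h0; apply hn; funext k; fin_cases k <;> assumption
    · exact case_lin hV h1 h2 Hs
  · exact case_quad hV h2 (hirr h2) Hs

end Q13
open Polynomial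

namespace Q13

lemma fP_monic (R : Type*) [CommRing R] : (fP R).Monic := by
  unfold fP
  nontriviality R
  monicity!

lemma fP_natDegree (R : Type*) [CommRing R] [Nontrivial R] : (fP R).natDegree = 6 := by
  unfold fP
  compute_degree!

lemma hP_monic (R : Type*) [CommRing R] : (hP R).Monic := by
  unfold hP
  nontriviality R
  monicity!

lemma hP_natDegree (R : Type*) [CommRing R] [Nontrivial R] : (hP R).natDegree = 3 := by
  unfold hP
  compute_degree!

lemma hP_irr : Irreducible (hP (ZMod 2)) := by
  rw [(hP_monic (ZMod 2)).irreducible_iff_roots_eq_zero_of_degree_le_three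
    (by rw [hP_natDegree]; norm_num) (by rw [hP_natDegree])]
  rw [Multiset.eq_zero_iff_forall_notMem]
  intro a ha
  rw [mem_roots (hP_monic _).ne_zero] at ha
  have : a ^ 3 + a + 1 = 0 := by simpa [hP, -ZMod.pow_card] using ha
  clear ha; revert a; decide

lemma fP_two : fP (ZMod 2) = hP (ZMod 2) ^ 2 := by
  have h2 : (2 : (ZMod 2)[X]) = 0 := by
    have : (C (2 : ZMod 2)) = 0 := by rw [show (2 : ZMod 2) = 0 by decide, map_zero]
    simpa [map_ofNat (C : ZMod 2 →+* (ZMod 2)[X])] using this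
  simp only [fP, hP]
  linear_combination (-2 * X ^ 5 + 2 * X ^ 4 - 2 * X ^ 3 - 2 * X) * h2

lemma fP_irrZ : Irreducible (fP ℤ) := by
  rw [(fP_monic ℤ).irreducible_iff_lt_natDegree_lt (by
    intro h; have := congrArg natDegree h; rw [fP_natDegree] at this; simp at this)]
  intro q hq hd hdvd
  rw [fP_natDegree, Finset.mem_Ioc] at hd
  have hq2 : (q.map (Int.castRingHom (ZMod 2))) ∣ hP (ZMod 2) ^ 2 := by
    rw [← fP_two, ← map_fP (Int.castRingHom (ZMod 2))]
    exact Polynomial.map_dvd _ hdvd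
  obtain ⟨k, hk, hk2⟩ := (dvd_prime_pow hP_irr.prime 2).1 hq2
  have hdeg : q.natDegree = k * 3 := by
    rw [← hq.natDegree_map (Int.castRingHom (ZMod 2)), natDegree_eq_of_degree_eq (degree_eq_degree_of_associated hk2),
      (hP_monic _).natDegree_pow, hP_natDegree]
  have h3 : q.natDegree = 3 := by omega
  have hq3 : (q.coeff 3 : ℝ) = 1 := by
    have := hq.coeff_natDegree; rw [h3] at this; exact_mod_cast this
  have hev : ∀ x : ℝ, aeval x q = q.coeff 0 + q.coeff 1 * x + q.coeff 2 * x ^ 2 + q.coeff 3 * x ^ 3 := by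
    intro x
    rw [aeval_eq_sum_range, h3]
    simp [Finset.sum_range_succ]
  have hne : ∀ x : ℝ, (q.coeff 0 : ℝ) + q.coeff 1 * x + q.coeff 2 * x ^ 2 + q.coeff 3 * x ^ 3 ≠ 0 := by
    intro x hx
    rw [← hev] at hx
    obtain ⟨r, hr⟩ := hdvd
    have h1 : aeval x (fP ℤ) = 0 := by rw [hr, map_mul, hx, zero_mul]
    have h2 : aeval x (fP ℤ) = evf x := by simp [fP, evf, map_ofNat (aeval x : ℤ[X] →ₐ[ℤ] ℝ)]
    exact absurd (h2.symm.trans h1) (evf_pos x).ne'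
  have r1 := right_sign (p := 0) (by rw [hq3]; norm_num) (fun x _ => hne x)
  have r2 := left_sign (p := 0) (by rw [hq3]; norm_num) (fun x _ => hne x)
  linarith

lemma fP_irr : Irreducible (fP ℚ) := by
  have := (fP_monic ℤ).irreducible_iff_irreducible_map_fraction_map (K := ℚ)
  rw [← map_fP (algebraMap ℤ ℚ)]
  exact this.1 fP_irrZ

structure Fld (L : Type) [Field L] [NumberField L] (θ I : L) : Prop where
  hI : I ^ 2 = -1
  hθ : θ ^ 3 = (2 + 2 * I) * θ ^ 2 + (1 - 2 * I) * θ - 1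
  fr : Module.finrank ℚ L = 6
  inj : ∀ p : ℚ[X], aeval θ p = 0 → fP ℚ ∣ p
  sur : ∀ x : L, ∃ p : ℚ[X], p.natDegree < 6 ∧ aeval θ p = x

lemma aeval_fP' {S L : Type*} [CommRing S] [CommRing L] [Algebra S L] (θ : L) : aeval θ (fP S) =
    θ ^ 6 - 4 * θ ^ 5 + 6 * θ ^ 4 - 2 * θ ^ 3 + θ ^ 2 - 2 * θ + 1 := by
  simp [fP, map_ofNat (aeval θ : S[X] →ₐ[S] L)]

lemma fld_aux {L : Type*} [Field L] [CharZero L] (θ : L)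
    (hf' : θ ^ 6 - 4 * θ ^ 5 + 6 * θ ^ 4 - 2 * θ ^ 3 + θ ^ 2 - 2 * θ + 1 = 0)
    (hB : θ ^ 2 - θ ≠ 0) : ∃ I : L, I ^ 2 = -1 ∧
    θ ^ 3 = (2 + 2 * I) * θ ^ 2 + (1 - 2 * I) * θ - 1 := by
  obtain ⟨z, hz⟩ : ∃ z, z * (2 * (θ ^ 2 - θ)) = 1 := ⟨(2 * (θ ^ 2 - θ))⁻¹, inv_mul_cancel₀ (by simpa using hB)⟩
  refine ⟨(θ ^ 3 - 2 * θ ^ 2 - θ + 1) * z, ?_, ?_⟩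
  · linear_combination z ^ 2 * hf' - (z * (2 * (θ ^ 2 - θ)) + 1) * hz
  · linear_combination -(θ ^ 3 - 2 * θ ^ 2 - θ + 1) * hz

lemma exists_fld : ∃ (L : Type) (_ : Field L) (_ : NumberField L) (θ I : L), Fld L θ I := by
  have : Fact (Irreducible (fP ℚ)) := ⟨fP_irr⟩
  let pb := AdjoinRoot.powerBasis (fP_irr.ne_zero)
  have : FiniteDimensional ℚ (AdjoinRoot (fP ℚ)) := pb.finite
  have : NumberField (AdjoinRoot (fP ℚ)) := { }
  refine ⟨AdjoinRoot (fP ℚ), inferInstance, inferInstance, AdjoinRoot.root _, ?_⟩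
  set θ := AdjoinRoot.root (fP ℚ) with hθ
  have hae : ∀ p : ℚ[X], aeval θ p = AdjoinRoot.mk (fP ℚ) p := fun p => AdjoinRoot.aeval_eq p
  have hinj : ∀ p : ℚ[X], aeval θ p = 0 → fP ℚ ∣ p := by
    intro p hp
    rw [hae] at hp
    exact AdjoinRoot.mk_eq_zero.1 hp
  have hf : aeval θ (fP ℚ) = 0 := by rw [hae]; exact AdjoinRoot.mk_self
  have hB : θ ^ 2 - θ ≠ 0 := by
    intro h
    have h1 : aeval θ (X ^ 2 - X : ℚ[X]) = 0 := by simpa using h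
    have h2 := natDegree_le_of_dvd (hinj _ h1) (by
      intro h; have := congrArg (fun p => coeff p 1) h; simp [coeff_X] at this)
    rw [fP_natDegree] at h2
    have h3 : (X ^ 2 - X : ℚ[X]).natDegree = 2 := by compute_degree!
    omega
  have hf' : θ ^ 6 - 4 * θ ^ 5 + 6 * θ ^ 4 - 2 * θ ^ 3 + θ ^ 2 - 2 * θ + 1 = 0 := by
    rw [← aeval_fP' (S := ℚ)]; exact hf
  obtain ⟨I, hI1, hI2⟩ := fld_aux θ hf' hB
  refine ⟨I, hI1, hI2, ?_, hinj, ?_⟩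
  · rw [pb.finrank, AdjoinRoot.powerBasis_dim, fP_natDegree]
  · intro x
    obtain ⟨p, hp⟩ := AdjoinRoot.mk_surjective x
    refine ⟨p %ₘ fP ℚ, ?_, ?_⟩
    · have := natDegree_modByMonic_lt p (fP_monic ℚ) (by
        intro h; have := congrArg natDegree h; rw [fP_natDegree] at this; simp at this)
      rwa [fP_natDegree] at this
    · have := modByMonic_add_div p (fP ℚ)
      conv_rhs => rw [← hp, ← hae, ← this]
      simp [hf]

end Q13
open Polynomial NumberField

namespace Q13

def Mth : Matrix (Fin 6) (Fin 6) ℤ :=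
  !![0,0,-1,0,0,0; 1,0,1,0,0,2; 0,1,2,0,0,-2; 0,0,0,0,0,-1; 0,0,-2,1,0,1; 0,0,2,0,1,2]
def MI : Matrix (Fin 6) (Fin 6) ℤ :=
  !![0,0,0,-1,0,0; 0,0,0,0,-1,0; 0,0,0,0,0,-1; 1,0,0,0,0,0; 0,1,0,0,0,0; 0,0,1,0,0,0]
def Nz : Fin 6 → Matrix (Fin 6) (Fin 6) ℤ := ![1, Mth, Mth ^ 2, MI, MI * Mth, MI * Mth ^ 2]

def TT : Matrix (Fin 6) (Fin 6) ℤ := Matrix.of fun i j => (Nz i * Nz j).trace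

def TTv : Matrix (Fin 6) (Fin 6) ℤ := !![6, 4, 4, 0, -4, -8; 4, 4, -2, -4, -8, -20;
  4, -2, -28, -8, -20, -32; 0, -4, -8, -6, -4, -4; -4, -8, -20, -4, -4, 2; -8, -20, -32, -4, 2, 28]
def UU : Matrix (Fin 6) (Fin 6) ℤ := !![1, -2, -6, -28, 98, -10; 0, 3, 7, 64, 138, 6;
  0, 0, 2, -22, -104, 4; 0, 0, 0, 47, -74, -2; 0, 0, 0, 0, 181, -17; 0, 0, 0, 0, 0, 6]
def LL : Matrix (Fin 6) (Fin 6) ℤ := !![6, 0, 0, 0, 0, 0; 4, 4, 0, 0, 0, 0; 4, -14, -94, 0, 0, 0;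
  0, -12, -44, -362, 0, 0; -4, -16, -72, -148, 156, 0; -8, -44, -156, -540, 442, -26]

lemma TT_eq : TT = TTv := by decide +kernel
lemma TT_LU : TTv * UU = LL := by decide +kernel
lemma UU_tri : UU.IsUpperTriangular := by
  have : ∀ i : Fin 6, ∀ j : Fin 6, j < i → UU i j = 0 := by
    intro i j; fin_cases i <;> fin_cases j <;> decide
  exact fun i j h => this i j h
lemma LL_tri : LL.IsLowerTriangular := by
  have : ∀ i : Fin 6, ∀ j : Fin 6, i < j → LL i j = 0 := by
    intro i j; fin_cases i <;> fin_cases j <;> decide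
  exact fun i j h => this i j h
lemma TT_det : TT.det = -10816 := by
  have h1 : UU.det = 306252 := by
    rw [Matrix.det_of_isUpperTriangular UU_tri]
    decide +kernel
  have h2 : LL.det = -3312421632 := by
    rw [Matrix.det_of_isLowerTriangular _ LL_tri]
    decide +kernel
  have := congrArg Matrix.det TT_LU
  rw [Matrix.det_mul, h1, h2, ← TT_eq] at this
  omega

section
variable {L : Type} [Field L] [NumberField L] {θ I : L}

lemma Fld.p4 (H : Fld L θ I) : θ ^ 4 = (1 + 6 * I) * θ ^ 2 + (5 - 2 * I) * θ - 2 - 2 * I := by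
  linear_combination (θ + 2 + 2 * I) * H.hθ + (4 * θ ^ 2 - 4 * θ) * H.hI
lemma Fld.p5 (H : Fld L θ I) : θ ^ 5 = (-5 + 12 * I) * θ ^ 2 + (11 + 2 * I) * θ - 1 - 6 * I := by
  linear_combination θ * H.p4 + (1 + 6 * I) * H.hθ + (12 * θ ^ 2 - 12 * θ) * H.hI

lemma Fld.span (H : Fld L θ I) : (⊤ : Submodule ℚ L) ≤ Submodule.span ℚ (Set.range ![1, θ, θ ^ 2, I, I * θ, I * θ ^ 2]) := by
  intro x _
  obtain ⟨p, hp, rfl⟩ := H.sur x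
  rw [aeval_eq_sum_range' hp]
  have hb : ∀ i : Fin 6, ![1, θ, θ ^ 2, I, I * θ, I * θ ^ 2] i ∈ Submodule.span ℚ (Set.range ![1, θ, θ ^ 2, I, I * θ, I * θ ^ 2]) :=
    fun i => Submodule.subset_span ⟨i, rfl⟩
  have b0 := hb 0
  have b1 := hb 1
  have b2 := hb 2
  have b3 := hb 3
  have b4 := hb 4
  have b5 := hb 5
  have comb : ∀ c0 c1 c2 c3 c4 c5 : ℚ, c0 • (1 : L) + c1 • θ + c2 • θ ^ 2 + c3 • I + c4 • (I * θ) + c5 • (I * θ ^ 2) ∈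
      Submodule.span ℚ (Set.range ![1, θ, θ ^ 2, I, I * θ, I * θ ^ 2]) := by
    intro c0 c1 c2 c3 c4 c5
    exact add_mem (add_mem (add_mem (add_mem (add_mem (Submodule.smul_mem _ _ b0) (Submodule.smul_mem _ _ b1)) (Submodule.smul_mem _ _ b2))
      (Submodule.smul_mem _ _ b3)) (Submodule.smul_mem _ _ b4)) (Submodule.smul_mem _ _ b5)
  convert! comb (p.coeff 0 - p.coeff 3 - 2 * p.coeff 4 - p.coeff 5) (p.coeff 1 + p.coeff 3 + 5 * p.coeff 4 + 11 * p.coeff 5)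
    (p.coeff 2 + 2 * p.coeff 3 + p.coeff 4 - 5 * p.coeff 5) (- 2 * p.coeff 4 - 6 * p.coeff 5)
    (-2 * p.coeff 3 - 2 * p.coeff 4 + 2 * p.coeff 5) (2 * p.coeff 3 + 6 * p.coeff 4 + 12 * p.coeff 5) using 1
  simp only [Finset.sum_range_succ, Finset.sum_range_zero, H.hθ, H.p4, H.p5, Algebra.smul_def]
  simp only [map_sub, map_add, map_mul, map_neg, map_ofNat]
  ring

noncomputable def Fld.b (H : Fld L θ I) : Module.Basis (Fin 6) ℚ L :=
  basisOfTopLeSpanOfCardEqFinrank _ H.span (by rw [H.fr]; rfl)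

lemma Fld.b_coe (H : Fld L θ I) : (H.b : Fin 6 → L) = ![1, θ, θ ^ 2, I, I * θ, I * θ ^ 2] := by
  simp [Fld.b]

lemma lmm {b : Module.Basis (Fin 6) ℚ L} {x : L} {M : Matrix (Fin 6) (Fin 6) ℤ}
    (h : ∀ j, x * b j = ∑ i, (M i j : L) * b i) :
    Algebra.leftMulMatrix b x = M.map (Int.castRingHom ℚ) := by
  ext i j
  rw [Algebra.leftMulMatrix_eq_repr_mul, h j]
  have : ∀ i, (M i j : L) * b i = (M i j : ℚ) • b i := by
    intro i; rw [Algebra.smul_def]; simp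
  simp only [this]
  rw [Module.Basis.repr_sum_self]
  simp

lemma Fld.lth (H : Fld L θ I) : Algebra.leftMulMatrix H.b θ = Mth.map (Int.castRingHom ℚ) := by
  apply lmm
  intro j
  have := H.hθ
  fin_cases j <;> simp [Fin.sum_univ_succ, H.b_coe, Mth]
  · ring
  · linear_combination H.hθ
  · ring
  · ring
  · linear_combination I * H.hθ + (2 * θ ^ 2 - 2 * θ) * H.hI

lemma Fld.lI (H : Fld L θ I) : Algebra.leftMulMatrix H.b I = MI.map (Int.castRingHom ℚ) := by
  apply lmm
  intro j
  have := H.hI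
  fin_cases j <;> simp [Fin.sum_univ_succ, H.b_coe, MI]
  · linear_combination H.hI
  · linear_combination θ * H.hI
  · linear_combination θ ^ 2 * H.hI

lemma Fld.lb (H : Fld L θ I) (i : Fin 6) : Algebra.leftMulMatrix H.b (H.b i) = (Nz i).map (Int.castRingHom ℚ) := by
  have e : ∀ M : Matrix (Fin 6) (Fin 6) ℤ, M.map (Int.castRingHom ℚ) = (Int.castRingHom ℚ).mapMatrix M := fun M => rfl
  rw [H.b_coe]
  fin_cases i <;> simp only [Nz, e, Fin.isValue, map_mul, map_pow, H.lth, H.lI, map_one, Fin.zero_eta, Fin.mk_one, Fin.reduceFinMk,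
    Matrix.cons_val]

lemma Fld.discr_b (H : Fld L θ I) : Algebra.discr ℚ H.b = -10816 := by
  have : Algebra.traceMatrix ℚ H.b = TT.map (Int.castRingHom ℚ) := by
    ext i j
    rw [Algebra.traceMatrix_apply, Algebra.traceForm_apply, Algebra.trace_eq_matrix_trace H.b, map_mul, H.lb, H.lb,
      ← Matrix.map_mul]
    simp [TT, Matrix.trace]
  rw [Algebra.discr_def, this]
  change ((Int.castRingHom ℚ).mapMatrix TT).det = _
  rw [← RingHom.map_det, TT_det]
  simp

lemma Fld.iI (H : Fld L θ I) : IsIntegral ℤ I := by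
  refine ⟨X ^ 2 + 1, by monicity!, ?_⟩
  simp [H.hI]

lemma Fld.f0 (H : Fld L θ I) : θ ^ 6 - 4 * θ ^ 5 + 6 * θ ^ 4 - 2 * θ ^ 3 + θ ^ 2 - 2 * θ + 1 = 0 := by
  linear_combination (θ ^ 3 - 2 * θ ^ 2 - θ + 1 + 2 * I * (θ ^ 2 - θ)) * H.hθ + 4 * (θ ^ 2 - θ) ^ 2 * H.hI

lemma Fld.iθ (H : Fld L θ I) : IsIntegral ℤ θ := by
  refine ⟨fP ℤ, fP_monic ℤ, ?_⟩
  have := aeval_fP' (S := ℤ) θ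
  rw [H.f0] at this
  exact this

lemma Fld.ib (H : Fld L θ I) (i : Fin 6) : IsIntegral ℤ (H.b i) := by
  have h1 := H.iθ
  have h2 := H.iI
  rw [H.b_coe]
  fin_cases i
  · exact isIntegral_one
  · exact h1
  · exact h1.pow 2
  · exact h2
  · exact h2.mul h1
  · exact h2.mul (h1.pow 2)

noncomputable def Fld.t (H : Fld L θ I) : 𝓞 L := ⟨θ, H.iθ⟩
noncomputable def Fld.J (H : Fld L θ I) : 𝓞 L := ⟨I, H.iI⟩
lemma Fld.t_coe (H : Fld L θ I) : algebraMap (𝓞 L) L H.t = θ := rfl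
lemma Fld.J_coe (H : Fld L θ I) : algebraMap (𝓞 L) L H.J = I := rfl
lemma Fld.t_f (H : Fld L θ I) : H.t ^ 6 - 4 * H.t ^ 5 + 6 * H.t ^ 4 - 2 * H.t ^ 3 + H.t ^ 2 - 2 * H.t + 1 = 0 := by
  apply FaithfulSMul.algebraMap_injective (𝓞 L) L
  simp only [map_add, map_sub, map_mul, map_pow, map_ofNat, map_one, map_zero, H.t_coe, H.f0]
lemma Fld.J2 (H : Fld L θ I) : H.J ^ 2 = -1 := by
  apply FaithfulSMul.algebraMap_injective (𝓞 L) L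
  simp only [map_pow, map_neg, map_one, H.J_coe, H.hI]
lemma Fld.t3 (H : Fld L θ I) : H.t ^ 3 = (2 + 2 * H.J) * H.t ^ 2 + (1 - 2 * H.J) * H.t - 1 := by
  apply FaithfulSMul.algebraMap_injective (𝓞 L) L
  simp only [map_add, map_sub, map_mul, map_pow, map_ofNat, map_one, H.t_coe, H.J_coe, H.hθ]

lemma Fld.discr_le (H : Fld L θ I) : |discr L| ≤ 10816 := by
  let b' := (integralBasis L).reindex ((integralBasis L).indexEquiv H.b)
  have h1 : Algebra.discr ℚ H.b = (b'.toMatrix H.b).det ^ 2 * Algebra.discr ℚ b' := by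
    rw [← Algebra.discr_of_matrix_vecMul, Module.Basis.toMatrix_map_vecMul]
  have h2 : Algebra.discr ℚ b' = discr L := by
    rw [Module.Basis.coe_reindex, Algebra.discr_reindex, coe_discr]
  have hdetint : IsIntegral ℤ (b'.toMatrix H.b).det := by
    apply IsIntegral.det
    intro i j
    rw [Module.Basis.toMatrix_apply, Module.Basis.repr_reindex_apply]
    have := integralBasis_repr_apply L (⟨H.b j, H.ib j⟩ : 𝓞 L) (((integralBasis L).indexEquiv H.b).symm i)
    have e : algebraMap (𝓞 L) L ⟨H.b j, H.ib j⟩ = H.b j := rfl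
    rw [e] at this
    rw [this]
    exact isIntegral_algebraMap
  obtain ⟨r, hr⟩ := IsIntegrallyClosed.isIntegral_iff.1 hdetint
  rw [H.discr_b, h2, ← hr] at h1
  have h3 : -10816 = r ^ 2 * discr L := by
    have : ((-10816 : ℤ) : ℚ) = ((r ^ 2 * discr L : ℤ) : ℚ) := by push_cast; simpa using h1
    exact_mod_cast this
  have h4 : (10816 : ℤ) = r ^ 2 * |discr L| := by
    rw [← abs_of_nonneg (sq_nonneg r), ← abs_mul, ← h3]; rfl
  have hr0 : r ≠ 0 := by rintro rfl; simp at h4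
  have : 1 ≤ r ^ 2 := by have := sq_pos_of_ne_zero hr0; omega
  nlinarith [abs_nonneg (discr L)]

lemma Fld.tc (H : Fld L θ I) : IsTotallyComplex L := by
  constructor
  intro v
  rw [← InfinitePlace.not_isReal_iff_isComplex]
  intro hv
  have := congrArg (InfinitePlace.embedding_of_isReal hv) H.hI
  rw [map_pow, map_neg, map_one] at this
  nlinarith [sq_nonneg (InfinitePlace.embedding_of_isReal hv I)]

lemma Fld.nrc (H : Fld L θ I) : InfinitePlace.nrComplexPlaces L = 3 := by
  have := H.tc
  have h := IsTotallyComplex.finrank (K := L)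
  rw [H.fr] at h
  omega

/-- no ring hom from the ring of integers to a ring with 2 or 3 elements -/
lemma Fld.pid (H : Fld L θ I) : IsPrincipalIdealRing (𝓞 L) := by
  apply RingOfIntegers.isPrincipalIdealRing_of_isPrincipal_of_norm_le_of_isPrime
  intro P hP hN
  exfalso
  rw [H.nrc, H.fr] at hN
  have hM : (4 / Real.pi) ^ 3 * ((Nat.factorial 6 : ℝ) / ((6 : ℕ) : ℝ) ^ 6 * √|(discr L : ℝ)|) < 4 := by
    have h1 : √|(discr L : ℝ)| ≤ 104 := by
      rw [Real.sqrt_le_left (by norm_num)]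
      have : ((|discr L| : ℤ) : ℝ) ≤ (10816 : ℤ) := by exact_mod_cast H.discr_le
      push_cast at this
      linarith
    have h2 : 4 / Real.pi < 1.274 := by
      rw [div_lt_iff₀ Real.pi_pos]
      linarith [Real.pi_gt_d6]
    have h3 : (4 / Real.pi) ^ 3 < 1.274 ^ 3 := by
      have : 0 < 4 / Real.pi := by positivity
      gcongr
    have h5 : (Nat.factorial 6 : ℝ) = 720 := by norm_num [Nat.factorial]
    rw [h5]
    have h4 : (720 : ℝ) / ((6 : ℕ) : ℝ) ^ 6 * √|(discr L : ℝ)| ≤ 720 / 6 ^ 6 * 104 := by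
      push_cast
      gcongr
    calc _ ≤ (1.274 : ℝ) ^ 3 * (720 / 6 ^ 6 * 104) := by gcongr
      _ < 4 := by norm_num
  have hN4 : Ideal.absNorm (P : Ideal (𝓞 L)) < 4 := by
    have := lt_of_le_of_lt hN hM
    exact_mod_cast this
  have hP0 : (P : Ideal (𝓞 L)) ≠ ⊥ := nonZeroDivisors.coe_ne_zero P
  have hmax := hP.isMaximal hP0
  let _ := Ideal.Quotient.field (P : Ideal (𝓞 L))
  have hcard : Nat.card (𝓞 L ⧸ (P : Ideal (𝓞 L))) = Ideal.absNorm (P : Ideal (𝓞 L)) := by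
    rw [Ideal.absNorm_apply]; rfl
  have hfin : Finite (𝓞 L ⧸ (P : Ideal (𝓞 L))) := by
    apply Nat.finite_of_card_ne_zero
    rw [hcard]
    exact Ideal.absNorm_eq_zero_iff.not.2 hP0
  have hgt : 1 < Nat.card (𝓞 L ⧸ (P : Ideal (𝓞 L))) := Finite.one_lt_card
  let φ := Ideal.Quotient.mk (P : Ideal (𝓞 L))
  set s := φ H.t
  have hs : s ^ 6 - 4 * s ^ 5 + 6 * s ^ 4 - 2 * s ^ 3 + s ^ 2 - 2 * s + 1 = 0 := by
    have := congrArg φ H.t_f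
    simp only [map_add, map_sub, map_mul, map_pow, map_ofNat, map_one, map_zero] at this
    exact this
  have hpow : s ^ Nat.card (𝓞 L ⧸ (P : Ideal (𝓞 L))) = s := by
    have := Fintype.ofFinite (𝓞 L ⧸ (P : Ideal (𝓞 L)))
    rw [Nat.card_eq_fintype_card]
    exact FiniteField.pow_card s
  have hzero : ((Nat.card (𝓞 L ⧸ (P : Ideal (𝓞 L))) : ℕ) : (𝓞 L ⧸ (P : Ideal (𝓞 L)))) = 0 := by
    have := Fintype.ofFinite (𝓞 L ⧸ (P : Ideal (𝓞 L)))
    rw [Nat.card_eq_fintype_card]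
    exact Nat.cast_card_eq_zero _
  have h23 : Nat.card (𝓞 L ⧸ (P : Ideal (𝓞 L))) = 2 ∨ Nat.card (𝓞 L ⧸ (P : Ideal (𝓞 L))) = 3 := by omega
  have h10 : (1 : (𝓞 L ⧸ (P : Ideal (𝓞 L)))) ≠ 0 := one_ne_zero
  rcases h23 with h | h
  · rw [h] at hpow hzero
    push_cast at hzero
    apply h10
    linear_combination hs - (s ^ 4 - 3 * s ^ 3 + 3 * s ^ 2 + s + 2) * hpow - s * 0 * hzero
  · rw [h] at hpow hzero
    push_cast at hzero
    apply h10
    have hq : s ^ 2 - s - 1 = 0 := by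
      linear_combination - hs + (s ^ 3 - 4 * s ^ 2 + 7 * s - 6) * hpow + (3 * s ^ 2 - 3 * s) * hzero
    have h1 : s + 1 = 0 := by linear_combination hpow - (s + 1) * hq
    linear_combination hq - (s - 2) * h1

end
end Q13
open Polynomial NumberField

namespace Q13

section
variable {k : Type*} [CommRing k]

/-- nonzero elements of `F₂[s]/(s³+s+1)` are invertible -/
lemma f8_inv {s : k} (h2 : (2 : k) = 0) (hs : s ^ 3 = s + 1) (c : Fin 3 → ℤ)
    (hc : ¬ ∀ j, (2 : ℤ) ∣ c j) : ∃ d : Fin 3 → ℤ, 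
      ((c 0 : k) + c 1 * s + c 2 * s ^ 2) * (d 0 + d 1 * s + d 2 * s ^ 2) = 1 := by
  have hpar : ∀ z : ℤ, ((2 : ℤ) ∣ z ∧ (z : k) = 0) ∨ (¬ (2 : ℤ) ∣ z ∧ (z : k) = 1) := by
    intro z
    rcases Int.even_or_odd' z with ⟨y, rfl | rfl⟩
    · left; refine ⟨⟨y, rfl⟩, ?_⟩; push_cast; linear_combination (y : k) * h2
    · right; refine ⟨by omega, ?_⟩; push_cast; linear_combination (y : k) * h2
  have fin : (2 : ℤ) ∣ c 0 → (2 : ℤ) ∣ c 1 → (2 : ℤ) ∣ c 2 → False := by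
    intro h0 h1 h2'; apply hc; intro j; fin_cases j <;> assumption
  rcases hpar (c 0) with ⟨h0, e0⟩ | ⟨h0, e0⟩ <;> rcases hpar (c 1) with ⟨h1, e1⟩ | ⟨h1, e1⟩ <;>
    rcases hpar (c 2) with ⟨h2', e2⟩ | ⟨h2', e2⟩ <;> simp only [e0, e1, e2]
  · exact (fin h0 h1 h2').elim
  · skip
    refine ⟨![1, 1, 1], ?_⟩
    simp
    linear_combination (s + 1) * hs + (s ^ 2 + s) * h2
  · refine ⟨![1, 0, 1], ?_⟩
    simp
    linear_combination hs + s * h2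
  · refine ⟨![1, 1, 0], ?_⟩
    simp
    linear_combination hs + (s ^ 2 + s) * h2
  · refine ⟨![1, 0, 0], ?_⟩
    simp
  · refine ⟨![0, 1, 0], ?_⟩
    simp
    linear_combination hs + s * h2
  · refine ⟨![0, 1, 1], ?_⟩
    simp
    linear_combination hs + (s ^ 2 + s) * h2
  · refine ⟨![0, 0, 1], ?_⟩
    simp
    linear_combination (s + 1) * hs + (s ^ 2 + s) * h2
end

section
variable {L : Type} [Field L] [NumberField L] {θ I : L}

noncomputable def Fld.q (H : Fld L θ I) (c : Fin 3 → ℤ) : 𝓞 L := c 0 + c 1 * H.t + c 2 * H.t ^ 2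

lemma Fld.normpi (H : Fld L θ I) : Ideal.absNorm (Ideal.span {1 + H.J}) = 8 := by
  rw [Ideal.absNorm_span_singleton]
  have h1 : (1 + H.J) ^ 2 = 2 * H.J := by linear_combination H.J2
  have h2 := congrArg (Algebra.norm ℤ) h1
  have h3 := congrArg (Algebra.norm ℤ) H.J2
  have hr : Module.finrank ℤ (𝓞 L) = 6 := by rw [RingOfIntegers.rank, H.fr]
  have h4 : Algebra.norm ℤ (2 : 𝓞 L) = 64 := by
    have := Algebra.norm_algebraMap_of_basis (RingOfIntegers.basis L) (2 : ℤ)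
    rw [← Module.finrank_eq_card_chooseBasisIndex, hr] at this
    simpa using this
  have h5 : Algebra.norm ℤ (-1 : 𝓞 L) = 1 := by
    have := Algebra.norm_algebraMap_of_basis (RingOfIntegers.basis L) (-1 : ℤ)
    rw [← Module.finrank_eq_card_chooseBasisIndex, hr] at this
    simpa using this
  rw [map_pow, map_mul, h4] at h2
  rw [map_pow, h5] at h3
  have h6 : Algebra.norm ℤ H.J = 1 ∨ Algebra.norm ℤ H.J = -1 := sq_eq_sq_iff_eq_or_eq_neg.1 (by rw [h3, one_pow])
  have h7 : Algebra.norm ℤ H.J = 1 := by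
    rcases h6 with h | h
    · exact h
    · rw [h] at h2; nlinarith [sq_nonneg (Algebra.norm ℤ (1 + H.J))]
  rw [h7] at h2
  have : (Algebra.norm ℤ (1 + H.J)).natAbs ^ 2 = 8 ^ 2 := by
    zify; rw [sq_abs, h2]; norm_num
  exact Nat.pow_left_injective (by norm_num : (2 : ℕ) ≠ 0) this

lemma Fld.two (H : Fld L θ I) : (2 : 𝓞 L) = (1 + H.J) * (1 - H.J) := by linear_combination H.J2

lemma Fld.not_unit (H : Fld L θ I) : ¬ (1 + H.J) ∣ 1 := by
  intro h
  have := H.normpi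
  rw [Ideal.span_singleton_eq_top.2 (isUnit_of_dvd_one h)] at this
  simp at this

lemma Fld.R2 (H : Fld L θ I) (c : Fin 3 → ℤ) (h : (1 + H.J) ∣ H.q c) (j : Fin 3) : (2 : ℤ) ∣ c j := by
  revert j
  by_contra hc
  let φ := Ideal.Quotient.mk (Ideal.span {1 + H.J})
  have hz : φ (1 + H.J) = 0 := Ideal.Quotient.eq_zero_iff_mem.2 (Ideal.mem_span_singleton_self _)
  have h2 : (2 : 𝓞 L ⧸ Ideal.span {1 + H.J}) = 0 := by
    rw [← map_ofNat φ, H.two, map_mul, hz, zero_mul]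
  have h3 : (φ H.t) ^ 3 = φ H.t + 1 := by
    have := congrArg φ H.t3
    simp only [map_add, map_sub, map_mul, map_pow, map_ofNat, map_one] at this
    rw [this]
    linear_combination ((1 + φ H.J) * φ H.t ^ 2 - φ H.J * φ H.t - 1) * h2
  obtain ⟨d, hd⟩ := f8_inv h2 h3 c hc
  have hq : φ (H.q c) = 0 := Ideal.Quotient.eq_zero_iff_mem.2 (Ideal.mem_span_singleton.2 h)
  simp only [Fld.q, map_add, map_mul, map_intCast, map_pow] at hq
  rw [hq, zero_mul] at hd
  apply H.not_unit
  rw [← Ideal.mem_span_singleton, ← Ideal.Quotient.eq_zero_iff_mem, map_one]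
  exact hd.symm

lemma Fld.R1 (H : Fld L θ I) (w : 𝓞 L) : ∃ (c : Fin 3 → ℤ) (z : 𝓞 L), w = H.q c + (1 + H.J) * z := by
  let φ := Ideal.Quotient.mk (Ideal.span {1 + H.J})
  let F : (Fin 3 → Fin 2) → 𝓞 L ⧸ Ideal.span {1 + H.J} := fun e => φ (H.q (fun j => ((e j : ℕ) : ℤ)))
  have hcard : Nat.card (𝓞 L ⧸ Ideal.span {1 + H.J}) = 8 := by
    rw [← H.normpi, Ideal.absNorm_apply]; rfl
  have hfin : Finite (𝓞 L ⧸ Ideal.span {1 + H.J}) := by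
    apply Nat.finite_of_card_ne_zero
    rw [hcard]; norm_num
  have hinj : Function.Injective F := by
    intro e e' h
    have h1 := Ideal.mem_span_singleton.1 ((Ideal.Quotient.eq).1 h)
    have h2 := H.R2 (fun j => ((e j : ℕ) : ℤ) - ((e' j : ℕ) : ℤ)) (by
      convert h1 using 1; simp only [Fld.q]; push_cast; ring)
    funext j
    have := h2 j
    apply Fin.ext
    have := (e j).2
    have := (e' j).2
    omega
  have hbij : Function.Bijective F := by
    rw [Nat.bijective_iff_injective_and_card]
    refine ⟨hinj, ?_⟩
    rw [hcard]; simp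
  obtain ⟨e, he⟩ := hbij.2 (φ w)
  obtain ⟨z, hz⟩ := Ideal.mem_span_singleton.1 ((Ideal.Quotient.eq).1 he.symm)
  exact ⟨_, z, by rw [← hz]; ring⟩

noncomputable def Fld.e1 (H : Fld L θ I) : 𝓞 L := (-1 + H.J) + (-1 - 2 * H.J) * H.t + H.t ^ 2
noncomputable def Fld.e2 (H : Fld L θ I) : 𝓞 L := - H.J + (2 + H.J) * H.t - H.t ^ 2

lemma Fld.e1sq (H : Fld L θ I) : H.e1 ^ 2 = H.t := by
  simp only [Fld.e1]
  have h3 := H.t3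
  have h2 := H.J2
  generalize H.t = t at *
  generalize H.J = J at *
  linear_combination (t - 2 * J) * h3 + h2
lemma Fld.e2sq (H : Fld L θ I) : H.e2 ^ 2 = 1 - H.t := by
  simp only [Fld.e2]
  have h3 := H.t3
  have h2 := H.J2
  generalize H.t = t at *
  generalize H.J = J at *
  linear_combination (t - 2) * h3 + (t ^ 2 + 1 - 2 * t) * h2


/-- the class of a unit modulo 2 -/
lemma Fld.key (H : Fld L θ I) (u w : 𝓞 L) (n a b : Fin 3 → ℤ) (z : 𝓞 L) (hu : u = H.q a + (1 + H.J) * H.q b + 2 * z)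
    (hb : ¬ ∀ j, (2 : ℤ) ∣ b j) (hn : ¬ ∀ j, (2 : ℤ) ∣ n j) (h : u * w ^ 2 = H.q n) : False := by
  obtain ⟨p, y, rfl⟩ := H.R1 w
  let φ := Ideal.Quotient.mk (Ideal.span {(2 : 𝓞 L)})
  have h2 : (2 : 𝓞 L ⧸ Ideal.span {(2 : 𝓞 L)}) = 0 := by
    rw [← map_ofNat φ]
    exact Ideal.Quotient.eq_zero_iff_mem.2 (Ideal.mem_span_singleton_self _)
  have hJ : φ H.J ^ 2 = 1 := by
    rw [← map_pow, H.J2, map_neg, map_one]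
    linear_combination -h2
  have h3 : (φ H.t) ^ 3 = φ H.t + 1 := by
    have := congrArg φ H.t3
    simp only [map_add, map_sub, map_mul, map_pow, map_ofNat, map_one] at this
    rw [this]
    linear_combination ((1 + φ H.J) * φ H.t ^ 2 - φ H.J * φ H.t - 1) * h2
  have hqφ : ∀ c, φ (H.q c) = c 0 + c 1 * φ H.t + c 2 * φ H.t ^ 2 := by
    intro c; simp only [Fld.q, map_add, map_mul, map_intCast, map_pow]
  -- K0 closed under multiplication
  have hmul : ∀ c d : Fin 3 → ℤ, ∃ e : Fin 3 → ℤ, φ (H.q c) * φ (H.q d) = φ (H.q e) := by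
    intro c d
    refine ⟨![c 0 * d 0 + c 1 * d 2 + c 2 * d 1, c 0 * d 1 + c 1 * d 0 + c 1 * d 2 + c 2 * d 1 + c 2 * d 2,
      c 0 * d 2 + c 1 * d 1 + c 2 * d 0 + c 2 * d 2], ?_⟩
    simp only [hqφ, Matrix.cons_val]
    push_cast
    linear_combination (c 1 * d 2 + c 2 * d 1 + c 2 * d 2 * φ H.t) * h3
  have hsub : ∀ c d : Fin 3 → ℤ, φ (H.q c) - φ (H.q d) = φ (H.q (c - d)) := by
    intro c d
    simp only [hqφ, Pi.sub_apply]; push_cast; ring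
  -- independence
  have hind : ∀ c d : Fin 3 → ℤ, φ (H.q c) = φ (1 + H.J) * φ (H.q d) →
      (∀ j, (2 : ℤ) ∣ c j) ∧ (∀ j, (2 : ℤ) ∣ d j) := by
    intro c d hcd
    rw [← map_mul] at hcd
    obtain ⟨v, hv⟩ := Ideal.mem_span_singleton.1 ((Ideal.Quotient.eq).1 hcd)
    have hc : ∀ j, (2 : ℤ) ∣ c j := H.R2 c ⟨H.q d + (1 - H.J) * v, by rw [H.two] at hv; linear_combination hv⟩
    refine ⟨hc, H.R2 d ?_⟩
    choose c' hc' using hc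
    have hcc : H.q c = 2 * H.q c' := by
      simp only [Fld.q, hc']; push_cast; ring
    rw [hcc] at hv
    have h0 : (1 + H.J) ≠ 0 := by
      intro h0; apply H.not_unit; rw [h0]
      have := H.two
      rw [h0, zero_mul] at this
      exact absurd this two_ne_zero
    refine ⟨-H.J * (H.q c' - v), ?_⟩
    apply mul_left_cancel₀ h0
    linear_combination -hv + (2 + H.J) * (H.q c' - v) * H.J2
  have hpi : φ (1 + H.J) ^ 2 = 0 := by
    rw [map_add, map_one]
    linear_combination hJ + (1 + φ H.J) * h2
  have hsq : φ ((H.q p + (1 + H.J) * y) ^ 2) = φ (H.q p) ^ 2 := by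
    simp only [map_pow, map_add, map_mul] at hpi ⊢
    linear_combination (φ y) ^ 2 * hpi + (φ (H.q p) * (φ 1 + φ H.J) * φ y) * h2
  have hmain := congrArg φ h
  rw [map_mul, hsq, hu] at hmain
  simp only [map_add φ (_ + _), map_add φ (H.q a), map_mul, map_ofNat φ] at hmain
  rw [h2, zero_mul, add_zero] at hmain
  obtain ⟨p2, hp2⟩ := hmul p p
  obtain ⟨bp, hbp⟩ := hmul b p2
  obtain ⟨ap, hap⟩ := hmul a p2
  have e1 : φ (H.q (n - ap)) = φ (1 + H.J) * φ (H.q bp) := by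
    rw [← hsub, ← hmain, ← hap, ← hbp, ← hp2]; ring
  obtain ⟨hA, hB⟩ := hind _ _ e1
  have hz : ∀ c : Fin 3 → ℤ, (∀ j, (2 : ℤ) ∣ c j) → φ (H.q c) = 0 := by
    intro c hc
    choose c' hc' using hc
    rw [hqφ]; simp only [hc']; push_cast
    linear_combination (c' 0 + c' 1 * φ H.t + c' 2 * φ H.t ^ 2) * h2
  have hz' : ∀ c : Fin 3 → ℤ, φ (H.q c) = 0 → (∀ j, (2 : ℤ) ∣ c j) := by
    intro c hc
    exact (hind c 0 (by rw [hc]; simp [Fld.q])).1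
  have hbp0 := hz _ hB
  obtain ⟨b', hb'⟩ := f8_inv h2 h3 b hb
  rw [← hqφ, ← hqφ] at hb'
  have hp20 : φ (H.q p2) = 0 := by
    rw [hbp0] at hbp
    linear_combination φ (H.q b') * hbp - φ (H.q p2) * hb'
  apply hn
  apply hz'
  rw [← hmain, sq, hp2, hp20, mul_zero]

lemma Fld.key8 (H : Fld L θ I) (a b c : ℕ) (ha : a < 2) (hb : b < 2) (hc : c < 2) (w : 𝓞 L) (n : Fin 3 → ℤ)
    (hn : ¬ ∀ j, (2 : ℤ) ∣ n j) (h : H.J ^ a * H.e1 ^ b * H.e2 ^ c * w ^ 2 = H.q n) :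
    a = 0 ∧ b = 0 ∧ c = 0 := by
  by_contra hne
  have fin : ∀ x y : Fin 3 → ℤ, (∃ z, H.J ^ a * H.e1 ^ b * H.e2 ^ c = H.q x + (1 + H.J) * H.q y + 2 * z) →
      ∀ j, (2 : ℤ) ∣ y j := by
    intro x y hxy
    obtain ⟨z, hz⟩ := hxy
    by_contra hy
    exact H.key _ w n x y z hz hy hn h
  have hJ := H.J2
  have h3 := H.t3
  have red : ∀ x y : Fin 3 → ℤ, ∀ z, (H.J ^ a * H.e1 ^ b * H.e2 ^ c = H.q x + (1 + H.J) * H.q y + 2 * z) →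
      ∀ j, (2 : ℤ) ∣ y j := fun x y z hz => fin x y ⟨z, hz⟩
  interval_cases a <;> interval_cases b <;> interval_cases c
  · simp at hne
  · have := red ![1, 1, 1] ![1, 1, 0] ((-1) * H.J ^ 0 * H.t ^ 0 + (-1) * H.J ^ 0 * H.t ^ 2 + (-1) * H.J ^ 1 * H.t ^ 0) (by
      simp [Fld.q, Fld.e1, Fld.e2]
      linear_combination (0) * h3 + (0) * hJ) 0
    simp at this
  · have := red ![0, 1, 1] ![1, 0, 0] ((-1) * H.J ^ 0 * H.t ^ 0 + (-1) * H.J ^ 0 * H.t ^ 1 + (-1) * H.J ^ 1 * H.t ^ 1) (by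
      simp [Fld.q, Fld.e1, Fld.e2]
      linear_combination (0) * h3 + (0) * hJ) 0
    simp at this
  · have := red ![0, 0, 1] ![0, 1, 1] ((-1) * H.J ^ 0 * H.t ^ 1 + (-1) * H.J ^ 0 * H.t ^ 2 + (-1) * H.J ^ 1 * H.t ^ 2) (by
      simp [Fld.q, Fld.e1, Fld.e2]
      linear_combination ((1) * H.J ^ 0 * H.t ^ 0 + (-1) * H.J ^ 0 * H.t ^ 1 + (1) * H.J ^ 1 * H.t ^ 0) * h3 + ((-1) * H.J ^ 0 * H.t ^ 0 + (1) * H.J ^ 0 * H.t ^ 1) * hJ) 1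
    simp at this
  · have := red ![1, 0, 0] ![1, 0, 0] ((-1) * H.J ^ 0 * H.t ^ 0) (by
      simp [Fld.q, Fld.e1, Fld.e2]
      linear_combination (0) * h3 + (0) * hJ) 0
    simp at this
  · have := red ![1, 1, 1] ![0, 0, 1] ((-1) * H.J ^ 0 * H.t ^ 1 + (-1) * H.J ^ 0 * H.t ^ 2 + (1) * H.J ^ 1 * H.t ^ 1 + (-1) * H.J ^ 1 * H.t ^ 2) (by
      simp [Fld.q, Fld.e1, Fld.e2]
      linear_combination (0) * h3 + ((-1) * H.J ^ 0 * H.t ^ 0 + (1) * H.J ^ 0 * H.t ^ 1) * hJ) 2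
    simp at this
  · have := red ![0, 1, 1] ![1, 1, 1] ((-1) * H.J ^ 0 * H.t ^ 0 + (-1) * H.J ^ 0 * H.t ^ 2 + (-1) * H.J ^ 1 * H.t ^ 0 + (-1) * H.J ^ 1 * H.t ^ 1) (by
      simp [Fld.q, Fld.e1, Fld.e2]
      linear_combination (0) * h3 + ((1) * H.J ^ 0 * H.t ^ 0 + (-2) * H.J ^ 0 * H.t ^ 1) * hJ) 0
    simp at this
  · have := red ![0, 0, 1] ![0, 1, 0] ((-1) * H.J ^ 0 * H.t ^ 1 + (-1) * H.J ^ 1 * H.t ^ 1) (by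
      simp [Fld.q, Fld.e1, Fld.e2]
      linear_combination ((1) * H.J ^ 1 * H.t ^ 0 + (-1) * H.J ^ 1 * H.t ^ 1 + (1) * H.J ^ 2 * H.t ^ 0) * h3 + ((1) * H.J ^ 0 * H.t ^ 1 + (-1) * H.J ^ 0 * H.t ^ 2 + (-1) * H.J ^ 1 * H.t ^ 0 + (1) * H.J ^ 1 * H.t ^ 1) * hJ) 1
    simp at this

end
end Q13
open Polynomial NumberField

namespace Q13

lemma grp8 {G : Type*} [CommGroup G] (g0 g1 g2 : G)
    (hg : ∀ x : G, ∃ i j k : ℤ, x = g0 ^ i * g1 ^ j * g2 ^ k)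
    (v : Fin 2 × Fin 2 × Fin 2 → G)
    (hv : ∀ s s' y, v s = v s' * y ^ 2 → s = s') (x : G) : ∃ s y, x = v s * y ^ 2 := by
  have half : ∀ (g : G) (i : ℤ), ∃ (a : Fin 2) (y : G), g ^ i = g ^ (a : ℕ) * y ^ 2 := by
    intro g i
    rcases Int.even_or_odd' i with ⟨y, rfl | rfl⟩
    · refine ⟨0, g ^ y, ?_⟩
      simp [zpow_mul, zpow_two, pow_two, mul_zpow]
    · refine ⟨1, g ^ y, ?_⟩
      simp [zpow_mul, zpow_add, zpow_two, pow_two, mul_zpow, mul_comm]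
  have nf : ∀ x : G, ∃ (u : Fin 2 × Fin 2 × Fin 2) (y : G),
      x = g0 ^ (u.1 : ℕ) * g1 ^ (u.2.1 : ℕ) * g2 ^ (u.2.2 : ℕ) * y ^ 2 := by
    intro x
    obtain ⟨i, j, k, rfl⟩ := hg x
    obtain ⟨a, y, h1⟩ := half g0 i
    obtain ⟨b, z, h2⟩ := half g1 j
    obtain ⟨c, w, h3⟩ := half g2 k
    refine ⟨(a, b, c), y * z * w, ?_⟩
    rw [h1, h2, h3]
    simp only [mul_pow]
    simp only [mul_comm, mul_left_comm, mul_assoc]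
  choose F Y hF using fun s => nf (v s)
  have inj : Function.Injective F := by
    intro s s' h
    apply hv s s' (Y s * (Y s')⁻¹)
    rw [hF s, hF s', h, mul_pow, inv_pow, mul_comm (Y s ^ 2), mul_assoc _ (Y s' ^ 2), mul_inv_cancel_left]
  obtain ⟨u, z, hz⟩ := nf x
  obtain ⟨s, rfl⟩ := (Finite.surjective_of_injective inj) u
  refine ⟨s, z * (Y s)⁻¹, ?_⟩
  rw [hF s, hz, mul_pow, inv_pow, mul_comm (z ^ 2), mul_assoc _ (Y s ^ 2), mul_inv_cancel_left]

section
variable {L : Type} [Field L] [NumberField L] {θ I : L}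

lemma Fld.rank2 (H : Fld L θ I) : NumberField.Units.rank L = 2 := by
  haveI := H.tc
  classical
  have h := InfinitePlace.card_eq_nrRealPlaces_add_nrComplexPlaces L
  have h2 : InfinitePlace.nrRealPlaces L = 0 := by
    simp
  rw [NumberField.Units.rank, h, H.nrc, h2]

lemma Fld.gens (H : Fld L θ I) : ∃ g0 g1 g2 : (𝓞 L)ˣ, ∀ x, ∃ i j k : ℤ, x = g0 ^ i * g1 ^ j * g2 ^ k := by
  obtain ⟨g, hg⟩ := IsCyclic.exists_generator (α := NumberField.Units.torsion L)
  have r := H.rank2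
  let e : Fin 2 ≃ Fin (NumberField.Units.rank L) := finCongr r.symm
  refine ⟨g, NumberField.Units.fundSystem L (e 0), NumberField.Units.fundSystem L (e 1), fun x => ?_⟩
  obtain ⟨⟨ζ, f⟩, h, -⟩ := NumberField.Units.exist_unique_eq_mul_prod L x
  obtain ⟨i, hi⟩ := Subgroup.mem_zpowers_iff.1 (hg ζ)
  refine ⟨i, f (e 0), f (e 1), ?_⟩
  simp only at h
  rw [h, ← Equiv.prod_comp e, Fin.prod_univ_two, ← hi, mul_assoc]
  simp

lemma Fld.uJ (H : Fld L θ I) : IsUnit H.J := IsUnit.of_mul_eq_one (-H.J) (by linear_combination -H.J2)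
lemma Fld.ue1 (H : Fld L θ I) : IsUnit H.e1 :=
  IsUnit.of_mul_eq_one (-H.e1 * (H.t^2-(2+2*H.J)*H.t-(1-2*H.J))) (by
    linear_combination - (H.t^2-(2+2*H.J)*H.t-(1-2*H.J)) * H.e1sq - H.t3)
lemma Fld.ue2 (H : Fld L θ I) : IsUnit H.e2 :=
  IsUnit.of_mul_eq_one (-H.e2 * (H.t^2+H.t+1-(2+2*H.J)*(H.t+1)-(1-2*H.J))) (by
    linear_combination - (H.t^2+H.t+1-(2+2*H.J)*(H.t+1)-(1-2*H.J)) * H.e2sq + H.t3)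

lemma Fld.units (H : Fld L θ I) (u : (𝓞 L)ˣ) : ∃ (a b c : Fin 2) (y : 𝓞 L),
    (u : 𝓞 L) = H.J ^ (a : ℕ) * H.e1 ^ (b : ℕ) * H.e2 ^ (c : ℕ) * y ^ 2 := by
  obtain ⟨j, hj⟩ := H.uJ
  obtain ⟨d, hd⟩ := H.ue1
  obtain ⟨e, he⟩ := H.ue2
  obtain ⟨g0, g1, g2, hg⟩ := H.gens
  have key := H.key8
  obtain ⟨⟨a, b, c⟩, y, h⟩ := grp8 g0 g1 g2 hg
    (fun s => j ^ (s.1 : ℕ) * d ^ (s.2.1 : ℕ) * e ^ (s.2.2 : ℕ)) (by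
      rintro ⟨a, b, c⟩ ⟨a', b', c'⟩ y h
      simp only at h
      have h' : H.J ^ (a : ℕ) * H.e1 ^ (b : ℕ) * H.e2 ^ (c : ℕ) =
          H.J ^ (a' : ℕ) * H.e1 ^ (b' : ℕ) * H.e2 ^ (c' : ℕ) * (y : 𝓞 L) ^ 2 := by
        have := congrArg (Units.val) h
        push_cast at this
        rwa [hj, hd, he] at this
      -- v(a-a') w^2 = 1
      have hh : ∀ (x : (𝓞 L)ˣ) (a a' : Fin 2), ∃ z : (𝓞 L)ˣ,
          x ^ (((a : ℕ) + a') % 2) * z ^ 2 * x ^ (a' : ℕ) = x ^ (a : ℕ) := by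
        intro x a a'
        fin_cases a <;> fin_cases a' <;> simp
        · exact ⟨1, by simp⟩
        · exact ⟨x⁻¹, by group⟩
        · exact ⟨1, by simp⟩
        · exact ⟨1, by simp⟩
      obtain ⟨z1, h1⟩ := hh j a a'
      obtain ⟨z2, h2⟩ := hh d b b'
      obtain ⟨z3, h3⟩ := hh e c c'
      have hfin : j ^ (((a : ℕ) + a') % 2) * d ^ (((b : ℕ) + b') % 2) * e ^ (((c : ℕ) + c') % 2) *
          (z1 * z2 * z3 * y⁻¹) ^ 2 = 1 := by
        rw [← h1, ← h2, ← h3] at h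
        have h4 : (j ^ (((a : ℕ) + a') % 2) * d ^ (((b : ℕ) + b') % 2) * e ^ (((c : ℕ) + c') % 2) *
          (z1 * z2 * z3) ^ 2) * (j ^ (a' : ℕ) * d ^ (b' : ℕ) * e ^ (c' : ℕ)) =
            y ^ 2 * (j ^ (a' : ℕ) * d ^ (b' : ℕ) * e ^ (c' : ℕ)) := by
          rw [mul_comm (y ^ 2), ← h]
          simp only [mul_pow]
          simp only [mul_comm, mul_left_comm, mul_assoc]
        have h5 := mul_right_cancel h4
        rw [mul_pow _ y⁻¹, ← mul_assoc, h5, inv_pow, mul_inv_cancel]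
      have h6 := congrArg Units.val hfin
      push_cast at h6
      rw [hj, hd, he] at h6
      have h7 := key _ _ _ (Nat.mod_lt _ (by norm_num)) (Nat.mod_lt _ (by norm_num))
        (Nat.mod_lt _ (by norm_num)) _ ![1, 0, 0] (by
          intro hx; have := hx 0; norm_num at this) (h6.trans (by simp [Fld.q]))
      simp only [Prod.mk.injEq, Fin.ext_iff]
      omega) u
  refine ⟨a, b, c, y, ?_⟩
  rw [h]; push_cast
  rw [hj, hd, he]

lemma Fld.sq_of_unit (H : Fld L θ I) (n : Fin 3 → ℤ) (hn : ¬ ∀ j, (2 : ℤ) ∣ n j) (β : 𝓞 L)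
    (h : Associated (β ^ 2) (H.q n)) : ∃ β : 𝓞 L, H.q n = β ^ 2 := by
  obtain ⟨u, hu⟩ := h
  obtain ⟨a, b, c, y, hy⟩ := H.units u
  have := H.key8 a b c a.2 b.2 c.2 (y * β) n hn (by rw [← hu, hy]; ring)
  obtain ⟨ha, hb, hc⟩ := this
  rw [ha, hb, hc] at hy
  exact ⟨y * β, by rw [← hu, hy]; ring⟩
end
end Q13
open Polynomial NumberField

namespace Q13

/-- over a field, `n W = V²`, `deg n ≤ 2`, `n` and `W` with a common root imply `n ∣ V` -/
lemma dvd_of_common {F k : Type*} [Field F] [Field k] [Algebra F k] (n W V : F[X]) (hn : n ≠ 0)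
    (hd : n.natDegree ≤ 2) (h : V ^ 2 = n * W) (s : k) (h1 : aeval s n = 0) (h2 : aeval s W = 0) :
    n ∣ V := by
  have h3 : aeval s V = 0 := by
    have := congrArg (aeval s) h
    rw [map_pow, map_mul, h1, zero_mul] at this
    exact pow_eq_zero_iff (two_ne_zero) |>.1 this
  have hi : IsIntegral F s := by
    rw [← isAlgebraic_iff_isIntegral]; exact ⟨n, hn, h1⟩
  obtain ⟨a, ha⟩ := minpoly.dvd F s h1
  obtain ⟨b, hb⟩ := minpoly.dvd F s h2
  obtain ⟨v, hv⟩ := minpoly.dvd F s h3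
  have hm := minpoly.ne_zero hi
  have hm1 := minpoly.natDegree_pos hi
  have hab : v ^ 2 = a * b := by
    apply mul_left_cancel₀ (pow_ne_zero 2 hm)
    rw [ha, hb, hv] at h
    linear_combination h
  have ha0 : a ≠ 0 := by rintro rfl; simp at ha; exact hn ha
  have had : a.natDegree ≤ 1 := by
    have := natDegree_mul hm ha0
    rw [← ha] at this; omega
  have hav : a ∣ v := by
    rcases Nat.le_one_iff_eq_zero_or_eq_one.1 had with h0 | h0
    · have : IsUnit a := by
        rw [Polynomial.isUnit_iff_degree_eq_zero, degree_eq_natDegree ha0, h0]; rfl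
      exact this.dvd
    · have : Irreducible a := by
        apply irreducible_of_degree_eq_one
        rw [degree_eq_natDegree ha0, h0]; rfl
      exact this.prime.dvd_of_dvd_pow (hab ▸ dvd_mul_right a b)
  rw [ha, hv]
  exact mul_dvd_mul_left _ hav

def Good (n : Fin 3 → ℤ) (N : ℕ) : Prop :=
  0 < N ∧ ∃ V W : ℤ[X], V ^ 2 - C (N : ℤ) ^ 2 * fP ℤ = P2 n * W

lemma P2_natDegree {R : Type*} [CommRing R] (n : Fin 3 → R) : (P2 n).natDegree ≤ 2 := by
  unfold P2; compute_degree

lemma P2_ne_zero_mod (n : Fin 3 → ℤ) (p : ℕ) (h : ¬ ∀ j, (p : ℤ) ∣ n j) :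
    (P2 n).map (Int.castRingHom (ZMod p)) ≠ 0 := by
  intro h0
  apply h
  intro j
  have h1 := congrArg (fun q => coeff q (j : ℕ)) h0
  simp only [coeff_map, coeff_zero, eq_intCast] at h1
  rw [ZMod.intCast_zmod_eq_zero_iff_dvd] at h1 
  convert h1 using 1
  fin_cases j <;> simp [P2, coeff_X, coeff_C, -eq_intCast, -map_intCast]

lemma reduceN (n : Fin 3 → ℤ) (N p : ℕ) (hp : p.Prime) (hprim : ¬ ∀ j, (p : ℤ) ∣ n j)
    (hpN : p ∣ N) (h0 : 0 < N) (V W : ℤ[X]) (h : V ^ 2 - C (N : ℤ) ^ 2 * fP ℤ = P2 n * W)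
    (hd : (P2 n).map (Int.castRingHom (ZMod p)) ∣ V.map (Int.castRingHom (ZMod p))) :
    ∃ N' < N, Good n N' := by
  obtain ⟨N', rfl⟩ := hpN
  obtain ⟨l', hl'⟩ := hd
  obtain ⟨l, rfl⟩ := Polynomial.map_surjective (Int.castRingHom (ZMod p)) ZMod.intCast_surjective l'
  have key : ∀ q : ℤ[X], q.map (Int.castRingHom (ZMod p)) = 0 ↔ C (p : ℤ) ∣ q := by
    intro q
    rw [C_dvd_iff_dvd_coeff, Polynomial.ext_iff]
    simp [ZMod.intCast_zmod_eq_zero_iff_dvd]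
  have h1 : C (p : ℤ) ∣ V - P2 n * l := by
    rw [← key, Polynomial.map_sub, Polynomial.map_mul, hl', sub_self]
  obtain ⟨V1, hV1⟩ := h1
  have hP : Prime (C (p : ℤ)) := Polynomial.prime_C_iff.2 (Nat.prime_iff_prime_int.1 hp)
  have h2 : C (p : ℤ) ^ 2 ∣ W - 2 * V * l + P2 n * l ^ 2 := by
    apply hP.pow_dvd_of_dvd_mul_left 2 (a := P2 n)
    · rw [← key]; exact P2_ne_zero_mod n p hprim
    · refine ⟨V1 ^ 2 - C (N' : ℤ) ^ 2 * fP ℤ, ?_⟩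
      have : V = C (p : ℤ) * V1 + P2 n * l := by linear_combination hV1
      push_cast at h
      rw [C_mul] at h
      linear_combination (-1) * h + (V - P2 n * l + C (p : ℤ) * V1) * hV1
  obtain ⟨W1, hW1⟩ := h2
  have hN' : 0 < N' := Nat.pos_of_mul_pos_left h0
  refine ⟨N', ?_, hN', V1, W1, ?_⟩
  · have := hp.two_le; nlinarith
  · apply mul_left_cancel₀ (pow_ne_zero 2 hP.ne_zero)
    push_cast at h
    rw [C_mul] at h
    linear_combination h + P2 n * hW1 - (V - P2 n * l + C (p : ℤ) * V1) * hV1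

lemma cop_field (n : Fin 3 → ℤ) (hprim : ∀ p : ℕ, p.Prime → ¬ ∀ j, (p : ℤ) ∣ n j) (N : ℕ)
    (hN : 0 < N) (hmin : ∀ N' < N, ¬ Good n N') (V W : ℤ[X])
    (h : V ^ 2 - C (N : ℤ) ^ 2 * fP ℤ = P2 n * W) {k : Type} [Field k] (s : k)
    (hf : s ^ 6 - 4 * s ^ 5 + 6 * s ^ 4 - 2 * s ^ 3 + s ^ 2 - 2 * s + 1 = 0)
    (h1 : aeval s (P2 n) = 0) (h2 : aeval s W = 0) : False := by
  have hfs : aeval s (fP ℤ) = 0 := by rw [aeval_fP']; exact hf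
  by_cases h2k : (2 : k) = 0
  · have hs : s ^ 3 = s + 1 := by
      have : (s ^ 3 - (s + 1)) ^ 2 = 0 := by
        linear_combination hf + (2 * s ^ 5 - 4 * s ^ 4 + 2 * s) * h2k
      exact sub_eq_zero.1 (pow_eq_zero_iff two_ne_zero |>.1 this)
    obtain ⟨d, hd⟩ := f8_inv h2k hs n (hprim 2 Nat.prime_two)
    have : aeval s (P2 n) = (n 0 : k) + n 1 * s + n 2 * s ^ 2 := by simp [P2]
    rw [← this, h1, zero_mul] at hd
    exact zero_ne_one hd
  by_cases hNk : (N : k) = 0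
  · obtain ⟨p, hp, hpN, hpk⟩ : ∃ p : ℕ, p.Prime ∧ p ∣ N ∧ (p : k) = 0 := by
      have hx := Nat.prod_primeFactorsList hN.ne'
      have := congrArg (Nat.cast (R := k)) hx
      rw [hNk, Nat.cast_list_prod, List.prod_eq_zero_iff] at this
      obtain ⟨p, hp, hpk⟩ := List.mem_map.1 this
      exact ⟨p, Nat.prime_of_mem_primeFactorsList hp, Nat.dvd_of_mem_primeFactorsList hp, hpk⟩
    haveI : Fact p.Prime := ⟨hp⟩
    haveI : CharP k p := (CharP.charP_iff_prime_eq_zero hp).2 hpk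
    letI := ZMod.algebra k p
    have hmap : ∀ q : ℤ[X], aeval s (q.map (Int.castRingHom (ZMod p))) = aeval s q := by
      intro q
      rw [aeval_def, eval₂_map, aeval_def]
      congr 1
      exact RingHom.ext_int _ _
    have hdv := dvd_of_common ((P2 n).map (Int.castRingHom (ZMod p))) (W.map (Int.castRingHom (ZMod p)))
      (V.map (Int.castRingHom (ZMod p))) (P2_ne_zero_mod n p (hprim p hp))
      (natDegree_map_le.trans (P2_natDegree n)) (by
        have := congrArg (Polynomial.map (Int.castRingHom (ZMod p))) h
        simp only [Polynomial.map_sub, Polynomial.map_mul, Polynomial.map_pow, map_C] at this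
        simp only [eq_intCast (Int.castRingHom (ZMod p))] at this
        rw [← this]
        have : ((N : ℤ) : ZMod p) = 0 := by
          rw [ZMod.intCast_zmod_eq_zero_iff_dvd]; exact_mod_cast hpN
        rw [this]; simp) s (by rw [hmap, h1]) (by rw [hmap, h2])
    obtain ⟨N', hlt, hg⟩ := reduceN n N p hp (hprim p hp) hpN hN V W h hdv
    exact hmin N' hlt hg
  · have hV : aeval s V = 0 := by
      have := congrArg (aeval s) h
      rw [map_sub, map_mul, map_pow, map_mul, h1, hfs] at this
      simpa using this
    have hf' : aeval s (derivative (fP ℤ)) = 0 := by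
      have := congrArg (fun q => aeval s (derivative q)) h
      simp only [derivative_sub, derivative_mul, derivative_pow, derivative_C, map_sub, map_add,
        map_mul, map_pow, h1, h2, hV] at this
      simpa [hNk] using this
    have hf'' : 6 * s ^ 5 - 20 * s ^ 4 + 24 * s ^ 3 - 6 * s ^ 2 + 2 * s - 2 = 0 := by
      rw [← hf']
      simp [fP, map_ofNat (aeval s : ℤ[X] →ₐ[ℤ] k)]
      ring
    have h104 : (104 : k) = 0 := by
      linear_combination (234+192*s+606*s^2-784*s^3+300*s^4) * hf + (65-73*s-40*s^2-177*s^3+164*s^4-50*s^5) * hf''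
    have h13 : (13 : k) = 0 := by
      have : (2 : k) ^ 3 * 13 = 0 := by linear_combination h104
      rcases mul_eq_zero.1 this with h' | h'
      · exact (h2k (pow_eq_zero_iff (by norm_num) |>.1 h')).elim
      · exact h'
    have hs4 : s = 4 := by
      have hsq : (3 * s + 1) ^ 2 = 0 := by
        linear_combination (2 * s + 11 * s ^ 2) * hf + (6 + 4 * s + 11 * s ^ 2 + 9 * s ^ 3) * hf'' +
          ((1)*s^0 + (0)*s^1 + (4)*s^2 + (-8)*s^3 + (5)*s^4 + (-12)*s^5 + (-6)*s^6 + (12)*s^7 + (-5)*s^8) * h13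
      have h31 := pow_eq_zero_iff two_ne_zero |>.1 hsq
      linear_combination (-4 : k) * h31 + s * h13
    have hz : ∀ z : ℤ, (z : k) = 0 → (13 : ℤ) ∣ z := by
      intro z hz
      by_contra hnd
      have hc : IsCoprime (13 : ℤ) z :=
        ((Int.prime_iff_natAbs_prime.2 (by norm_num)).coprime_iff_not_dvd).2 hnd
      obtain ⟨a, b, hab⟩ := hc
      have := congrArg (Int.cast (R := k)) hab
      push_cast at this
      rw [h13, hz] at this
      simp at this
    have hev : ∀ q : ℤ[X], aeval s q = 0 → (13 : ℤ) ∣ q.eval 4 := by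
      intro q hq
      apply hz
      rw [← hq, hs4]
      have : (4 : k) = algebraMap ℤ k 4 := by simp
      rw [this, aeval_algebraMap_apply]
      simp
    obtain ⟨a, ha⟩ := hev _ h1
    obtain ⟨b, hb⟩ := hev _ h2
    obtain ⟨c, hc⟩ := hev _ hV
    have h4 := congrArg (eval 4) h
    simp only [eval_sub, eval_mul, eval_pow, eval_C, ha, hb, hc] at h4
    have hf4 : (fP ℤ).eval 4 = 1417 := by simp [fP]
    rw [hf4] at h4
    have h5 : (13 : ℤ) ∣ (N : ℤ) ^ 2 * 109 := ⟨c ^ 2 - a * b, by linarith⟩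
    have h6 : (13 : ℤ) ∣ N := by
      have p13 : Prime (13 : ℤ) := Int.prime_iff_natAbs_prime.2 (by norm_num)
      rcases p13.dvd_or_dvd h5 with h' | h'
      · exact p13.dvd_of_dvd_pow h'
      · norm_num at h'
    obtain ⟨d, hd⟩ := h6
    apply hNk
    have := congrArg (Int.cast (R := k)) hd
    push_cast at this
    rw [this, h13, zero_mul]

section
variable {L : Type} [Field L] [NumberField L] {θ I : L}

lemma Fld.coprime (H : Fld L θ I) (n : Fin 3 → ℤ) (hprim : ∀ p : ℕ, p.Prime → ¬ ∀ j, (p : ℤ) ∣ n j) (N : ℕ)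
    (hN : 0 < N) (hmin : ∀ N' < N, ¬ Good n N') (V W : ℤ[X])
    (h : V ^ 2 - C (N : ℤ) ^ 2 * fP ℤ = P2 n * W) :
    IsCoprime (aeval H.t (P2 n)) (aeval H.t W) := by
  rw [← Ideal.isCoprime_span_singleton_iff, Ideal.isCoprime_iff_sup_eq]
  by_contra hne
  obtain ⟨M, hM, hle⟩ := Ideal.exists_le_maximal _ hne
  letI := Ideal.Quotient.field M
  have m1 : aeval H.t (P2 n) ∈ M := hle (Ideal.mem_sup_left (Ideal.mem_span_singleton_self _))
  have m2 : aeval H.t W ∈ M := hle (Ideal.mem_sup_right (Ideal.mem_span_singleton_self _))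
  have hev : ∀ q : ℤ[X], aeval H.t q ∈ M → aeval (Ideal.Quotient.mk M H.t) q = 0 := by
    intro q hq
    rw [← Ideal.Quotient.eq_zero_iff_mem] at hq
    rw [← hq, aeval_def, aeval_def, hom_eval₂]
    congr 1
  refine cop_field n hprim N hN hmin V W h (Ideal.Quotient.mk M H.t) ?_ (hev _ m1) (hev _ m2)
  have := congrArg (Ideal.Quotient.mk M) H.t_f
  simpa only [map_add, map_sub, map_mul, map_pow, map_ofNat, map_one, map_zero] using this

lemma Fld.sqZ (H : Fld L θ I) (n : Fin 3 → ℤ) (hprim : ∀ p : ℕ, p.Prime → ¬ ∀ j, (p : ℤ) ∣ n j)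
    (hex : ∃ N, Good n N) : ∃ β : 𝓞 L, H.q n = β ^ 2 := by
  classical
  have hg := Nat.find_spec hex
  have hm := fun N' (h : N' < Nat.find hex) => Nat.find_min hex h
  obtain ⟨h0, V, W, h⟩ := hg
  have hc := H.coprime n hprim _ h0 hm V W h
  have hq : aeval H.t (P2 n) = H.q n := by simp [P2, Fld.q]
  have hft : aeval H.t (fP ℤ) = 0 := by rw [aeval_fP']; exact H.t_f
  haveI := H.pid
  have hmul : aeval H.t (P2 n) * aeval H.t W = (aeval H.t V) ^ 2 := by
    have := congrArg (aeval H.t) h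
    rw [map_sub, map_mul, hft, map_mul, map_pow] at this
    simpa using this.symm
  obtain ⟨d, hd⟩ := exists_associated_pow_of_mul_eq_pow' hc hmul
  rw [hq] at hd
  exact H.sq_of_unit n (hprim 2 Nat.prime_two) d hd
end

lemma exists_good (n : Fin 3 → ℤ) (V : Fin 4 → ℚ) (w : Fin 5 → ℚ)
    (h : P3 V ^ 2 - fP ℚ = P2 (fun j => (n j : ℚ)) * P4 w) : ∃ N, Good n N := by
  obtain ⟨⟨d1, h1⟩, hd1⟩ := IsLocalization.exist_integer_multiples_of_finite (nonZeroDivisors ℤ) V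
  obtain ⟨⟨d2, h2⟩, hd2⟩ := IsLocalization.exist_integer_multiples_of_finite (nonZeroDivisors ℤ) w
  choose V' hV' using hd1
  choose w' hw' using hd2
  simp only [Algebra.smul_def, algebraMap_int_eq, eq_intCast] at hV' hw'
  have e1 : d1 ≠ 0 := nonZeroDivisors.ne_zero h1
  have e2 : d2 ≠ 0 := nonZeroDivisors.ne_zero h2
  refine ⟨(d1 * d2).natAbs, by positivity, C d2 * P3 V', C (d1 ^ 2 * d2) * P4 w', ?_⟩
  have hsq : C (((d1 * d2).natAbs : ℕ) : ℤ) ^ 2 = C (d1 * d2) ^ 2 := by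
    rw [← C_pow, ← C_pow, Int.natAbs_sq]
  rw [hsq]
  apply Polynomial.map_injective (Int.castRingHom ℚ) Int.cast_injective
  simp only [Polynomial.map_sub, Polynomial.map_mul, Polynomial.map_pow, map_C, Int.coe_castRingHom, map_P2,
    map_P3, map_P4, map_fP]
  have hv : P3 ((fun x : ℤ => (x : ℚ)) ∘ V') = C (d1 : ℚ) * P3 V := by
    simp [P3, hV']; ring
  have hw : P4 ((fun x : ℤ => (x : ℚ)) ∘ w') = C (d2 : ℚ) * P4 w := by
    simp [P4, hw']; ring
  have hn : P2 ((fun x : ℤ => (x : ℚ)) ∘ n) = P2 (fun j => (n j : ℚ)) := rfl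
  rw [hv, hw, hn]
  push_cast
  simp only [C_mul, C_pow, -eq_intCast, -map_intCast]
  linear_combination C (d1 : ℚ) ^ 2 * C (d2 : ℚ) ^ 2 * h

end Q13
open Polynomial NumberField

namespace Q13

def Prim (n : Fin 3 → ℤ) : Prop := ∀ p : ℕ, p.Prime → ¬ ∀ j, (p : ℤ) ∣ n j

/-- integer coefficients as rationals -/
def qn (n : Fin 3 → ℤ) : Fin 3 → ℚ := fun j => (n j : ℚ)

lemma exists_prim (m : Fin 3 → ℚ) (hm : m ≠ 0) : ∃ (m' : Fin 3 → ℤ) (r : ℚ), Prim m' ∧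
    ∀ k, m k = r * m' k := by
  obtain ⟨⟨d1, h1⟩, hd1⟩ := IsLocalization.exist_integer_multiples_of_finite (nonZeroDivisors ℤ) m
  choose V' hV' using hd1
  simp only [Algebra.smul_def, algebraMap_int_eq, eq_intCast] at hV'
  have e1 : (d1 : ℚ) ≠ 0 := by exact_mod_cast nonZeroDivisors.ne_zero h1
  obtain ⟨g, hg, hg1⟩ := Finset.extract_gcd (s := Finset.univ) V' ⟨0, Finset.mem_univ _⟩
  refine ⟨g, (Finset.univ.gcd V' : ℤ) / d1, ?_, ?_⟩
  · intro p hp hd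
    have : (p : ℤ) ∣ Finset.univ.gcd g := Finset.dvd_gcd (fun b _ => hd b)
    rw [hg1] at this
    exact (Nat.prime_iff_prime_int.1 hp).not_dvd_one this
  · intro k
    have h2 := hV' k
    rw [hg k (Finset.mem_univ _)] at h2
    push_cast at h2
    field_simp
    linarith

lemma Prim.ne_zero {n : Fin 3 → ℤ} (h : Prim n) : qn n ≠ 0 := by
  intro h0
  apply h 2 Nat.prime_two
  intro j
  have := congrFun h0 j
  simp only [qn, Pi.zero_apply, Int.cast_eq_zero] at this
  simp [this]

lemma irr_ndvd (n : Fin 3 → ℚ) (h2 : n 2 ≠ 0) : ¬ P2 n ∣ fP ℚ := by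
  rintro ⟨q, hq⟩
  have hd : (P2 n).natDegree = 2 := by
    unfold P2
    compute_degree!
  rcases fP_irr.isUnit_or_isUnit hq with h | h
  · have := natDegree_eq_zero_of_isUnit h
    omega
  · have h3 := natDegree_eq_zero_of_isUnit h
    have h4 := congrArg natDegree hq
    have n0 : P2 n ≠ 0 := by intro h; rw [h] at hd; simp at hd
    rw [natDegree_mul n0 h.ne_zero, h3, hd, fP_natDegree] at h4
    omega

section
variable {L : Type} [Field L] [NumberField L] {θ I : L}

lemma Fld.rel (H : Fld L θ I) (n : Fin 3 → ℚ) (c : ℚ) (β : L) (h : aeval θ (P2 n) * algebraMap ℚ L c = β ^ 2) :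
    ∃ a m k, (a ≠ 0 ∨ m ≠ 0) ∧ Rel n c a m k := by
  let u : Fin 7 → L := ![1, θ, θ ^ 2, θ ^ 3, -β, -β * θ, -β * θ ^ 2]
  have hni : ¬ LinearIndependent ℚ u := by
    intro hli
    have := hli.fintype_card_le_finrank
    rw [H.fr, Fintype.card_fin] at this
    omega
  obtain ⟨g, hg, i, hi⟩ := Fintype.not_linearIndependent_iff.1 hni
  let a : Fin 4 → ℚ := ![g 0, g 1, g 2, g 3]
  let m : Fin 3 → ℚ := ![g 4, g 5, g 6]
  have ham : aeval θ (P3 a) = β * aeval θ (P2 m) := by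
    rw [← sub_eq_zero, ← hg]
    simp [Fin.sum_univ_succ, a, m, u, P3, P2, Algebra.smul_def]
    ring
  have hz : aeval θ (P3 a ^ 2 - C c * P2 n * P2 m ^ 2) = 0 := by
    simp only [map_sub, map_mul, map_pow, aeval_C, ham]
    linear_combination (-(aeval θ (P2 m)) ^ 2) * h
  obtain ⟨d, hd⟩ := H.inj _ hz
  have hdeg : (P3 a ^ 2 - C c * P2 n * P2 m ^ 2).natDegree ≤ 6 := by
    have h1 : (P3 a).natDegree ≤ 3 := by unfold P3; compute_degree
    have h2 := P2_natDegree n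
    have h3 := P2_natDegree m
    refine (natDegree_sub_le _ _).trans (max_le ?_ ?_)
    · exact natDegree_pow_le.trans (by omega)
    · refine natDegree_mul_le.trans ?_
      have h4 := natDegree_C_mul_le c (P2 n)
      have h5 : (P2 m ^ 2).natDegree ≤ 2 * 2 := natDegree_pow_le.trans (by omega)
      omega
  have hd0 : d.natDegree = 0 := by
    by_cases hd0 : d = 0
    · simp [hd0]
    · rw [hd, natDegree_mul (fP_monic ℚ).ne_zero hd0, fP_natDegree] at hdeg
      omega
  rw [eq_C_of_natDegree_eq_zero hd0] at hd
  refine ⟨a, m, d.coeff 0, ?_, by rw [Rel, hd]; ring⟩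
  by_contra hcon
  push Not at hcon
  obtain ⟨h1, h2⟩ := hcon
  apply hi
  have e0 := congrFun h1 0
  have e1 := congrFun h1 1
  have e2 := congrFun h1 2
  have e3 := congrFun h1 3
  have e4 := congrFun h2 0
  have e5 := congrFun h2 1
  have e6 := congrFun h2 2
  fin_cases i
  exacts [e0, e1, e2, e3, e4, e5, e6]
end

theorem rat_step (n : Fin 3 → ℤ) (hn : Prim n) (A : Fin 4 → ℚ) (w : Fin 5 → ℚ)
    (hA : P3 A ^ 2 + hP ℚ * P3 A - gP ℚ = P2 (qn n) * P4 w) :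
    ∃ (m : Fin 3 → ℤ) (B : Fin 4 → ℚ) (c : ℚ) (l : Fin 2 → ℚ), Prim m ∧ MulEq (qn n) (qn m) B c ∧
      P3 B = P3 A + P2 (qn n) * P1 l := by
  set V : Fin 4 → ℚ := ![1 + 2 * A 0, 1 + 2 * A 1, 2 * A 2, 1 + 2 * A 3] with hVd
  have hVP : P3 V = hP ℚ + 2 * P3 A := by
    simp [hVd, P3, hP, map_ofNat (C : ℚ →+* ℚ[X])]; ring
  have hV : P3 V ^ 2 - fP ℚ = P2 (qn n) * P4 (fun k => 4 * w k) := by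
    rw [P4_smul, hVP, map_ofNat C]
    have : hP ℚ ^ 2 - fP ℚ = - 4 * gP ℚ := by simp only [hP, fP, gP]; ring
    linear_combination 4 * hA + this
  obtain ⟨L, _, _, θ, I, H⟩ := exists_fld
  obtain ⟨β, hβ⟩ := H.sqZ n hn (exists_good n V _ hV)
  have hβ' : aeval θ (P2 (qn n)) = (algebraMap (𝓞 L) L β) ^ 2 := by
    rw [← map_pow, ← hβ]
    simp [P2, qn, Fld.q, H.t_coe]
  obtain ⟨c, r, a, m, l, hc, hr, hrel, hl⟩ := descent_step hV hn.ne_zero (irr_ndvd (qn n)) (by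
    rintro c (rfl | rfl)
    · exact H.rel (qn n) 1 (algebraMap (𝓞 L) L β) (by rw [hβ']; simp)
    · exact H.rel (qn n) (-1) (I * algebraMap (𝓞 L) L β) (by rw [hβ', mul_pow, H.hI]; simp))
  have hm : m ≠ 0 := by
    rintro rfl
    have := congrArg (eval (-1)) hrel
    have hf : (fP ℚ).eval (-1) = 17 := by simp [fP]; norm_num
    simp only [eval_sub, eval_mul, eval_pow, eval_C, hf] at this
    have h0 : P2 (0 : Fin 3 → ℚ) = 0 := by simp [P2]
    rw [h0] at this
    simp at this
    have h17 : IsSquare (17 : ℚ) := ⟨eval (-1) (P3 a) / r, by field_simp; linarith⟩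
    revert h17
    norm_num
  obtain ⟨m', s, hm', hms⟩ := exists_prim m hm
  obtain ⟨u, hu⟩ : ∃ u : ℚ[X], u = C (1 / 2) := ⟨_, rfl⟩
  obtain ⟨v, hv⟩ : ∃ v : ℚ[X], v = C (1 / r) := ⟨_, rfl⟩
  have hE : 2 * u = 1 := by
    have : (2 : ℚ[X]) = C 2 := (map_ofNat C 2).symm
    rw [hu, this, ← C_mul]; norm_num
  have hR : v * C r = 1 := by rw [hv, ← C_mul, one_div, inv_mul_cancel₀ hr, C_1]
  have hB : P3 (![(a 0 / r - 1) / 2, (a 1 / r - 1) / 2, a 2 / r / 2, (a 3 / r - 1) / 2]) =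
      u * (v * P3 a - hP ℚ) := by
    simp [P3, hP, div_eq_mul_inv, hu, hv]; ring
  refine ⟨m', ![(a 0 / r - 1) / 2, (a 1 / r - 1) / 2, a 2 / r / 2, (a 3 / r - 1) / 2],
    c * s ^ 2 * (1 / 2) ^ 2 * (1 / r) ^ 2, fun k => (1 / 2) * (1 / r) * l k, hm', ?_, ?_⟩
  · have hm2 : P2 m = C s * P2 (qn m') := by
      simp only [P2, hms, qn, C_mul]; ring
    rw [MulEq, hB, C_mul, C_mul, C_mul, C_pow, C_pow, C_pow, ← hu, ← hv]
    rw [Rel, hm2, C_pow] at hrel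
    have hfg : fP ℚ - hP ℚ ^ 2 - 4 * gP ℚ = 0 := by simp only [hP, fP, gP]; ring
    linear_combination u ^ 2 * v ^ 2 * hrel + (- u * v * P3 a * hP ℚ + u * hP ℚ ^ 2
      + gP ℚ * (2 * u + 1)) * hE + u ^ 2 * fP ℚ * (v * C r + 1) * hR + u ^ 2 * hfg
  · have hl2 : P1 (fun k => (1 / 2) * (1 / r) * l k) = u * v * P1 l := by
      simp only [P1, C_mul, ← hu, ← hv]; ring
    rw [hB, hl2]
    linear_combination u * v * hl + u * P3 V * hR + P3 A * hE + u * hVP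

end Q13
open Polynomial

namespace Q13

/-- integer coefficients as 2-adic integers -/
noncomputable def zn (n : Fin 3 → ℤ) : Fin 3 → Z2 := fun j => (n j : Z2)

lemma rd_int (z : ℤ) : rd (z : Z2) = (z : ZMod 2) := map_intCast rd z

lemma Prim.rd_ne {n : Fin 3 → ℤ} (h : Prim n) :
    rd (zn n 0) ≠ 0 ∨ rd (zn n 1) ≠ 0 ∨ rd (zn n 2) ≠ 0 := by
  by_contra hc
  push Not at hc
  obtain ⟨h0, h1, h2⟩ := hc
  simp only [zn, rd_int] at h0 h1 h2
  apply h 2 Nat.prime_two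
  intro j
  rw [← ZMod.intCast_zmod_eq_zero_iff_dvd]
  fin_cases j
  exacts [h0, h1, h2]

lemma cz_zn (n : Fin 3 → ℤ) : cz ∘ zn n = Rat.castHom Q2 ∘ qn n := by
  funext j
  simp [zn, qn, Function.comp]

def GG : Set ((Fin 3 → Z2) × (Fin 4 → Z2)) :=
  fun s => ∃ n : Fin 3 → ℤ, Prim n ∧ s.1 = zn n ∧ ∃ (A : Fin 4 → ℚ) (w : Fin 5 → ℚ),
    P3 A ^ 2 + hP ℚ * P3 A - gP ℚ = P2 (qn n) * P4 w ∧ (∀ k, cz (s.2 k) = Rat.castHom Q2 (A k)) ∧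
    ∃ wz : Fin 5 → Z2, P3 s.2 ^ 2 + hP Z2 * P3 s.2 - gP Z2 = P2 s.1 * P4 wz

lemma swap_nw {R : Type*} [CommRing R] {n m : Fin 3 → R} {B : Fin 4 → R} {c : R}
    (h : MulEq n m B c) : ∃ w : Fin 5 → R, P3 B ^ 2 + hP R * P3 B - gP R = P2 m * P4 w := by
  refine ⟨![c * (n 0 * m 0), c * (n 0 * m 1 + n 1 * m 0), c * (n 0 * m 2 + n 1 * m 1 + n 2 * m 0),
    c * (n 1 * m 2 + n 2 * m 1), c * (n 2 * m 2)], ?_⟩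
  have : P4 (![c * (n 0 * m 0), c * (n 0 * m 1 + n 1 * m 0), c * (n 0 * m 2 + n 1 * m 1 + n 2 * m 0),
    c * (n 1 * m 2 + n 2 * m 1), c * (n 2 * m 2)] : Fin 5 → R) = C c * P2 n * P2 m := by
    simp [P4, P2]; ring
  rw [this, h]; ring

lemma GG_step (s) (hs : s ∈ GG) : ∃ t ∈ GG, ∃ c, Stp s.1 s.2 t.1 t.2 c := by
  obtain ⟨nz, Az⟩ := s
  obtain ⟨n, hn, h1, A, w, hA, hAz, wz, hwz⟩ := hs
  simp only at h1 hAz hwz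
  subst h1
  obtain ⟨m, B, c, l, hm, hB, hl⟩ := rat_step n hn A w hA
  have hB' := hB.map (Rat.castHom Q2)
  rw [← cz_zn, ← cz_zn] at hB'
  have hAA : cz ∘ Az = Rat.castHom Q2 ∘ A := funext hAz
  have hl' := congrArg (Polynomial.map (Rat.castHom Q2)) hl
  rw [Polynomial.map_add, Polynomial.map_mul, map_P3, map_P3, map_P2, map_P1, ← hAA, ← cz_zn] at hl'
  obtain ⟨B', c', hB1, hc1, hst⟩ := integrality hn.rd_ne hm.rd_ne hwz hB' hl'
  refine ⟨(zn m, B'), ⟨m, hm, rfl, B, ?_⟩, c', hst⟩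
  obtain ⟨w1, hw1⟩ := swap_nw hB
  obtain ⟨w2, hw2⟩ := swap_nw hst.2.1
  exact ⟨w1, hw1, hB1, w2, hw2⟩

lemma lem1 {R : Type*} [CommRing R] (p q Z qi : R) (hq : q * qi = 1)
    (hZ : Z ^ 2 + (p ^ 3 + p * q ^ 2 + q ^ 3) * Z = - p ^ 5 * q + p ^ 4 * q ^ 2 - p ^ 3 * q ^ 3 - p * q ^ 5) :
    ∃ w : Fin 5 → R, P3 ![Z * qi ^ 3, 0, 0, 0] ^ 2 + hP R * P3 ![Z * qi ^ 3, 0, 0, 0] - gP R =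
      P2 ![-p, q, 0] * P4 w := by
  obtain ⟨a, ha⟩ : ∃ a, a = Z * qi ^ 3 := ⟨_, rfl⟩
  obtain ⟨x, hx⟩ : ∃ x, x = p * qi := ⟨_, rfl⟩
  have hp : p = q * x := by rw [hx]; linear_combination (-p) * hq
  have hZa : Z = q ^ 3 * a := by
    rw [ha]; linear_combination (-Z * (q ^ 2 * qi ^ 2 + q * qi + 1)) * hq
  have hq6 : q ^ 6 * qi ^ 6 = 1 := by rw [← mul_pow, hq, one_pow]
  have E : a ^ 2 + (x ^ 3 + x + 1) * a + x ^ 5 - x ^ 4 + x ^ 3 + x = 0 := by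
    rw [hp, hZa] at hZ
    linear_combination qi ^ 6 * hZ - (a ^ 2 + (x ^ 3 + x + 1) * a + x ^ 5 - x ^ 4 + x ^ 3 + x) * hq6
  refine ⟨![qi * ((1 + a) + x * (x * ((1 + a) + x * (-1 + x)))), qi * (x * ((1 + a) + x * (-1 + x))),
    qi * ((1 + a) + x * (-1 + x)), qi * (-1 + x), qi], ?_⟩
  have E' := congrArg (C : R → R[X]) E
  have hq' := congrArg (C : R → R[X]) hq
  rw [hp, ← ha]
  simp only [C_mul, C_add, C_sub, C_pow, C_1, C_0] at E' hq'
  simp [P3, P2, P4, hP, gP]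
  linear_combination E' - (X - C x) * (((1 + C a) + C x * (C x * ((1 + C a) + C x * (-1 + C x)))) + (C x * ((1 + C a) + C x * (-1 + C x))) * X + ((1 + C a) + C x * (-1 + C x)) * X ^ 2 + (-1 + C x) * X ^ 3 + X ^ 4) * hq'

lemma lem2 {R : Type*} [CommRing R] (p q Z qi : R) (hq : p * qi = 1)
    (hZ : Z ^ 2 + (p ^ 3 + p * q ^ 2 + q ^ 3) * Z = - p ^ 5 * q + p ^ 4 * q ^ 2 - p ^ 3 * q ^ 3 - p * q ^ 5) :
    ∃ w : Fin 5 → R, P3 ![0, 0, 0, Z * qi ^ 3] ^ 2 + hP R * P3 ![0, 0, 0, Z * qi ^ 3] - gP R =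
      P2 ![0, -p, q] * P4 w := by
  obtain ⟨a, ha⟩ : ∃ a, a = Z * qi ^ 3 := ⟨_, rfl⟩
  obtain ⟨x, hx⟩ : ∃ x, x = q * qi := ⟨_, rfl⟩
  have hp : q = p * x := by rw [hx]; linear_combination (-q) * hq
  have hZa : Z = p ^ 3 * a := by
    rw [ha]; linear_combination (-Z * (p ^ 2 * qi ^ 2 + p * qi + 1)) * hq
  have hq6 : p ^ 6 * qi ^ 6 = 1 := by rw [← mul_pow, hq, one_pow]
  have E : a ^ 2 + (1 + x ^ 2 + x ^ 3) * a + x - x ^ 2 + x ^ 3 + x ^ 5 = 0 := by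
    rw [hp, hZa] at hZ
    linear_combination qi ^ 6 * hZ - (a ^ 2 + (1 + x ^ 2 + x ^ 3) * a + x - x ^ 2 + x ^ 3 + x ^ 5) * hq6
  refine ⟨![-qi, - qi * x, - qi * ((a + 1) + x * x), - qi * ((a - 1) + x * ((a + 1) + x * x)),
    - qi * (1 + x * ((a - 1) + x * ((a + 1) + x * x)))], ?_⟩
  have E' := congrArg (C : R → R[X]) E
  have hq' := congrArg (C : R → R[X]) hq
  rw [hp, ← ha]
  simp only [C_mul, C_add, C_sub, C_pow, C_1, C_0] at E' hq'
  simp [P3, P2, P4, hP, gP]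
  linear_combination X ^ 6 * E' - X * (1 - C x * X) * (1 + C x * X + ((C a + 1) + C x * C x) * X ^ 2 + ((C a - 1) + C x * ((C a + 1) + C x * C x)) * X ^ 3 + (1 + C x * ((C a - 1) + C x * ((C a + 1) + C x * C x))) * X ^ 4) * hq'

lemma isUnit_odd {q : ℤ} (hq : Odd q) : IsUnit (q : Z2) := by
  apply rd_unit
  rw [rd_int, Ne, ZMod.intCast_zmod_eq_zero_iff_dvd]
  obtain ⟨k, rfl⟩ := hq
  push_cast; omega

lemma rd_odd {q : ℤ} (hq : Odd q) : rd (q : Z2) = 1 := rd_of_unit (isUnit_odd hq)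
lemma rd_even {q : ℤ} (hq : Even q) : rd (q : Z2) = 0 := by
  rw [rd_int, ZMod.intCast_zmod_eq_zero_iff_dvd]; exact hq.two_dvd

lemma prim_of {p q : ℤ} (h : IsCoprime p q) (n : Fin 3 → ℤ) (i j : Fin 3) (hi : n i = -p) (hj : n j = q) :
    Prim n := by
  intro r hr hd
  have h1 := hd i
  have h2 := hd j
  rw [hi, dvd_neg] at h1
  rw [hj] at h2
  exact (Nat.prime_iff_prime_int.1 hr).not_isUnit (h.isUnit_of_dvd' h1 h2)

lemma int_main (p q Z : ℤ) (hpq : IsCoprime p q) (hq0 : q ≠ 0) (hZe : Even Z)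
    (hZ : Z ^ 2 + (p ^ 3 + p * q ^ 2 + q ^ 3) * Z = - p ^ 5 * q + p ^ 4 * q ^ 2 - p ^ 3 * q ^ 3 - p * q ^ 5) :
    p = 0 ∨ p = q := by
  have hZq := congrArg (Int.cast (R := ℚ)) hZ
  have hZz := congrArg (Int.cast (R := Z2)) hZ
  push_cast at hZq hZz
  rcases Int.even_or_odd q with hq | hq
  · skip
    exfalso
    have hp : Odd p := by
      rw [← Int.not_even_iff_odd]
      intro hp
      have := hpq.isUnit_of_dvd' hp.two_dvd hq.two_dvd
      rw [Int.isUnit_iff] at this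
      omega
    have hp0 : (p : ℚ) ≠ 0 := by
      rintro h; norm_cast at h; subst h; simp at hp
    obtain ⟨u, hu⟩ := (isUnit_odd hp).exists_right_inv
    obtain ⟨w, hw⟩ := lem2 (p : ℚ) q Z (1 / p) (by field_simp) hZq
    obtain ⟨wz, hwz⟩ := lem2 (p : Z2) q Z u hu hZz
    have e1 : zn ![0, -p, q] = ![0, -(p : Z2), q] := by
      funext k; fin_cases k <;> simp [zn]
    have e2 : qn ![0, -p, q] = ![0, -(p : ℚ), q] := by
      funext k; fin_cases k <;> simp [qn]
    have hu2 : cz u = (p : Q2)⁻¹ := by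
      have := congrArg cz hu
      rw [map_mul, map_one, map_intCast] at this
      exact eq_inv_of_mul_eq_one_right this
    have hmem : ((zn ![0, -p, q], ![0, 0, 0, (Z : Z2) * u ^ 3]) : _ × _) ∈ GG := by
      refine ⟨![0, -p, q], prim_of hpq _ 1 2 rfl rfl, rfl, ![0, 0, 0, (Z : ℚ) * (1 / p) ^ 3], w, ?_, ?_,
        wz, ?_⟩
      · rw [e2]; exact hw
      · intro k; fin_cases k <;> simp [hu2]
      · rw [e1]; exact hwz
    have := closing' GG GG_step _ hmem 0 (by
      have h2 : ∀ k, rd ((![0, 0, 0, (Z : Z2) * u ^ 3] : Fin 4 → Z2) k) = 0 := by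
        intro k; fin_cases k <;> simp [rd_even hZe]
      refine ⟨?_, 1, 0, ?_⟩
      · intro k; fin_cases k <;> simp [e1, rd_odd hp, rd_even hq, nd]
      · simp only [h2]; decide) 2 1
    simp [e1, nd] at this
    exact hq0 this
  · have hq0' : (q : ℚ) ≠ 0 := by exact_mod_cast hq0
    obtain ⟨u, hu⟩ := (isUnit_odd hq).exists_right_inv
    obtain ⟨w, hw⟩ := lem1 (p : ℚ) q Z (1 / q) (by field_simp) hZq
    obtain ⟨wz, hwz⟩ := lem1 (p : Z2) q Z u hu hZz
    have e1 : zn ![-p, q, 0] = ![-(p : Z2), q, 0] := by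
      funext k; fin_cases k <;> simp [zn]
    have e2 : qn ![-p, q, 0] = ![-(p : ℚ), q, 0] := by
      funext k; fin_cases k <;> simp [qn]
    have hu2 : cz u = (q : Q2)⁻¹ := by
      have := congrArg cz hu
      rw [map_mul, map_one, map_intCast] at this
      exact eq_inv_of_mul_eq_one_right this
    have hmem : ((zn ![-p, q, 0], ![(Z : Z2) * u ^ 3, 0, 0, 0]) : _ × _) ∈ GG := by
      refine ⟨![-p, q, 0], prim_of hpq _ 0 1 rfl rfl, rfl, ![(Z : ℚ) * (1 / q) ^ 3, 0, 0, 0], w, ?_, ?_,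
        wz, ?_⟩
      · rw [e2]; exact hw
      · intro k; fin_cases k <;> simp [hu2]
      · rw [e1]; exact hwz
    have h2 : ∀ k, rd ((![(Z : Z2) * u ^ 3, 0, 0, 0] : Fin 4 → Z2) k) = 0 := by
      intro k; fin_cases k <;> simp [rd_even hZe]
    rcases Int.even_or_odd p with hp | hp
    · left
      have := closing' GG GG_step _ hmem 0 (by
        refine ⟨?_, 1, 0, ?_⟩
        · intro k; fin_cases k <;> simp [e1, rd_odd hq, rd_even hp, nd]
        · simp only [h2]; decide) 0 1
      simp [e1, nd] at this
      exact this
    · right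
      have := closing' GG GG_step _ hmem 6 (by
        refine ⟨?_, 1, 1, ?_⟩
        · intro k; fin_cases k <;> simp [e1, rd_odd hq, rd_odd hp, nd]
        · simp only [h2]; decide) 0 1
      simp [e1, nd] at this
      exact_mod_cast this

lemma int_main' (p q Y : ℤ) (hpq : IsCoprime p q) (hq0 : q ≠ 0)
    (hY : Y ^ 2 = p ^ 6 - 4 * p ^ 5 * q + 6 * p ^ 4 * q ^ 2 - 2 * p ^ 3 * q ^ 3 + p ^ 2 * q ^ 4
      - 2 * p * q ^ 5 + q ^ 6) : p = 0 ∨ p = q := by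
  have hodd : Odd (p ^ 3 + p * q ^ 2 + q ^ 3) := by
    rw [← Int.not_even_iff_odd]
    intro he
    have : Even p ∧ Even q := by
      rcases Int.even_or_odd p with h1 | h1 <;> rcases Int.even_or_odd q with h2 | h2
      · exact ⟨h1, h2⟩
      all_goals
        exfalso
        rw [Int.even_iff] at he
        simp only [Int.even_iff, Int.odd_iff] at h1 h2
        have h3 : (p ^ 3 + p * q ^ 2 + q ^ 3) % 2 = ((p % 2) ^ 3 + (p % 2) * (q % 2) ^ 2 + (q % 2) ^ 3) % 2 := by
          simp [Int.add_emod, Int.mul_emod, pow_succ]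
        rw [h1, h2, he] at h3
        norm_num at h3
    have := hpq.isUnit_of_dvd' this.1.two_dvd this.2.two_dvd
    rw [Int.isUnit_iff] at this
    omega
  have hYodd : Odd Y := by
    have h2 : Odd (Y ^ 2) := by
      have : Y ^ 2 = (p ^ 3 + p * q ^ 2 + q ^ 3) ^ 2 + 2 * (2 * (- p ^ 5 * q + p ^ 4 * q ^ 2 - p ^ 3 * q ^ 3 - p * q ^ 5)) := by
        rw [hY]; ring
      rw [this]
      exact hodd.pow.add_even (even_two_mul _)
    exact (Int.odd_pow' two_ne_zero).1 h2
  obtain ⟨Z, hZ⟩ := (hYodd.sub_odd hodd).two_dvd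
  have hZ1 : Z ^ 2 + (p ^ 3 + p * q ^ 2 + q ^ 3) * Z = - p ^ 5 * q + p ^ 4 * q ^ 2 - p ^ 3 * q ^ 3 - p * q ^ 5 := by
    have hYe : Y = p ^ 3 + p * q ^ 2 + q ^ 3 + 2 * Z := by linarith
    rw [hYe] at hY
    have : 4 * (Z ^ 2 + (p ^ 3 + p * q ^ 2 + q ^ 3) * Z) = 4 * (- p ^ 5 * q + p ^ 4 * q ^ 2 - p ^ 3 * q ^ 3 - p * q ^ 5) := by
      linear_combination hY
    linarith
  rcases Int.even_or_odd Z with he | he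
  · exact int_main p q Z hpq hq0 he hZ1
  · exact int_main p q (-Z - (p ^ 3 + p * q ^ 2 + q ^ 3)) hpq hq0 (he.neg.sub_odd hodd)
      (by linear_combination hZ1)

lemma rat_main (x y : ℚ) (h : y ^ 2 = x ^ 6 - 4 * x ^ 5 + 6 * x ^ 4 - 2 * x ^ 3 + x ^ 2 - 2 * x + 1) :
    x = 0 ∨ x = 1 := by
  have hd : (x.den : ℚ) ≠ 0 := by exact_mod_cast x.den_nz
  have hx : x = x.num / x.den := (Rat.num_div_den x).symm
  have hxd : x * x.den = x.num := Rat.mul_den_eq_num x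
  set p := x.num
  set q : ℤ := ((x.den : ℕ) : ℤ) with hq
  have hqq : (x.den : ℚ) = (q : ℚ) := by rw [hq]; simp
  rw [hqq] at hd hx hxd
  have hsq : IsSquare ((p ^ 6 - 4 * p ^ 5 * q + 6 * p ^ 4 * q ^ 2 - 2 * p ^ 3 * q ^ 3 + p ^ 2 * q ^ 4
      - 2 * p * q ^ 5 + q ^ 6 : ℤ) : ℚ) := by
    refine ⟨y * q ^ 3, ?_⟩
    push_cast
    rw [← hxd]
    linear_combination (-(q : ℚ) ^ 6) * h
  rw [Rat.isSquare_intCast_iff] at hsq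
  obtain ⟨Y, hY⟩ := hsq
  have hc : IsCoprime p q := by
    rw [Int.isCoprime_iff_gcd_eq_one]
    exact x.reduced
  have hq0 : q ≠ 0 := by exact_mod_cast hd
  rcases int_main' p q Y hc hq0 (by rw [hY]; ring) with h0 | h0
  · left; rw [hx, h0]; simp
  · right; rw [hx, h0]; field_simp

end Q13

theorem stmt_17 :
    {p : ℚ × ℚ | p.2 ^ 2 = p.1 ^ 6 - 4 * p.1 ^ 5 + 6 * p.1 ^ 4 - 2 * p.1 ^ 3 + p.1 ^ 2 - 2 * p.1 + 1} =
      ({(0, 1), (0, -1), (1, 1), (1, -1)} : Set (ℚ × ℚ)) := by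
  ext ⟨x, y⟩
  simp only [Set.mem_ofPred_eq, Set.mem_insert_iff, Set.mem_singleton_iff, Prod.mk.injEq]
  constructor
  · intro h
    rcases Q13.rat_main x y h with rfl | rfl
    · have : y ^ 2 = 1 := by rw [h]; norm_num
      rcases mul_self_eq_one_iff.1 ((sq y).symm.trans this) with rfl | rfl <;> simp
    · have : y ^ 2 = 1 := by rw [h]; norm_num
      rcases mul_self_eq_one_iff.1 ((sq y).symm.trans this) with rfl | rfl <;> simp
  · rintro (⟨rfl, rfl⟩ | ⟨rfl, rfl⟩ | ⟨rfl, rfl⟩ | ⟨rfl, rfl⟩) <;> norm_num
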